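/- arXiv:1406.2827 — 3 statements merged into one kernel-verified Lean document; each statement's English description precedes it below -/
import Mathlib

section
/- For all integers a ≥ b ≥ 0 with a + b ≥ 6, the presented group G_{5,3,6}(a,b) = ⟨P, Q, R | P⁵, Q³, R⁶, (PQ)², (QR)², (PQR)², (QR⁴)^a (RQR³)^b⟩ is infinite. (This is the dodecahedral case of Theorem 7.1: the universal regular tessellation of type {5,3,6} and cusp modulus z = a+bζ is infinite volume when the combinatorial length ‖z‖ = a+b is at least 6.) -/
/-- The relators of the presentation
⟨P, Q, R | P^p, Q^q, R^r, (PQ)², (QR)², (PQR)², (Q R^{r/2+1})^a (R Q R^{r/2})^b⟩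
of the orientation-preserving symmetry group of the universal regular
tessellation of type {p,q,r} and cusp modulus a+bu, u = e^{2πi/r}.
The generators P, Q, R are `FreeGroup.of 0`, `FreeGroup.of 1`, `FreeGroup.of 2`. -/
def tessRels (p q r a b : ℕ) : Set (FreeGroup (Fin 3)) :=
  {(FreeGroup.of 0) ^ p, (FreeGroup.of 1) ^ q, (FreeGroup.of 2) ^ r,
   (FreeGroup.of 0 * FreeGroup.of 1) ^ 2,
   (FreeGroup.of 1 * FreeGroup.of 2) ^ 2,
   (FreeGroup.of 0 * FreeGroup.of 1 * FreeGroup.of 2) ^ 2,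
   (FreeGroup.of 1 * (FreeGroup.of 2) ^ (r / 2 + 1)) ^ a *
     (FreeGroup.of 2 * FreeGroup.of 1 * (FreeGroup.of 2) ^ (r / 2)) ^ b}

/-- G_{p,q,r}(a,b), the presented group of the above presentation. -/
def tessGroup (p q r a b : ℕ) : Type := PresentedGroup (tessRels p q r a b)

instance (p q r a b : ℕ) : Group (tessGroup p q r a b) :=
  inferInstanceAs (Group (PresentedGroup _))

/-- The directed edges of a nonpositively curved cube complex, recorded through their squares.
`Sq a b b' a'` says that `a` and `b` leave a common corner of a square whose edge opposite
to `b` is `b'` and whose edge opposite to `a` is `a'`, so that the paths `a, b'` and `b, a'` are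
the two sides of that square. The field `exists_cube` is the flag condition on links. -/
structure SquareComplex (E : Type*) where
  inv : E → E
  Sq : E → E → E → E → Prop
  inv_inv : ∀ a, inv (inv a) = a
  symm : ∀ {a b b' a'}, Sq a b b' a' → Sq b a a' b'
  rot : ∀ {a b b' a'}, Sq a b b' a' → Sq (inv a) b' b (inv a')
  uniq : ∀ {a b b' a' b'' a''}, Sq a b b' a' → Sq a b b'' a'' → b' = b'' ∧ a' = a''
  irrefl : ∀ {a b' a'}, ¬ Sq a a b' a'
  exists_cube : ∀ {a b c b₁ a₁ c₁ b₂ c₂ a₂}, Sq a b b₁ a₁ → Sq b c c₁ b₂ → Sq a c c₂ a₂ →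
    ∃ a₃ b₃ c₃, Sq b₁ c₂ c₃ b₃ ∧ Sq a₁ c₁ c₃ a₃ ∧ Sq a₂ b₂ b₃ a₃

namespace SquareComplex

variable {E : Type*} (X : SquareComplex E)

/-- Two edges that span a square. -/
def Adj (a b : E) : Prop := ∃ b' a', X.Sq a b b' a'

open Classical in
/-- The edge opposite to `b` in the square spanned by `a` and `b` (and `b` if there is none). -/
noncomputable def tr (a b : E) : E :=
  if h : ∃ b' a', X.Sq a b b' a' then h.choose else b

variable {X}

theorem Sq.tr_eq {a b b' a' : E} (h : X.Sq a b b' a') : X.tr a b = b' := by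
  have h1 : ∃ b' a', X.Sq a b b' a' := ⟨b', a', h⟩
  rw [tr, dif_pos h1]
  obtain ⟨a'', h2⟩ := h1.choose_spec
  exact (X.uniq h2 h).1

theorem Sq.adj {a b b' a' : E} (h : X.Sq a b b' a') : X.Adj a b := ⟨b', a', h⟩

variable (X)

/-- Edge paths, written with the last edge first, that differ by pushing two consecutive
edges across a square. -/
inductive Swap : List E → List E → Prop
  | swap {b c b' c' : E} (w : List E) (h : X.Sq (X.inv b) c c' (X.inv b')) :
      Swap (c :: b :: w) (b' :: c' :: w)
  | cons (b : E) {u v : List E} (h : Swap u v) : Swap (b :: u) (b :: v)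

/-- Edge paths up to pushing across squares. -/
def Trace : Type _ := Quot X.Swap

open Classical in
/-- If `w` can be pushed across squares to a path ending with the inverse of `e`, remove that last
edge. -/
noncomputable def remList : List E → E → Option (List E)
  | [], _ => none
  | b :: w, e =>
    if e = X.inv b then some w
    else if X.Adj (X.inv b) e then
      (remList w (X.tr (X.inv b) e)).map (fun u => X.tr (X.tr (X.inv b) e) b :: u)
    else none

namespace Trace

variable {X}

/-- The trace of a path. -/
def mk (w : List E) : X.Trace := Quot.mk _ w

/-- Append an edge to a path. -/
def cons (b : E) : X.Trace → X.Trace :=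
  Quot.map (fun w => b :: w) (fun _ _ h => Swap.cons b h)

theorem cons_cons {b c b' c' : E} (h : X.Sq (X.inv b) c c' (X.inv b')) (w : X.Trace) :
    cons c (cons b w) = cons b' (cons c' w) := by
  induction w using Quot.ind with
  | mk w => exact Quot.sound (Swap.swap w h)

end Trace

/-- `SquareComplex.remList` with values in traces. -/
noncomputable def remMk (w : List E) (e : E) : Option X.Trace :=
  (X.remList w e).map Trace.mk

theorem remMk_cons_self (b : E) (w : List E) :
    X.remMk (b :: w) (X.inv b) = some (Trace.mk w) := by
  rw [remMk, remList, if_pos rfl]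
  rfl

variable {X} in
theorem remMk_cons_of_sq {b e e' b' : E} (h : X.Sq (X.inv b) e e' (X.inv b')) (w : List E) :
    X.remMk (b :: w) e = (X.remMk w e').map (Trace.cons b') := by
  have h1 : e ≠ X.inv b := by
    rintro rfl
    exact X.irrefl h
  have h2 : X.tr e' b = b' := by
    have := X.symm (X.rot h)
    rw [X.inv_inv, X.inv_inv] at this
    exact this.tr_eq
  rw [remMk, remList, if_neg h1, if_pos h.adj, h.tr_eq, h2, remMk, Option.map_map, Option.map_map]
  rfl

variable {X} in
theorem remMk_cons_of_not {b e : E} (h1 : e ≠ X.inv b) (h2 : ¬ X.Adj (X.inv b) e)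
    (w : List E) : X.remMk (b :: w) e = none := by
  rw [remMk, remList, if_neg h1, if_neg h2]
  rfl

variable {X} in
theorem not_adj_of_sq {a b b' a' e e' f' : E} (h : X.Sq a b b' a') (h1 : X.Sq a e e' f')
    (h2 : ¬ X.Adj b e) : ¬ X.Adj b' e' := by
  rintro ⟨x, y, h3⟩
  obtain ⟨_, _, _, h4, -, -⟩ := X.exists_cube (X.rot h) h3 (X.rot h1)
  exact h2 h4.adj

variable {X} in
theorem remMk_none_of_sq {b c b' c' e : E} (h : X.Sq (X.inv b) c c' (X.inv b'))
    (h2 : e ≠ X.inv b') (h3 : X.Adj (X.inv c) e)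
    (h4 : ¬ X.Adj (X.inv b') e) (w : List E) : X.remMk (c :: b :: w) e = none := by
  have hz : X.Sq (X.inv c) (X.inv b') (X.inv b) (X.inv c') := X.rot (X.symm h)
  obtain ⟨e', f', h5⟩ := h3
  have h6 : X.Sq (X.inv c) e e' (X.inv (X.inv f')) := by rwa [X.inv_inv]
  rw [remMk_cons_of_sq h6, remMk_cons_of_not]
  · rfl
  · rintro rfl
    have := X.uniq (X.rot h5) (X.rot hz)
    exact h2 this.1
  · exact not_adj_of_sq hz h5 h4

theorem remMk_swap {w w' : List E} (h : X.Swap w w') (e : E) :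
    X.remMk w e = X.remMk w' e := by
  induction h generalizing e with
  | @swap b c b' c' w h =>
    have hz : X.Sq (X.inv c) (X.inv b') (X.inv b) (X.inv c') := X.rot (X.symm h)
    have h' : X.Sq (X.inv c') b' b (X.inv c) := by
      simpa only [X.inv_inv] using X.rot (X.symm (X.rot h))
    by_cases h1 : e = X.inv c
    · subst h1
      rw [remMk_cons_self, remMk_cons_of_sq (X.symm hz), remMk_cons_self]
      rfl
    by_cases h2 : e = X.inv b'
    · subst h2
      rw [remMk_cons_self, remMk_cons_of_sq hz, remMk_cons_self]
      rfl
    by_cases h3 : X.Adj (X.inv c) e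
    · by_cases h4 : X.Adj (X.inv b') e
      · obtain ⟨e₁, p, h3⟩ := h3
        obtain ⟨e₂, q, h4⟩ := h4
        obtain ⟨r, s, t, k1, k2, k3⟩ := X.exists_cube hz h4 h3
        rw [← X.inv_inv p] at h3 k3
        rw [← X.inv_inv q] at h4 k3
        rw [← X.inv_inv r] at k2
        rw [← X.inv_inv s] at k1
        rw [remMk_cons_of_sq h3, remMk_cons_of_sq h4, remMk_cons_of_sq k1, remMk_cons_of_sq k2,
          Option.map_map, Option.map_map]
        congr 1
        funext x
        refine Trace.cons_cons ?_ x
        simp only [X.inv_inv] at k3 ⊢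
        exact X.symm (X.rot k3)
      · rw [remMk_none_of_sq h h2 h3 h4, remMk_cons_of_not h2 h4]
    · rw [remMk_cons_of_not h1 h3]
      by_cases h4 : X.Adj (X.inv b') e
      · rw [remMk_none_of_sq h' h1 h4 h3]
      · rw [remMk_cons_of_not h2 h4]
  | @cons b w w' h ih =>
    by_cases h1 : e = X.inv b
    · subst h1
      rw [remMk_cons_self, remMk_cons_self]
      exact congrArg some (Quot.sound h)
    by_cases h2 : X.Adj (X.inv b) e
    · obtain ⟨e', f', h2⟩ := h2
      rw [← X.inv_inv f'] at h2
      rw [remMk_cons_of_sq h2, remMk_cons_of_sq h2, ih]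
    · rw [remMk_cons_of_not h1 h2, remMk_cons_of_not h1 h2]

namespace Trace

variable {X}

@[elab_as_elim]
theorem ind {p : X.Trace → Prop} (h : ∀ w, p (mk w)) (x : X.Trace) : p x := Quot.ind h x

/-- The number of edges of a path. -/
def length : X.Trace → ℕ :=
  Quot.lift List.length fun w w' h => by
    induction h with
    | swap w h => rfl
    | cons b h ih => exact congrArg Nat.succ ih

theorem length_cons (b : E) (x : X.Trace) : length (cons b x) = length x + 1 := by
  induction x using ind with
  | h w => rfl

/-- Remove the inverse of `e` from the end of a path, if possible. -/
noncomputable def rem : X.Trace → E → Option X.Trace :=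
  Quot.lift X.remMk fun _ _ h => funext (X.remMk_swap h)

theorem rem_cons_self (b : E) (x : X.Trace) : rem (cons b x) (X.inv b) = some x := by
  induction x using ind with
  | h w => exact X.remMk_cons_self b w

theorem rem_cons_of_sq {b e e' b' : E} (h : X.Sq (X.inv b) e e' (X.inv b')) (x : X.Trace) :
    rem (cons b x) e = (rem x e').map (cons b') := by
  induction x using ind with
  | h w => exact remMk_cons_of_sq h w

theorem rem_cons_of_not {b e : E} (h1 : e ≠ X.inv b) (h2 : ¬ X.Adj (X.inv b) e)
    (x : X.Trace) : rem (cons b x) e = none := by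
  induction x using ind with
  | h w => exact remMk_cons_of_not h1 h2 w

theorem rem_nil (e : E) : rem (mk [] : X.Trace) e = none := rfl

theorem eq_cons_of_rem {x u : X.Trace} {e : E} (h : rem x e = some u) :
    x = cons (X.inv e) u := by
  induction x using ind with
  | h w =>
    induction w generalizing e u with
    | nil => simp [rem_nil] at h
    | cons b w ih =>
      change rem (cons b (mk w)) e = some u at h
      change cons b (mk w) = _
      by_cases h1 : e = X.inv b
      · subst h1
        rw [rem_cons_self, Option.some_inj] at h
        rw [h, X.inv_inv]
      by_cases h2 : X.Adj (X.inv b) e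
      · obtain ⟨e', f, h2⟩ := h2
        rw [← X.inv_inv f] at h2
        rw [rem_cons_of_sq h2, Option.map_eq_some_iff] at h
        obtain ⟨v, hv, rfl⟩ := h
        rw [ih hv]
        refine cons_cons ?_ v
        simp only [X.inv_inv] at h2 ⊢
        simpa only [X.inv_inv] using X.symm (X.rot h2)
      · rw [rem_cons_of_not h1 h2] at h
        simp at h

/-- A path is reduced if no edge can be cancelled after pushing edges across squares. -/
def Reduced : X.Trace → Prop :=
  Quot.lift (fun w => List.rec True (fun b w ih => ih ∧ X.remMk w b = none) w) fun w w' h => by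
    induction h with
    | @swap b c b' c' w h =>
      have h' : X.Sq (X.inv c') b' b (X.inv c) := by
        simpa only [X.inv_inv] using X.rot (X.symm (X.rot h))
      simp only [remMk_cons_of_sq h, remMk_cons_of_sq h', Option.map_eq_none_iff, eq_iff_iff]
      tauto
    | cons b h ih => simp only [ih, X.remMk_swap h]

theorem reduced_nil : Reduced (mk [] : X.Trace) := trivial

theorem reduced_cons {b : E} {x : X.Trace} :
    Reduced (cons b x) ↔ Reduced x ∧ rem x b = none := by
  induction x using ind with
  | h w => exact Iff.rfl

end Trace

/-- Reduced paths up to pushing across squares: the vertices of the universal cover. -/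
def Cover : Type _ := {x : X.Trace // x.Reduced}

namespace Cover

variable {X}

open Trace

/-- Move along an edge. -/
noncomputable def move (e : E) (x : X.Cover) : X.Cover :=
  match h : rem x.1 e with
  | some u => ⟨u, by
      have := x.2
      rw [eq_cons_of_rem h, reduced_cons] at this
      exact this.1⟩
  | none => ⟨cons e x.1, reduced_cons.2 ⟨x.2, h⟩⟩

theorem move_of_none {e : E} {x : X.Cover} (h : rem x.1 e = none) :
    (move e x).1 = cons e x.1 := by
  unfold move
  split
  · simp_all
  · rfl

theorem move_of_some {e : E} {x : X.Cover} {u : X.Trace} (h : rem x.1 e = some u) :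
    (move e x).1 = u := by
  unfold move
  split
  · simp_all
  · simp_all

theorem rem_of_eq_cons {e : E} {x : X.Cover} {u : X.Trace} (h : x.1 = cons e u) :
    rem u e = none := (reduced_cons.1 (h ▸ x.2)).2

theorem move_inv_move (e : E) (x : X.Cover) : move (X.inv e) (move e x) = x := by
  apply Subtype.ext
  cases h : rem x.1 e with
  | none =>
    apply move_of_some
    rw [move_of_none h, rem_cons_self]
  | some u =>
    have hx := eq_cons_of_rem h
    have h1 := rem_of_eq_cons hx
    rw [← move_of_some h] at h1
    rw [move_of_none h1, move_of_some h, ← hx]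

theorem move_move_inv (e : E) (x : X.Cover) : move e (move (X.inv e) x) = x := by
  have := move_inv_move (X.inv e) x
  rwa [X.inv_inv] at this

theorem rem_move_of_none {a b b' a' : E} (h : X.Sq a b b' a') {x : X.Cover}
    (ha : rem x.1 a = none) : rem (move a x).1 b' = (rem x.1 b).map (cons a') := by
  rw [move_of_none ha]
  exact rem_cons_of_sq (X.rot h) x.1

theorem move_move_of_none_of_some {a b b' a' : E} (h : X.Sq a b b' a') {x : X.Cover}
    (ha : rem x.1 a = none) {u : X.Trace} (hb : rem x.1 b = some u) :
    move b' (move a x) = move a' (move b x) := by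
  have h1 := rem_move_of_none h ha
  rw [hb] at h1
  apply Subtype.ext
  rw [move_of_some h1]
  have h2 : rem (move b x).1 a' = none := by
    rw [move_of_some hb]
    have h3 := eq_cons_of_rem hb
    rw [h3, rem_cons_of_sq (e' := a') (b' := X.inv b')] at ha
    · simpa using ha
    · simpa only [X.inv_inv] using X.symm h
  rw [move_of_none h2, move_of_some hb]

theorem move_move {a b b' a' : E} (h : X.Sq a b b' a') (x : X.Cover) :
    move b' (move a x) = move a' (move b x) := by
  cases ha : rem x.1 a with
  | none =>
    cases hb : rem x.1 b with
    | none =>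
      have h1 := rem_move_of_none h ha
      have h2 := rem_move_of_none (X.symm h) hb
      rw [hb] at h1
      rw [ha] at h2
      apply Subtype.ext
      rw [move_of_none h1, move_of_none h2, move_of_none ha, move_of_none hb]
      apply cons_cons
      exact X.rot h
    | some u => exact move_move_of_none_of_some h ha hb
  | some u =>
    cases hb : rem x.1 b with
    | none => exact (move_move_of_none_of_some (X.symm h) hb ha).symm
    | some v =>
      have h1 := eq_cons_of_rem ha
      have h2 := hb
      rw [h1, rem_cons_of_sq (e' := b') (b' := X.inv a') (by simpa only [X.inv_inv] using h),
        Option.map_eq_some_iff] at h2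
      obtain ⟨p, hp, rfl⟩ := h2
      apply Subtype.ext
      rw [move_of_some (u := p), move_of_some (u := p)]
      · rw [move_of_some hb]
        have := rem_cons_self (X.inv a') p
        rwa [X.inv_inv] at this
      · rwa [move_of_some ha]

end Cover

end SquareComplex

open scoped Pointwise

/-- Three elements of a group subject to the relations between the rotations `P` of a face, `Q` of a
vertex figure and `R` of an edge in a regular tessellation by dodecahedra, together with the
conditions that make the links of the tessellation flag complexes: `K 0`, `K 1`, `K 2` are the
stabilizers of the flags of type cell-face, face-edge, edge-vertex, and `τ 0`, `τ 1` are the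
half-turns stabilizing a flag of type cell-edge, face-vertex. -/
structure DodecahedralTriple (F : Type*) [Group F] where
  P : F
  Q : F
  R : F
  K : Fin 3 → Subgroup F
  τ : Fin 2 → F
  Q_pow : Q ^ 3 = 1
  PQ_pow : (P * Q) ^ 2 = 1
  QR_pow : (Q * R) ^ 2 = 1
  PQR_pow : (P * Q * R) ^ 2 = 1
  P_mem : P ∈ K 0
  PQR_mem : P * Q * R ∈ K 1
  R_mem : R ∈ K 2
  eq_or_eq_of_mem : ∀ x ∈ K 1, x = 1 ∨ x = P * Q * R
  τ_zero : τ 0 = P * Q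
  τ_one : τ 1 = Q * R
  notMem_castSucc : ∀ i : Fin 2, τ i ∉ K i.castSucc
  notMem_succ : ∀ i : Fin 2, τ i ∉ K i.succ
  QR_notMem : Q * R ∉ K 0
  top_eq_one : ∀ i : Fin 2, ∀ x ∈ K i.castSucc, τ i * x * τ i ∈ K i.castSucc → x = 1
  mid_eq_one : ∀ i : Fin 2, ∀ x ∈ K i.castSucc, x ∈ K i.succ → x = 1
  bot_eq_one : ∀ i : Fin 2, ∀ x ∈ K i.succ, τ i * x * τ i ∈ K i.succ → x = 1
  top_zero : ∀ x ∈ K 0, ∀ y ∈ K 0, ∀ z ∈ K 0,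
    τ 0 * x * τ 0 = y * τ 0 * z → x = P ∨ x = P⁻¹
  top_one : ∀ x ∈ K 1, ∀ y ∈ K 1, ∀ z ∈ K 1, τ 1 * x * τ 1 ≠ y * τ 1 * z
  bot_zero : ∀ x ∈ K 1, ∀ y ∈ K 1, ∀ z ∈ K 1, τ 0 * x * τ 0 ≠ y * τ 0 * z
  bot_one : ∀ x ∈ K 2, ∀ y ∈ K 2, ∀ z ∈ K 2,
    τ 1 * x * τ 1 = y * τ 1 * z → x = R ∨ x = R⁻¹

namespace DodecahedralTriple

variable {F : Type*} [Group F] (D : DodecahedralTriple F)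

/-- The edge of type `i` at the flag `g`, directed downwards if `d` holds. -/
def edge (i : Fin 3) (d : Bool) (g : F) : Fin 3 × Bool × Set F := (i, d, g • (D.K i : Set F))

theorem edge_eq_iff {i j : Fin 3} {d e : Bool} {g h : F} :
    D.edge i d g = D.edge j e h ↔ i = j ∧ d = e ∧ g⁻¹ * h ∈ D.K i := by
  simp only [edge, Prod.mk.injEq]
  constructor
  · rintro ⟨rfl, rfl, h⟩
    exact ⟨rfl, rfl, (leftCoset_eq_iff _).1 h⟩
  · rintro ⟨rfl, rfl, h⟩
    exact ⟨rfl, rfl, (leftCoset_eq_iff _).2 h⟩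

theorem edge_eq {i : Fin 3} {d : Bool} {g h : F} (H : g⁻¹ * h ∈ D.K i) :
    D.edge i d g = D.edge i d h := D.edge_eq_iff.2 ⟨rfl, rfl, H⟩

/-- The squares of the tessellation, subdivided into cubes. -/
def Sq (a b b' a' : Fin 3 × Bool × Set F) : Prop :=
  ∃ (i : Fin 2) (k : F),
    (a = D.edge i.castSucc true k ∧ b = D.edge i.castSucc true (k * D.τ i) ∧
      b' = D.edge i.succ true k ∧ a' = D.edge i.succ true (k * D.τ i)) ∨
    (a = D.edge i.castSucc false k ∧ b = D.edge i.succ true k ∧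
      b' = D.edge i.castSucc true (k * D.τ i) ∧ a' = D.edge i.succ false (k * D.τ i)) ∨
    (a = D.edge i.succ true k ∧ b = D.edge i.castSucc false k ∧
      b' = D.edge i.succ false (k * D.τ i) ∧ a' = D.edge i.castSucc true (k * D.τ i)) ∨
    (a = D.edge i.succ false k ∧ b = D.edge i.succ false (k * D.τ i) ∧
      b' = D.edge i.castSucc false k ∧ a' = D.edge i.castSucc false (k * D.τ i))

theorem sq_top (i : Fin 2) (k : F) :
    D.Sq (D.edge i.castSucc true k) (D.edge i.castSucc true (k * D.τ i))
      (D.edge i.succ true k) (D.edge i.succ true (k * D.τ i)) :=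
  ⟨i, k, Or.inl ⟨rfl, rfl, rfl, rfl⟩⟩

theorem τ_mul_τ (i : Fin 2) : D.τ i * D.τ i = 1 := by
  rw [← pow_two]
  match i with
  | 0 => rw [D.τ_zero, D.PQ_pow]
  | 1 => rw [D.τ_one, D.QR_pow]

theorem mul_τ_mul_τ (k : F) (i : Fin 2) : k * D.τ i * D.τ i = k := by
  rw [mul_assoc, D.τ_mul_τ, mul_one]

theorem τ_inv (i : Fin 2) : (D.τ i)⁻¹ = D.τ i := inv_eq_of_mul_eq_one_left (D.τ_mul_τ i)

/-- Reverse the direction of an edge. -/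
def reverse (a : Fin 3 × Bool × Set F) : Fin 3 × Bool × Set F := (a.1, !a.2.1, a.2.2)

variable {D} {a b c b' a' b'' a'' : Fin 3 × Bool × Set F}

theorem Sq.symm (h : D.Sq a b b' a') : D.Sq b a a' b' := by
  obtain ⟨i, k, ⟨rfl, rfl, rfl, rfl⟩ | ⟨rfl, rfl, rfl, rfl⟩ | ⟨rfl, rfl, rfl, rfl⟩ |
    ⟨rfl, rfl, rfl, rfl⟩⟩ := h
  · exact ⟨i, k * D.τ i, Or.inl (by simp only [D.mul_τ_mul_τ, and_self])⟩
  · exact ⟨i, k, Or.inr (Or.inr (Or.inl ⟨rfl, rfl, rfl, rfl⟩))⟩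
  · exact ⟨i, k, Or.inr (Or.inl ⟨rfl, rfl, rfl, rfl⟩)⟩
  · exact ⟨i, k * D.τ i, Or.inr (Or.inr (Or.inr (by simp only [D.mul_τ_mul_τ, and_self])))⟩

theorem Sq.rot (h : D.Sq a b b' a') : D.Sq (reverse a) b' b (reverse a') := by
  obtain ⟨i, k, ⟨rfl, rfl, rfl, rfl⟩ | ⟨rfl, rfl, rfl, rfl⟩ | ⟨rfl, rfl, rfl, rfl⟩ |
    ⟨rfl, rfl, rfl, rfl⟩⟩ := h
  · exact ⟨i, k, Or.inr (Or.inl ⟨rfl, rfl, rfl, rfl⟩)⟩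
  · exact ⟨i, k, Or.inl ⟨rfl, rfl, rfl, rfl⟩⟩
  · exact ⟨i, k, Or.inr (Or.inr (Or.inr ⟨rfl, rfl, rfl, rfl⟩))⟩
  · exact ⟨i, k, Or.inr (Or.inr (Or.inl ⟨rfl, rfl, rfl, rfl⟩))⟩

theorem Sq.irrefl : ¬ D.Sq a a b' a' := by
  rintro ⟨i, k, ⟨rfl, h, -, -⟩ | ⟨rfl, h, -, -⟩ | ⟨rfl, h, -, -⟩ | ⟨rfl, h, -, -⟩⟩ <;>
    simp only [edge_eq_iff, true_and, inv_mul_cancel_left] at h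
  · exact D.notMem_castSucc i h
  · simp at h
  · simp at h
  · exact D.notMem_succ i h

theorem eq_of_top {i : Fin 2} {k l : F} (h1 : k⁻¹ * l ∈ D.K i.castSucc)
    (h2 : (k * D.τ i)⁻¹ * (l * D.τ i) ∈ D.K i.castSucc) : k = l := by
  rw [← inv_mul_eq_one]
  refine D.top_eq_one i _ h1 ?_
  rwa [mul_inv_rev, D.τ_inv, mul_assoc, ← mul_assoc k⁻¹, ← mul_assoc] at h2

theorem eq_of_bot {i : Fin 2} {k l : F} (h1 : k⁻¹ * l ∈ D.K i.succ)
    (h2 : (k * D.τ i)⁻¹ * (l * D.τ i) ∈ D.K i.succ) : k = l := by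
  rw [← inv_mul_eq_one]
  refine D.bot_eq_one i _ h1 ?_
  rwa [mul_inv_rev, D.τ_inv, mul_assoc, ← mul_assoc k⁻¹, ← mul_assoc] at h2

theorem eq_of_mid {i : Fin 2} {k l : F} (h1 : k⁻¹ * l ∈ D.K i.castSucc)
    (h2 : k⁻¹ * l ∈ D.K i.succ) : k = l := by
  rw [← inv_mul_eq_one]
  exact D.mid_eq_one i _ h1 h2

theorem Sq.uniq (h : D.Sq a b b' a') (h' : D.Sq a b b'' a'') : b' = b'' ∧ a' = a'' := by
  obtain ⟨i, k, ⟨rfl, rfl, rfl, rfl⟩ | ⟨rfl, rfl, rfl, rfl⟩ | ⟨rfl, rfl, rfl, rfl⟩ |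
    ⟨rfl, rfl, rfl, rfl⟩⟩ := h <;>
  obtain ⟨j, l, ⟨h1, h2, rfl, rfl⟩ | ⟨h1, h2, rfl, rfl⟩ | ⟨h1, h2, rfl, rfl⟩ |
    ⟨h1, h2, rfl, rfl⟩⟩ := h' <;>
  simp only [edge_eq_iff, Fin.castSucc_inj, Fin.succ_inj, reduceCtorEq, false_and, and_false,
    true_and] at h1 h2
  · obtain ⟨rfl, h1⟩ := h1
    rw [eq_of_top h1 h2.2]
    exact ⟨rfl, rfl⟩
  · obtain ⟨rfl, h1⟩ := h1
    rw [eq_of_mid h1 h2.2]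
    exact ⟨rfl, rfl⟩
  · obtain ⟨rfl, h1⟩ := h1
    rw [eq_of_mid h2.2 h1]
    exact ⟨rfl, rfl⟩
  · obtain ⟨rfl, h1⟩ := h1
    rw [eq_of_bot h1 h2.2]
    exact ⟨rfl, rfl⟩

theorem QR_mul_QR : D.Q * D.R * (D.Q * D.R) = 1 := by rw [← pow_two, D.QR_pow]

theorem PQR_mul_PQR : D.P * D.Q * D.R * (D.P * D.Q * D.R) = 1 := by rw [← pow_two, D.PQR_pow]

variable (D)

theorem edge_zero_mul_Q (d : Bool) (k : F) :
    D.edge 0 d (k * D.Q⁻¹) = D.edge 0 d (k * D.τ 0) := by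
  apply D.edge_eq
  rw [← D.τ_inv, D.τ_zero]
  have := D.K 0 |>.inv_mem D.P_mem
  convert this using 1
  group

theorem edge_two_mul_Q (d : Bool) (k : F) :
    D.edge 2 d (k * D.Q) = D.edge 2 d (k * D.τ 1) := by
  apply D.edge_eq
  rw [D.τ_one]
  convert D.R_mem using 1
  group

theorem edge_one_mul_Q (d : Bool) (k : F) :
    D.edge 1 d (k * D.Q⁻¹ * D.τ 1) = D.edge 1 d (k * D.τ 0) := by
  apply D.edge_eq
  rw [← D.τ_inv 0, D.τ_zero, D.τ_one]
  convert D.K 1 |>.inv_mem D.PQR_mem using 1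
  group

theorem edge_zero_mul_P (d : Bool) (k : F) : D.edge 0 d (k * D.P) = D.edge 0 d k :=
  (D.edge_eq (by simpa using D.P_mem)).symm

theorem edge_one_mul_PQR (d : Bool) (k : F) :
    D.edge 1 d (k * (D.P * D.Q * D.R)) = D.edge 1 d k :=
  (D.edge_eq (by simpa using D.PQR_mem)).symm

theorem edge_two_mul_R (d : Bool) (k : F) : D.edge 2 d (k * D.R) = D.edge 2 d k :=
  (D.edge_eq (by simpa using D.R_mem)).symm

/-- The twelve edges of a cube, three at a corner, six in the middle and three at the
opposite corner. -/
def IsCube (a b c b₁ a₁ c₁ b₂ c₂ a₂ a₃ b₃ c₃ : Fin 3 × Bool × Set F) : Prop :=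
  D.Sq a b b₁ a₁ ∧ D.Sq b c c₁ b₂ ∧ D.Sq a c c₂ a₂ ∧
    D.Sq b₁ c₂ c₃ b₃ ∧ D.Sq a₁ c₁ c₃ a₃ ∧ D.Sq a₂ b₂ b₃ a₃

/-- Three edges that span a cube. -/
def SpanCube (a b c : Fin 3 × Bool × Set F) : Prop :=
  ∃ b₁ a₁ c₁ b₂ c₂ a₂ a₃ b₃ c₃, D.IsCube a b c b₁ a₁ c₁ b₂ c₂ a₂ a₃ b₃ c₃

variable {D}

theorem IsCube.rot {a b c b₁ a₁ c₁ b₂ c₂ a₂ a₃ b₃ c₃ : Fin 3 × Bool × Set F}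
    (h : D.IsCube a b c b₁ a₁ c₁ b₂ c₂ a₂ a₃ b₃ c₃) :
    D.IsCube (reverse a) b₁ c₂ b (reverse a₁) c₃ b₃ c (reverse a₂) (reverse a₃) b₂ c₁ := by
  obtain ⟨h1, h2, h3, h4, h5, h6⟩ := h
  exact ⟨h1.rot, h4, h3.rot, h2, h5.rot, h6.rot⟩

theorem IsCube.span {a b c b₁ a₁ c₁ b₂ c₂ a₂ a₃ b₃ c₃ : Fin 3 × Bool × Set F}
    (h : D.IsCube a b c b₁ a₁ c₁ b₂ c₂ a₂ a₃ b₃ c₃) : D.SpanCube a b c :=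
  ⟨_, _, _, _, _, _, _, _, _, h⟩

theorem IsCube.swap {a b c b₁ a₁ c₁ b₂ c₂ a₂ a₃ b₃ c₃ : Fin 3 × Bool × Set F}
    (h : D.IsCube a b c b₁ a₁ c₁ b₂ c₂ a₂ a₃ b₃ c₃) :
    D.IsCube b a c a₁ b₁ c₂ a₂ c₁ b₂ b₃ a₃ c₃ := by
  obtain ⟨h1, h2, h3, h4, h5, h6⟩ := h
  exact ⟨h1.symm, h3, h2, h5, h4, h6.symm⟩

theorem IsCube.swap' {a b c b₁ a₁ c₁ b₂ c₂ a₂ a₃ b₃ c₃ : Fin 3 × Bool × Set F}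
    (h : D.IsCube a b c b₁ a₁ c₁ b₂ c₂ a₂ a₃ b₃ c₃) :
    D.IsCube a c b c₂ a₂ b₂ c₁ b₁ a₁ a₃ c₃ b₃ := by
  obtain ⟨h1, h2, h3, h4, h5, h6⟩ := h
  exact ⟨h3, h2.symm, h1, h4.symm, h6, h5⟩

theorem SpanCube.swap (h : D.SpanCube a b c) : D.SpanCube b a c := by
  obtain ⟨_, _, _, _, _, _, _, _, _, h⟩ := h
  exact h.swap.span

theorem SpanCube.swap' (h : D.SpanCube a b c) : D.SpanCube a c b := by
  obtain ⟨_, _, _, _, _, _, _, _, _, h⟩ := h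
  exact h.swap'.span

variable (D)

theorem sq_zero (k : F) :
    D.Sq (D.edge 0 true k) (D.edge 0 true (k * D.τ 0)) (D.edge 1 true k)
      (D.edge 1 true (k * D.τ 0)) := D.sq_top 0 k

theorem sq_one (k : F) :
    D.Sq (D.edge 1 true k) (D.edge 1 true (k * D.τ 1)) (D.edge 2 true k)
      (D.edge 2 true (k * D.τ 1)) := D.sq_top 1 k

theorem isCube_cell (k : F) :
    D.IsCube (D.edge 0 true k) (D.edge 0 true (k * D.Q⁻¹)) (D.edge 0 true (k * D.Q))
      (D.edge 1 true k) (D.edge 1 true (k * D.τ 0))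
      (D.edge 1 true (k * D.Q⁻¹)) (D.edge 1 true (k * D.Q * D.τ 1))
      (D.edge 1 true (k * D.τ 1)) (D.edge 1 true (k * D.Q))
      (D.edge 2 true (k * D.Q⁻¹)) (D.edge 2 true (k * D.Q)) (D.edge 2 true k) := by
  have hQ : k * D.Q * D.Q⁻¹ = k := by group
  have hQ' : k * D.Q⁻¹ * D.Q = k := by group
  have hQ2 : k * D.Q⁻¹ * D.Q⁻¹ = k * D.Q := by
    rw [mul_assoc]
    congr 1
    rw [← mul_inv_rev, inv_eq_iff_mul_eq_one, mul_assoc, ← pow_two, ← pow_succ', D.Q_pow]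
  have hQ3 : k * D.Q * D.Q = k * D.Q⁻¹ := by rw [← hQ2]; group
  have h1 := D.sq_zero k
  have h2 := D.sq_zero (k * D.Q⁻¹)
  have h3 := (D.sq_zero (k * D.Q)).symm
  have h4 := D.sq_one k
  have h5 := (D.sq_one (k * D.Q⁻¹)).symm
  have h6 := D.sq_one (k * D.Q)
  simp only [← edge_two_mul_Q, ← edge_zero_mul_Q] at h1 h2 h3 h4 h5 h6
  rw [← D.edge_one_mul_Q _ (k * D.Q⁻¹), hQ2] at h2
  rw [← D.edge_one_mul_Q _ (k * D.Q), hQ] at h3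
  rw [D.edge_one_mul_Q, hQ'] at h5
  rw [hQ3] at h6
  exact ⟨h1, h2, h3, h4, h5, h6⟩

theorem spanCube_zero (k : F) : D.SpanCube (D.edge 0 true k) (D.edge 0 true (k * D.τ 0))
    (D.edge 0 true (k * D.Q)) := by
  have := (D.isCube_cell k).span
  rwa [edge_zero_mul_Q] at this

theorem spanCube_one (k : F) : D.SpanCube (D.edge 0 false k) (D.edge 1 true k)
    (D.edge 1 true (k * D.τ 1)) :=
  (D.isCube_cell k).rot.span

theorem spanCube_two (k : F) : D.SpanCube (D.edge 1 false k) (D.edge 1 false (k * D.τ 0))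
    (D.edge 2 true k) :=
  (D.isCube_cell k).rot.swap.rot.span

theorem spanCube_three (k : F) : D.SpanCube (D.edge 2 false k) (D.edge 2 false (k * D.τ 1))
    (D.edge 2 false (k * D.Q⁻¹)) := by
  have := (D.isCube_cell k).rot.swap.rot.swap'.swap.rot.span
  rwa [edge_two_mul_Q] at this

variable {D}

variable (D) in
/-- Two edges at the center of a cell or of a face that span a square. -/
def AdjTop (a b : Fin 3 × Bool × Set F) : Prop :=
  ∃ (i : Fin 2) (k : F), a = D.edge i.castSucc true k ∧ b = D.edge i.castSucc true (k * D.τ i)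

variable (D) in
/-- Two edges in different directions that span a square. -/
def AdjMid (a b : Fin 3 × Bool × Set F) : Prop :=
  ∃ (i : Fin 2) (k : F), a = D.edge i.castSucc false k ∧ b = D.edge i.succ true k

variable (D) in
/-- Two edges at a vertex or at the center of an edge that span a square. -/
def AdjBot (a b : Fin 3 × Bool × Set F) : Prop :=
  ∃ (i : Fin 2) (k : F), a = D.edge i.succ false k ∧ b = D.edge i.succ false (k * D.τ i)

theorem Sq.adj (h : D.Sq a b b' a') :
    D.AdjTop a b ∨ D.AdjMid a b ∨ D.AdjMid b a ∨ D.AdjBot a b := by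
  obtain ⟨i, k, ⟨h1, h2, -, -⟩ | ⟨h1, h2, -, -⟩ | ⟨h1, h2, -, -⟩ | ⟨h1, h2, -, -⟩⟩ := h
  exacts [.inl ⟨i, k, h1, h2⟩, .inr (.inl ⟨i, k, h1, h2⟩), .inr (.inr (.inl ⟨i, k, h2, h1⟩)),
    .inr (.inr (.inr ⟨i, k, h1, h2⟩))]

theorem AdjTop.dir (h : D.AdjTop a b) : a.2.1 = true ∧ b.2.1 = true := by
  obtain ⟨i, k, rfl, rfl⟩ := h
  exact ⟨rfl, rfl⟩

theorem AdjMid.dir (h : D.AdjMid a b) : a.2.1 = false ∧ b.2.1 = true := by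
  obtain ⟨i, k, rfl, rfl⟩ := h
  exact ⟨rfl, rfl⟩

theorem AdjBot.dir (h : D.AdjBot a b) : a.2.1 = false ∧ b.2.1 = false := by
  obtain ⟨i, k, rfl, rfl⟩ := h
  exact ⟨rfl, rfl⟩

theorem τ_conj (i : Fin 2) (k l m : F) : D.τ i * (k⁻¹ * m) * D.τ i =
    (k * D.τ i)⁻¹ * l * D.τ i * ((l * D.τ i)⁻¹ * (m * D.τ i)) := by
  rw [mul_inv_rev, mul_inv_rev, D.τ_inv]
  have := D.τ_mul_τ i
  calc _ = D.τ i * k⁻¹ * l * 1 * l⁻¹ * m * D.τ i := by group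
    _ = _ := by rw [← this]; simp only [mul_assoc]

theorem R_mul_τ : D.R * D.τ 1 = D.Q⁻¹ := by
  rw [D.τ_one, eq_inv_iff_mul_eq_one, mul_assoc, mul_eq_one_iff_eq_inv', ← mul_eq_one_iff_eq_inv]
  rw [← D.QR_mul_QR]
  simp only [mul_assoc]

theorem PQR_mul_τ_one : D.P * D.Q * D.R * D.τ 1 = D.P := by
  rw [D.τ_one, mul_assoc D.P, mul_assoc, D.QR_mul_QR, mul_one]

theorem P_mul_τ : D.P * D.τ 1 = D.P * D.Q * D.R := by
  rw [D.τ_one, mul_assoc]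

theorem PQR_mul_τ_zero : D.P * D.Q * D.R * D.τ 0 = D.R⁻¹ := by
  rw [D.τ_zero, eq_inv_iff_mul_eq_one, mul_assoc _ _ D.R, D.PQR_mul_PQR]

theorem R_inv_mul_τ : D.R⁻¹ * D.τ 0 = D.P * D.Q * D.R := by
  rw [← D.τ_inv, D.τ_zero, ← mul_inv_rev, inv_eq_iff_mul_eq_one, D.PQR_mul_PQR]

theorem spanCube_of_adjTop (h1 : D.AdjTop a b) (h2 : D.AdjTop b c) (h3 : D.AdjTop a c) :
    D.SpanCube a b c := by
  obtain ⟨i, k, rfl, rfl⟩ := h1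
  obtain ⟨j, l, hb, rfl⟩ := h2
  obtain ⟨n, m, ha, hc⟩ := h3
  simp only [edge_eq_iff, Fin.castSucc_inj, true_and] at ha hb hc
  obtain ⟨rfl, hb⟩ := hb
  obtain ⟨rfl, ha⟩ := ha
  have hc := hc.2
  have key := D.τ_conj i k l m
  match i with
  | 0 =>
    obtain h | h := D.top_zero _ ha _ hb _ hc key
    · rw [inv_mul_eq_iff_eq_mul] at h
      have := D.spanCube_zero m
      have h5 : m * D.Q = k * D.τ 0 := by rw [h, D.τ_zero, mul_assoc]
      rw [h5, ← D.edge_eq (i := 0) ha, ← D.edge_eq (i := 0) hc] at this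
      exact this.swap'
    · rw [inv_mul_eq_iff_eq_mul] at h
      have := D.spanCube_zero k
      have h5 : k * D.Q = m * D.τ 0 := by rw [h, D.τ_zero]; group
      rw [h5, ← D.edge_eq (i := 0) hc] at this
      exact this
  | 1 => exact absurd key (D.top_one _ ha _ hb _ hc)

theorem spanCube_of_adjBot (h1 : D.AdjBot a b) (h2 : D.AdjBot b c) (h3 : D.AdjBot a c) :
    D.SpanCube a b c := by
  obtain ⟨i, k, rfl, rfl⟩ := h1
  obtain ⟨j, l, hb, rfl⟩ := h2
  obtain ⟨n, m, ha, hc⟩ := h3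
  simp only [edge_eq_iff, Fin.succ_inj, true_and] at ha hb hc
  obtain ⟨rfl, hb⟩ := hb
  obtain ⟨rfl, ha⟩ := ha
  have hc := hc.2
  have key := D.τ_conj i k l m
  match i with
  | 1 =>
    obtain h | h := D.bot_one _ ha _ hb _ hc key
    · rw [inv_mul_eq_iff_eq_mul] at h
      have := D.spanCube_three k
      have h5 : k * D.Q⁻¹ = m * D.τ 1 := by rw [h, mul_assoc, R_mul_τ]
      rw [h5, ← D.edge_eq (i := 2) hc] at this
      exact this
    · rw [inv_mul_eq_iff_eq_mul] at h
      have := D.spanCube_three m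
      have h5 : m * D.Q⁻¹ = k * D.τ 1 := by rw [h, mul_assoc, ← R_mul_τ]; group
      rw [h5, ← D.edge_eq (i := 2) ha, ← D.edge_eq (i := 2) hc] at this
      exact this.swap'
  | 0 => exact absurd key (D.bot_zero _ ha _ hb _ hc)

theorem spanCube_of_adjMid_of_adjTop (h1 : D.AdjMid a b) (h2 : D.AdjTop b c) :
    D.SpanCube a b c := by
  obtain ⟨i, k, rfl, rfl⟩ := h1
  obtain ⟨j, l, hb, rfl⟩ := h2
  simp only [edge_eq_iff, true_and] at hb
  match i, j with
  | 0, 1 =>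
    obtain h | h := D.eq_or_eq_of_mem _ hb.2
    · rw [inv_mul_eq_one] at h
      subst h
      exact D.spanCube_one k
    · rw [inv_mul_eq_iff_eq_mul] at h
      subst h
      have := (D.spanCube_one (k * D.P)).swap'
      rw [mul_assoc, P_mul_τ, edge_one_mul_PQR, edge_zero_mul_P] at this
      rw [mul_assoc, PQR_mul_τ_one]
      exact this
  | 0, 0 => simp at hb
  | 1, 0 => simp at hb
  | 1, 1 => simp at hb

theorem spanCube_of_adjMid_of_adjBot (h1 : D.AdjMid a c) (h2 : D.AdjBot a b) :
    D.SpanCube a b c := by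
  obtain ⟨i, k, rfl, rfl⟩ := h1
  obtain ⟨j, l, ha, rfl⟩ := h2
  simp only [edge_eq_iff, true_and] at ha
  match i, j with
  | 1, 0 =>
    obtain h | h := D.eq_or_eq_of_mem _ ha.2
    · rw [inv_mul_eq_one] at h
      subst h
      exact D.spanCube_two k
    · rw [inv_mul_eq_iff_eq_mul] at h
      subst h
      have := (D.spanCube_two (k * D.R⁻¹)).swap
      rw [mul_assoc, R_inv_mul_τ, edge_one_mul_PQR, ← D.edge_two_mul_R, inv_mul_cancel_right]
        at this
      rw [mul_assoc, PQR_mul_τ_zero]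
      exact this
  | 0, 0 => simp at ha
  | 0, 1 => simp at ha
  | 1, 1 => simp at ha

theorem spanCube_of_sq {b₁ a₁ c₁ b₂ c₂ a₂} (h1 : D.Sq a b b₁ a₁) (h2 : D.Sq b c c₁ b₂)
    (h3 : D.Sq a c c₂ a₂) : D.SpanCube a b c := by
  obtain h1 | h1 | h1 | h1 := h1.adj <;> obtain h3 | h3 | h3 | h3 := h3.adj <;>
    first
    | exact Bool.noConfusion (h1.dir.1.symm.trans h3.dir.1)
    | exact Bool.noConfusion (h1.dir.1.symm.trans h3.dir.2)
    | exact Bool.noConfusion (h1.dir.2.symm.trans h3.dir.1)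
    | exact Bool.noConfusion (h1.dir.2.symm.trans h3.dir.2)
    | skip
  · obtain h2 | h2 | h2 | h2 := h2.adj
    · exact spanCube_of_adjTop h1 h2 h3
    · exact Bool.noConfusion (h2.dir.1.symm.trans h1.dir.2)
    · exact Bool.noConfusion (h2.dir.1.symm.trans h3.dir.2)
    · exact Bool.noConfusion (h2.dir.1.symm.trans h1.dir.2)
  · exact (spanCube_of_adjMid_of_adjTop h3 h1).swap.swap'
  · obtain h2 | h2 | h2 | h2 := h2.adj
    · exact spanCube_of_adjMid_of_adjTop h1 h2
    · exact Bool.noConfusion (h2.dir.1.symm.trans h1.dir.2)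
    · exact Bool.noConfusion (h2.dir.1.symm.trans h3.dir.2)
    · exact Bool.noConfusion (h2.dir.1.symm.trans h1.dir.2)
  · exact (spanCube_of_adjMid_of_adjBot h1 h3).swap'
  · exact (spanCube_of_adjMid_of_adjTop h1 h3).swap
  · obtain h2 | h2 | h2 | h2 := h2.adj
    · exact Bool.noConfusion (h2.dir.1.symm.trans h1.dir.1)
    · exact Bool.noConfusion (h2.dir.2.symm.trans h3.dir.1)
    · exact Bool.noConfusion (h2.dir.2.symm.trans h1.dir.1)
    · exact (spanCube_of_adjMid_of_adjBot h1 h2).swap'.swap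
  · exact spanCube_of_adjMid_of_adjBot h3 h1
  · obtain h2 | h2 | h2 | h2 := h2.adj
    · exact Bool.noConfusion (h2.dir.1.symm.trans h1.dir.2)
    · exact Bool.noConfusion (h2.dir.2.symm.trans h3.dir.2)
    · exact Bool.noConfusion (h2.dir.2.symm.trans h1.dir.2)
    · exact spanCube_of_adjBot h1 h2 h3

variable (D) in
/-- The tessellation, subdivided into cubes. -/
def squareComplex : SquareComplex (Fin 3 × Bool × Set F) where
  inv := reverse
  Sq := D.Sq
  inv_inv a := by simp [reverse]
  symm := Sq.symm
  rot := Sq.rot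
  uniq := Sq.uniq
  irrefl := Sq.irrefl
  exists_cube h1 h2 h3 := by
    obtain ⟨_, _, _, _, _, _, a₃, b₃, c₃, k1, k2, k3, k4, k5, k6⟩ := spanCube_of_sq h1 h2 h3
    obtain ⟨rfl, rfl⟩ := h1.uniq k1
    obtain ⟨rfl, rfl⟩ := h2.uniq k2
    obtain ⟨rfl, rfl⟩ := h3.uniq k3
    exact ⟨a₃, b₃, c₃, k4, k5, k6⟩

end DodecahedralTriple

section Lift

variable {G : Type*} [Group G] {P Q R A B C : G}

theorem commute_mul_mul_of_commute (h : P * Q * R * (P * Q * R) = 1)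
    (hA : Commute A P) (hB : Commute B (P * Q * R)) (hC : Commute C R)
    (hBA : Commute (B * A) (P * Q)) (hCB : Commute (C * B) (Q * R)) :
    Commute (C * B * A) Q := by
  have h1 : P⁻¹ = Q * R * (P * Q * R) := by
    rw [inv_eq_iff_mul_eq_one, ← h]
    simp only [mul_assoc]
  have h2 : P * Q * R * (P * Q) = R⁻¹ := by
    rw [eq_inv_iff_mul_eq_one, mul_assoc _ (P * Q), h]
  have h3 : Q * R * R⁻¹ = Q := mul_inv_cancel_right Q R
  calc C * B * A * Q = C * B * (A * P⁻¹) * (P * Q) := by group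
    _ = C * B * P⁻¹ * B⁻¹ * (B * A * (P * Q)) := by rw [hA.inv_right.eq]; group
    _ = C * B * (Q * R) * (P * Q * R) * B⁻¹ * (P * Q * (B * A)) := by
      rw [hBA.eq, h1]; simp only [mul_assoc]
    _ = Q * R * C * (B * (P * Q * R)) * B⁻¹ * (P * Q * (B * A)) := by
      rw [hCB.eq]; simp only [mul_assoc]
    _ = Q * R * C * (P * Q * R * (P * Q)) * (B * A) := by
      rw [hB.eq]; group
    _ = Q * R * R⁻¹ * (C * B * A) := by
      rw [h2, mul_assoc (Q * R) C, hC.inv_right.eq]; simp only [mul_assoc]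
    _ = Q * (C * B * A) := by rw [h3]

end Lift

namespace DodecahedralTriple

open SquareComplex

variable {F : Type*} [Group F] (D : DodecahedralTriple F)

/-- The flags of the universal cover of the tessellation. -/
abbrev Flag : Type _ := D.squareComplex.Cover × F

/-- The right action of the group on flags over a fixed vertex. -/
def act : F →* Equiv.Perm D.Flag where
  toFun x := Equiv.prodCongr (Equiv.refl _) (Equiv.mulRight x⁻¹)
  map_one' := by ext <;> simp
  map_mul' x y := by ext <;> simp [mul_assoc]

/-- Move the vertex of a flag along the edge of type `i` at the flag. -/
noncomputable def step (i : Fin 3) : Equiv.Perm D.Flag where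
  toFun p := (Cover.move (D.edge i true p.2) p.1, p.2)
  invFun p := (Cover.move (D.edge i false p.2) p.1, p.2)
  left_inv _ := Prod.ext (Cover.move_inv_move (X := D.squareComplex) _ _) rfl
  right_inv p := Prod.ext (Cover.move_move_inv (X := D.squareComplex) (D.edge i true p.2) _) rfl

theorem act_apply (x : F) (p : D.Flag) : D.act x p = (p.1, p.2 * x⁻¹) := rfl

theorem step_apply (i : Fin 3) (p : D.Flag) :
    D.step i p = (Cover.move (D.edge i true p.2) p.1, p.2) := rfl

theorem step_inv_apply (i : Fin 3) (p : D.Flag) :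
    (D.step i)⁻¹ p = (Cover.move (D.edge i false p.2) p.1, p.2) := rfl

theorem commute_step {i : Fin 3} {x : F} (hx : x ∈ D.K i) : Commute (D.step i) (D.act x) := by
  refine Equiv.ext fun p => ?_
  simp only [Equiv.Perm.mul_apply, step_apply, act_apply]
  rw [← D.edge_eq (g := p.2) (h := p.2 * x⁻¹)]
  simpa using hx

theorem commute_step_step (i : Fin 2) :
    Commute (D.step i.succ * D.step i.castSucc) (D.act (D.τ i)) := by
  refine Equiv.ext fun p => ?_
  simp only [Equiv.Perm.mul_apply, step_apply, act_apply, D.τ_inv]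
  rw [← Cover.move_move (X := D.squareComplex) (D.sq_top i p.2)]

/-- The images of the generators of `tessGroup` in the permutations of the flags of the universal
cover. -/
noncomputable def gen : Fin 3 → Equiv.Perm D.Flag :=
  ![D.act D.P, D.act D.Q,
    (D.step 1 * D.step 0)⁻¹ * D.act D.R * (D.step 1 * D.step 0)]

theorem gen_two : D.gen 2 =
    (D.step 2 * D.step 1 * D.step 0)⁻¹ * D.act D.R * (D.step 2 * D.step 1 * D.step 0) := by
  have h := (D.commute_step D.R_mem).eq
  rw [mul_assoc (D.step 2), mul_inv_rev, mul_assoc _ (D.act D.R), ← mul_assoc (D.act D.R), ← h]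
  simp only [gen]
  simp [mul_assoc]

theorem commute_act_Q : Commute (D.step 2 * D.step 1 * D.step 0) (D.act D.Q) := by
  apply commute_mul_mul_of_commute (P := D.act D.P) (R := D.act D.R)
  · simp only [← map_mul]
    rw [D.PQR_mul_PQR, map_one]
  · exact D.commute_step D.P_mem
  · simp only [← map_mul]
    exact D.commute_step D.PQR_mem
  · exact D.commute_step D.R_mem
  · rw [← map_mul, ← D.τ_zero]
    exact D.commute_step_step 0
  · rw [← map_mul, ← D.τ_one]
    exact D.commute_step_step 1

theorem gen_one : D.gen 1 =
    (D.step 2 * D.step 1 * D.step 0)⁻¹ * D.act D.Q * (D.step 2 * D.step 1 * D.step 0) := by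
  rw [mul_assoc, ← D.commute_act_Q.eq, inv_mul_cancel_left]
  rfl

theorem gen_zero_mul_gen_one_mul_gen_two : D.gen 0 * D.gen 1 * D.gen 2 =
    (D.step 1 * D.step 0)⁻¹ * D.act (D.P * D.Q * D.R) * (D.step 1 * D.step 0) := by
  have h := (D.commute_step_step 0).inv_left.eq
  rw [D.τ_zero] at h
  rw [map_mul, ← mul_assoc _ (D.act (D.P * D.Q))]
  refine Eq.trans ?_ (congrArg (· * D.act D.R * (D.step 1 * D.step 0)) h.symm)
  rw [map_mul]
  simp only [gen]
  simp [mul_assoc]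

theorem gen_one_mul_gen_two : D.gen 1 * D.gen 2 =
    (D.step 0)⁻¹ * D.act (D.Q * D.R) * D.step 0 := by
  have h : D.step 2 * D.step 1 * _ = _ * (D.step 2 * D.step 1) := (D.commute_step_step 1).eq
  rw [D.τ_one] at h
  rw [gen_one, gen_two, map_mul] at *
  calc _ = (D.step 0)⁻¹ * (D.step 2 * D.step 1)⁻¹ * (D.act D.Q * D.act D.R) *
        (D.step 2 * D.step 1 * D.step 0) := by group
    _ = (D.step 0)⁻¹ * ((D.step 2 * D.step 1)⁻¹ * (D.act D.Q * D.act D.R *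
        (D.step 2 * D.step 1))) * D.step 0 := by group
    _ = _ := by rw [← h, inv_mul_cancel_left]

theorem lift_gen_eq_one {a b : ℕ} (hP : D.P ^ 5 = 1) (hR : D.R ^ 6 = 1)
    (hz : (D.Q * D.R ^ 4) ^ a * (D.R * D.Q * D.R ^ 3) ^ b = 1) :
    ∀ r ∈ tessRels 5 3 6 a b, FreeGroup.lift D.gen r = 1 := by
  have conj (y x : Equiv.Perm D.Flag) : y⁻¹ * x * y = (MulAut.conj y)⁻¹ x :=
    (MulAut.conj_inv_apply y x).symm
  rintro r (rfl | rfl | rfl | rfl | rfl | rfl | rfl)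
  all_goals simp only [map_mul, map_pow, FreeGroup.lift_apply_of]
  · change D.act D.P ^ 5 = 1
    rw [← map_pow, hP, map_one]
  · change D.act D.Q ^ 3 = 1
    rw [← map_pow, D.Q_pow, map_one]
  · rw [gen_two, conj, ← map_pow, ← map_pow, hR, map_one, map_one]
  · change (D.act D.P * D.act D.Q) ^ 2 = 1
    rw [← map_mul, ← map_pow, D.PQ_pow, map_one]
  · rw [gen_one_mul_gen_two, conj, ← map_pow, ← map_pow, D.QR_pow, map_one, map_one]
  · rw [gen_zero_mul_gen_one_mul_gen_two, conj, ← map_pow, ← map_pow, D.PQR_pow, map_one, map_one]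
  · rw [gen_two, gen_one, conj, conj]
    simp only [← map_mul, ← map_pow]
    rw [hz, map_one, map_one]

theorem not_adj_false (g h : F) : ¬ D.squareComplex.Adj (D.edge 0 false g) (D.edge 0 false h) := by
  rintro ⟨b', a', h⟩
  obtain h | h | h | h := Sq.adj h
  · exact Bool.noConfusion h.dir.1
  · exact Bool.noConfusion h.dir.2
  · exact Bool.noConfusion h.dir.2
  · obtain ⟨i, k, h, -⟩ := h
    exact Fin.succ_ne_zero i (D.edge_eq_iff.1 h).1.symm

theorem not_adj_true {g h : F} (H : ∀ x ∈ D.K 0, ∀ y ∈ D.K 0, g⁻¹ * h ≠ x * D.τ 0 * y) :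
    ¬ D.squareComplex.Adj (D.edge 0 true g) (D.edge 0 true h) := by
  rintro ⟨b', a', h1⟩
  obtain h1 | h1 | h1 | h1 := Sq.adj h1
  · obtain ⟨i, k, h1, h2⟩ := h1
    obtain ⟨hi, -, h3⟩ := D.edge_eq_iff.1 h1
    obtain ⟨-, -, h4⟩ := D.edge_eq_iff.1 h2
    obtain rfl : i = 0 := (Fin.castSucc_eq_zero_iff.1 hi.symm)
    refine H _ h3 _ (inv_mem h4) ?_
    group
  · exact Bool.noConfusion h1.dir.1
  · exact Bool.noConfusion h1.dir.1
  · exact Bool.noConfusion h1.dir.1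

theorem val_move_move {g h : F} {x : D.squareComplex.Cover} (hg : g ∉ D.K 0)
    (H : ∀ x ∈ D.K 0, ∀ y ∈ D.K 0, g ≠ x * D.τ 0 * y) (hh : h ∉ D.K 0) (k : F)
    (hx : x.1 = Trace.mk [] ∨ ∃ u, x.1 = Trace.cons (D.edge 0 false k) u) :
    (Cover.move (D.edge 0 false (k * g * h)) (Cover.move (D.edge 0 true (k * g)) x)).1 =
      Trace.cons (D.edge 0 false (k * g * h)) (Trace.cons (D.edge 0 true (k * g)) x.1) := by
  have h1 : (Cover.move (D.edge 0 true (k * g)) x).1 = Trace.cons (D.edge 0 true (k * g)) x.1 := by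
    apply Cover.move_of_none
    obtain hx | ⟨u, hx⟩ := hx
    · rw [hx, Trace.rem_nil]
    · rw [hx, Trace.rem_cons_of_not]
      · intro h
        replace h : D.edge 0 true k = D.edge 0 true (k * g) := h.symm
        exact hg (by simpa using (D.edge_eq_iff.1 h).2.2)
      · apply D.not_adj_true
        simpa using H
  rw [← h1]
  apply Cover.move_of_none
  rw [h1, Trace.rem_cons_of_not]
  · intro h'
    replace h' : D.edge 0 false (k * g) = D.edge 0 false (k * g * h) := h'.symm
    exact hh (by simpa only [inv_mul_cancel_left] using (D.edge_eq_iff.1 h').2.2)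
  · exact D.not_adj_false _ _

theorem infinite_tessGroup {a b : ℕ} (hP : D.P ^ 5 = 1) (hP1 : D.P ≠ 1) (hR : D.R ^ 6 = 1)
    (hz : (D.Q * D.R ^ 4) ^ a * (D.R * D.Q * D.R ^ 3) ^ b = 1) :
    Infinite (tessGroup 5 3 6 a b) := by
  have hP2 : D.P ^ 2 ≠ 1 := fun h => hP1 <| by
    calc D.P = D.P ^ 5 * ((D.P ^ 2) ^ 2)⁻¹ := by group
      _ = 1 := by rw [hP, h, one_pow, inv_one, one_mul]
  have hP3 : D.P ^ 2 ≠ D.P⁻¹ := fun h => hP1 <| by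
    rw [eq_inv_iff_mul_eq_one] at h
    calc D.P = (D.P ^ 2 * D.P) ^ 2 * (D.P ^ 5)⁻¹ := by group
      _ = 1 := by rw [hP, h, one_pow, inv_one, one_mul]
  have hP4 : D.P ^ 2 ≠ D.P := fun h => hP1 <| by
    rwa [pow_two, mul_eq_left] at h
  have hm : D.P ^ 2 ∈ D.K 0 := pow_mem D.P_mem 2
  set g := D.τ 0 * D.P ^ 2 * D.τ 0 with hg
  have hg0 : g ∉ D.K 0 := fun h => hP2 (D.top_eq_one 0 _ hm h)
  have hg1 : ∀ x ∈ D.K 0, ∀ y ∈ D.K 0, g ≠ x * D.τ 0 * y := fun x hx y hy h =>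
    (D.top_zero _ hm x hx y hy h).elim hP4 hP3
  let f : tessGroup 5 3 6 a b →* Equiv.Perm D.Flag :=
    PresentedGroup.toGroup (D.lift_gen_eq_one hP hR hz)
  let of : Fin 3 → tessGroup 5 3 6 a b := PresentedGroup.of
  have hf (i) : f (of i) = D.gen i := PresentedGroup.toGroup.of _
  let y : tessGroup 5 3 6 a b := of 1 * of 2 * (of 0 * of 1 * of 0 ^ 2 * (of 0 * of 1))⁻¹
  have hy (p : D.Flag) : f y p =
      (Cover.move (D.edge 0 false (p.2 * g * D.τ 1)) (Cover.move (D.edge 0 true (p.2 * g)) p.1),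
        p.2 * g * D.τ 1) := by
    have h1 : f (of 1 * of 2) = (D.step 0)⁻¹ * D.act (D.τ 1) * D.step 0 := by
      rw [map_mul, hf, hf, gen_one_mul_gen_two, D.τ_one]
    have h2 : f (of 0 * of 1 * of 0 ^ 2 * (of 0 * of 1)) = D.act g := by
      simp only [map_mul, map_pow, hf, hg, D.τ_zero]
      rfl
    rw [map_mul f (of 1 * of 2), map_inv, h1, h2, ← map_inv]
    simp only [Equiv.Perm.mul_apply, act_apply, step_apply, step_inv_apply, _root_.inv_inv, D.τ_inv]
  have key (n : ℕ) : ((f y ^ n) (⟨Trace.mk [], Trace.reduced_nil⟩, 1)).1.1.length = 2 * n ∧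
      ∃ x k, (f y ^ n) (⟨Trace.mk [], Trace.reduced_nil⟩, 1) = (x, k) ∧
        (x.1 = Trace.mk [] ∨ ∃ u, x.1 = Trace.cons (D.edge 0 false k) u) := by
    induction n with
    | zero => exact ⟨rfl, _, _, rfl, .inl rfl⟩
    | succ n ih =>
      obtain ⟨hn, x, k, hx, h⟩ := ih
      rw [pow_succ', Equiv.Perm.mul_apply, hx, hy]
      have h1 := D.val_move_move hg0 hg1 (D.τ_one ▸ D.QR_notMem) k h
      refine ⟨?_, _, _, rfl, .inr ⟨_, h1⟩⟩
      rw [hx] at hn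
      rw [h1, Trace.length_cons, Trace.length_cons, hn]
      ring
  refine Infinite.of_injective (fun n : ℕ => y ^ n) fun m n h => ?_
  have h1 := (key m).1
  have h2 : f y ^ m = f y ^ n := by rw [← map_pow, ← map_pow]; exact congrArg f h
  rw [h2, (key n).1] at h1
  omega

end DodecahedralTriple

open scoped MatrixGroups

/-- The Eisenstein integers `ℤ[ζ]`, where `ζ ^ 2 = ζ - 1`. -/
abbrev Eisenstein : Type := QuadraticAlgebra ℤ (-1) 1

/-- The extension `ℤ[ζ, σ]` of the Eisenstein integers, where `σ ^ 2 = 3 * σ - 1`. -/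
abbrev EisensteinGolden : Type := QuadraticAlgebra Eisenstein (-1) 3

/-- Two by two matrices over `ℤ[ζ, σ]`, in a form suited to computation. -/
@[ext]
structure GoldenMatrix where
  a : EisensteinGolden
  b : EisensteinGolden
  c : EisensteinGolden
  d : EisensteinGolden
  deriving DecidableEq

namespace GoldenMatrix

instance : Mul GoldenMatrix where
  mul m n := ⟨m.a * n.a + m.b * n.c, m.a * n.b + m.b * n.d,
    m.c * n.a + m.d * n.c, m.c * n.b + m.d * n.d⟩

/-- The scalar matrix with diagonal entry `c`. -/
def scalar (c : EisensteinGolden) : GoldenMatrix := ⟨c, 0, 0, c⟩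

/-- The adjugate matrix. -/
def adj (m : GoldenMatrix) : GoldenMatrix := ⟨m.d, -m.b, -m.c, m.a⟩

/-- The two by two minors of the pair of entry vectors of two matrices. -/
def minors (m n : GoldenMatrix) : List EisensteinGolden :=
  [m.a * n.b - m.b * n.a, m.a * n.c - m.c * n.a, m.a * n.d - m.d * n.a,
    m.b * n.c - m.c * n.b, m.b * n.d - m.d * n.b, m.c * n.d - m.d * n.c]

end GoldenMatrix

/-- A nonzero Eisenstein integer of norm less than `27`. -/
def Eisenstein.Small (w : Eisenstein) : Prop :=
  w ≠ 0 ∧ w.re * w.re + w.re * w.im + w.im * w.im < 27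

instance : DecidablePred Eisenstein.Small := fun _ => inferInstanceAs (Decidable (_ ∧ _))

/-- Some minor of `m` and `n`, possibly multiplied by the unit `3 - σ`, has a small coordinate. -/
def GoldenMatrix.Indep (m n : GoldenMatrix) : Prop :=
  ∃ d ∈ m.minors n, ∃ e ∈ [d, ⟨3, -1⟩ * d], e.re.Small ∨ e.im.Small

instance (m n : GoldenMatrix) : Decidable (m.Indep n) :=
  inferInstanceAs (Decidable (∃ d ∈ m.minors n, ∃ e ∈ [d, ⟨3, -1⟩ * d], e.re.Small ∨ e.im.Small))

theorem Eisenstein.not_small_of_dvd {a b : ℕ} (h : 6 ≤ a + b) {w : Eisenstein}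
    (hw : (⟨a, b⟩ : Eisenstein) ∣ w) : ¬ w.Small := by
  rintro ⟨h0, h1⟩
  obtain ⟨⟨x, y⟩, rfl⟩ := hw
  have hxy : 0 < x * x + x * y + y * y := by
    by_contra hn
    have hx : x = 0 := by nlinarith [sq_nonneg (x + 2 * y), sq_nonneg x, sq_nonneg y]
    subst hx
    have hy : y = 0 := by nlinarith [sq_nonneg y]
    subst hy
    exact h0 (mul_zero _)
  have hab : (27 : ℤ) ≤ a * a + a * b + b * b := by
    have : (6 : ℤ) ≤ a + b := by exact_mod_cast h
    nlinarith [sq_nonneg ((a : ℤ) - b)]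
  simp only [QuadraticAlgebra.re_mul, QuadraticAlgebra.im_mul] at h1
  nlinarith [mul_le_mul hab (Int.add_one_le_of_lt hxy) (by norm_num) (by linarith)]

/-- The quotient of `ℤ[ζ, σ]` by the ideal generated by `a + b ζ`. -/
abbrev GoldenQuotient (a b : ℕ) : Type :=
  EisensteinGolden ⧸ Ideal.span {algebraMap Eisenstein EisensteinGolden ⟨a, b⟩}

namespace GoldenMatrix

variable {a b : ℕ}

/-- The reduction of a matrix modulo `a + b ζ`. -/
def reduce (a b : ℕ) (m : GoldenMatrix) : Matrix (Fin 2) (Fin 2) (GoldenQuotient a b) :=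
  !![Ideal.Quotient.mk _ m.a, Ideal.Quotient.mk _ m.b;
    Ideal.Quotient.mk _ m.c, Ideal.Quotient.mk _ m.d]

theorem reduce_mul (m n : GoldenMatrix) : (m * n).reduce a b = m.reduce a b * n.reduce a b := by
  change reduce a b ⟨m.a * n.a + m.b * n.c, m.a * n.b + m.b * n.d,
    m.c * n.a + m.d * n.c, m.c * n.b + m.d * n.d⟩ = _
  simp only [reduce, Matrix.mul_fin_two, map_add, map_mul]

theorem reduce_adj (m : GoldenMatrix) : m.adj.reduce a b = (m.reduce a b).adjugate := by
  simp only [reduce, adj, Matrix.adjugate_fin_two_of, map_neg]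

/-- The element `x` of the projective group is the class of `m`. -/
def Represents (m : GoldenMatrix) (x : PGL(2, GoldenQuotient a b)) : Prop :=
  ∃ g : GL (Fin 2) (GoldenQuotient a b), .mk g = x ∧ g.1 = m.reduce a b

namespace Represents

variable {m n : GoldenMatrix} {x y : PGL(2, GoldenQuotient a b)}

theorem mul (hm : m.Represents x) (hn : n.Represents y) : (m * n).Represents (x * y) := by
  obtain ⟨g, rfl, hg⟩ := hm
  obtain ⟨h, rfl, hh⟩ := hn
  exact ⟨g * h, map_mul _ _ _, by rw [Units.val_mul, hg, hh, reduce_mul]⟩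

theorem inv (hm : m.Represents x) : m.adj.Represents x⁻¹ := by
  obtain ⟨g, rfl, hg⟩ := hm
  refine ⟨g⁻¹ * .scalar (Fin 2) g.det, ?_, ?_⟩
  · rw [map_mul, Matrix.ProjGenLinGroup.mk_scalar, mul_one, map_inv]
  · rw [reduce_adj, ← hg]
    have : (g : Matrix (Fin 2) (Fin 2) (GoldenQuotient a b)) * g.1.adjugate =
        g.1 * ((g⁻¹ * .scalar (Fin 2) g.det :
          GL (Fin 2) (GoldenQuotient a b)) : Matrix (Fin 2) (Fin 2) _) := by
      rw [← Units.val_mul, mul_inv_cancel_left, Matrix.mul_adjugate]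
      ext i j
      simp [Matrix.scalar_apply, Matrix.smul_apply, Matrix.one_apply, Matrix.diagonal_apply]
    exact (g.isUnit.mul_left_cancel this).symm

theorem isUnit_det (hm : m.Represents x) :
    IsUnit (Ideal.Quotient.mk (Ideal.span {algebraMap Eisenstein EisensteinGolden ⟨a, b⟩})
      (m.a * m.d - m.b * m.c)) := by
  obtain ⟨g, -, hg⟩ := hm
  have := g.det.isUnit
  simpa only [Matrix.GeneralLinearGroup.val_det_apply, hg, reduce, Matrix.det_fin_two_of, map_sub,
    map_mul] using this

theorem of_smul {c : EisensteinGolden} (hm : Represents ⟨c * m.a, c * m.b, c * m.c, c * m.d⟩ x) :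
    m.Represents x := by
  have hu := hm.isUnit_det
  simp only [mul_assoc, mul_left_comm _ c, ← mul_sub, map_mul] at hu
  obtain ⟨u, hu⟩ := isUnit_of_mul_isUnit_left hu
  obtain ⟨g, rfl, hg⟩ := hm
  refine ⟨g * .scalar (Fin 2) u⁻¹, ?_, ?_⟩
  · rw [map_mul, Matrix.ProjGenLinGroup.mk_scalar, mul_one]
  · have h : g.1 = m.reduce a b * Matrix.scalar (Fin 2) u.1 := by
      rw [hg]
      ext i j
      fin_cases i <;> fin_cases j <;> simp [reduce, ← hu, mul_comm u.1]
    have h2 : g * .scalar (Fin 2) u⁻¹ * .scalar (Fin 2) u = g := by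
      rw [map_inv, inv_mul_cancel_right]
    have h3 := congrArg Units.val h2
    rw [Units.val_mul, h] at h3
    exact (Units.isUnit (Matrix.GeneralLinearGroup.scalar (Fin 2) u)).mul_right_cancel h3

theorem one : Represents ⟨1, 0, 0, 1⟩ (1 : PGL(2, GoldenQuotient a b)) :=
  ⟨1, map_one _, by simp [reduce, Matrix.one_fin_two]⟩

theorem ext (hm : m.Represents x) (hn : m.Represents y) : x = y := by
  obtain ⟨g, rfl, hg⟩ := hm
  obtain ⟨h, rfl, hh⟩ := hn
  exact congrArg _ (Units.ext (hg.trans hh.symm))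

theorem eq_one {c : EisensteinGolden} (hm : Represents (.scalar c) x) : x = 1 :=
  ext (of_smul (c := c) (by simpa only [mul_one, mul_zero, scalar] using hm)) one

theorem translation_mul {e f : EisensteinGolden} (hm : Represents ⟨1, e, 0, 1⟩ x)
    (hn : Represents ⟨1, f, 0, 1⟩ y) : Represents ⟨1, e + f, 0, 1⟩ (x * y) := by
  convert hm.mul hn using 1
  change _ = GoldenMatrix.mk _ _ _ _
  ext1 <;> ring

theorem translation_pow {e : EisensteinGolden} (hm : Represents ⟨1, e, 0, 1⟩ x) (k : ℕ) :
    Represents ⟨1, k * e, 0, 1⟩ (x ^ k) := by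
  induction k with
  | zero => simpa using one
  | succ k ih =>
    rw [pow_succ, Nat.cast_succ, add_one_mul]
    exact ih.translation_mul hm

theorem eq_one_of_translation {e : EisensteinGolden} (hm : Represents ⟨1, e, 0, 1⟩ x)
    (he : algebraMap Eisenstein EisensteinGolden ⟨a, b⟩ ∣ e) : x = 1 := by
  rw [← Ideal.mem_span_singleton, ← Ideal.Quotient.eq_zero_iff_mem] at he
  obtain ⟨g, rfl, hg⟩ := hm
  obtain rfl : g = 1 := Units.ext (hg.trans (by simp [reduce, Matrix.one_fin_two, he]))
  exact map_one _

theorem ne_of_indep (h : 6 ≤ a + b) (hm : m.Represents x) (hn : n.Represents y)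
    (hmn : m.Indep n) : x ≠ y := by
  rintro rfl
  obtain ⟨g, rfl, hg⟩ := hm
  obtain ⟨g', hgg, hg'⟩ := hn
  obtain ⟨u, hu⟩ := Matrix.ProjGenLinGroup.mk_eq_mk_iff.1 hgg.symm
  have hu' := congrArg Units.val hu
  rw [Units.val_mul, hg, hg'] at hu'
  have key (i j : Fin 2) : n.reduce a b i j = m.reduce a b i j * u := by
    rw [← hu']
    simp [Matrix.scalar_apply]
  have ha : Ideal.Quotient.mk _ n.a = Ideal.Quotient.mk _ m.a * u.1 := key 0 0
  have hb : Ideal.Quotient.mk _ n.b = Ideal.Quotient.mk _ m.b * u.1 := key 0 1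
  have hc : Ideal.Quotient.mk _ n.c = Ideal.Quotient.mk _ m.c * u.1 := key 1 0
  have hd : Ideal.Quotient.mk _ n.d = Ideal.Quotient.mk _ m.d * u.1 := key 1 1
  obtain ⟨d, hmem, e, he, hs⟩ := hmn
  have hd0 : algebraMap Eisenstein EisensteinGolden ⟨a, b⟩ ∣ d := by
    rw [← Ideal.mem_span_singleton, ← Ideal.Quotient.eq_zero_iff_mem]
    simp only [minors, List.mem_cons, List.not_mem_nil, or_false] at hmem
    rcases hmem with rfl | rfl | rfl | rfl | rfl | rfl <;>
      simp only [map_sub, map_mul, ha, hb, hc, hd] <;> ring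
  have he0 : algebraMap Eisenstein EisensteinGolden ⟨a, b⟩ ∣ e := by
    simp only [List.mem_cons, List.not_mem_nil, or_false] at he
    rcases he with rfl | rfl
    · exact hd0
    · exact hd0.mul_left _
  rw [QuadraticAlgebra.algebraMap_dvd_iff] at he0
  rcases hs with hs | hs
  · exact Eisenstein.not_small_of_dvd h he0.1 hs
  · exact Eisenstein.not_small_of_dvd h he0.2 hs

end Represents

theorem exists_represents (m : GoldenMatrix) (c : EisensteinGolden)
    (hc : (m.a * m.d - m.b * m.c) * c = 1) :
    ∃ x : PGL(2, GoldenQuotient a b), m.Represents x := by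
  have hdet : IsUnit (m.reduce a b).det := by
    rw [reduce, Matrix.det_fin_two_of, ← map_mul, ← map_mul, ← map_sub]
    exact (IsUnit.of_mul_eq_one c hc).map _
  exact ⟨_, Matrix.GeneralLinearGroup.mk'' _ hdet, rfl, rfl⟩

/-- Every nontrivial element of the subgroup `K` is represented by an entry of the list `l`. -/
def Covers (l : List GoldenMatrix) (K : Subgroup PGL(2, GoldenQuotient a b)) : Prop :=
  ∀ x ∈ K, x = 1 ∨ ∃ m ∈ l, m.Represents x

/-- The identity matrix. -/
def one : GoldenMatrix := scalar 1

theorem Covers.exists_represents {l : List GoldenMatrix}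
    {K : Subgroup PGL(2, GoldenQuotient a b)} (hl : Covers l K)
    {x : PGL(2, GoldenQuotient a b)} (hx : x ∈ K) : ∃ m ∈ one :: l, m.Represents x := by
  rcases hl x hx with rfl | ⟨m, hm, h⟩
  · exact ⟨one, List.mem_cons_self, Represents.one⟩
  · exact ⟨m, List.mem_cons_of_mem _ hm, h⟩

theorem Covers.notMem (h : 6 ≤ a + b) {l : List GoldenMatrix}
    {K : Subgroup PGL(2, GoldenQuotient a b)} (hl : Covers l K) {m : GoldenMatrix}
    {x : PGL(2, GoldenQuotient a b)} (hm : m.Represents x) (hi : ∀ n ∈ one :: l, m.Indep n) :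
    x ∉ K := fun hx => by
  obtain ⟨n, hn, hr⟩ := hl.exists_represents hx
  exact hm.ne_of_indep h hr (hi n hn) rfl

theorem Covers.eq_one (h : 6 ≤ a + b) {l : List GoldenMatrix}
    {K : Subgroup PGL(2, GoldenQuotient a b)} (hl : Covers l K) {t : GoldenMatrix}
    {y : PGL(2, GoldenQuotient a b)} (ht : t.Represents y)
    (hi : ∀ m ∈ l, ∀ n ∈ one :: l, (t * m * t).Indep n) :
    ∀ x ∈ K, y * x * y ∈ K → x = 1 := by
  intro x hx hyx
  rcases hl x hx with rfl | ⟨m, hm, hr⟩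
  · rfl
  · exact absurd hyx (hl.notMem h ((ht.mul hr).mul ht) (hi m hm))

theorem Covers.mul_mul_ne (h : 6 ≤ a + b) {l : List GoldenMatrix}
    {K : Subgroup PGL(2, GoldenQuotient a b)} (hl : Covers l K) {t m : GoldenMatrix}
    {x y z w : PGL(2, GoldenQuotient a b)} (ht : t.Represents y) (hm : m.Represents x)
    (hi : ∀ n ∈ one :: l, ∀ k ∈ one :: l, (t * m * t).Indep (n * t * k))
    (hz : z ∈ K) (hw : w ∈ K) : y * x * y ≠ z * y * w := by
  obtain ⟨n, hn, hnr⟩ := hl.exists_represents hz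
  obtain ⟨k, hk, hkr⟩ := hl.exists_represents hw
  exact ((ht.mul hm).mul ht).ne_of_indep h ((hnr.mul ht).mul hkr) (hi n hn k hk)

/-- The matrix of the rotation of a face. -/
def rotP : GoldenMatrix := ⟨0, ⟨0, -1⟩, 1, -1⟩

/-- The matrix of the rotation of a vertex figure. -/
def rotQ : GoldenMatrix := ⟨⟨⟨-1, 1⟩, 0⟩, 1, 0, 1⟩

/-- The matrix of the rotation about an edge. -/
def rotR : GoldenMatrix := ⟨⟨⟨0, 1⟩, 0⟩, 0, 0, 1⟩

/-- Matrices of the nontrivial powers of `rotP`. -/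
def powersP : List GoldenMatrix := [rotP, rotP.adj, rotP * rotP, (rotP * rotP).adj]

/-- Matrices of the nontrivial powers of `rotR`. -/
def powersR : List GoldenMatrix :=
  [rotR, rotR.adj, rotR * rotR, (rotR * rotR).adj, rotR * rotR * rotR]

theorem indep_top_zero : ∀ m ∈ [one, rotP * rotP, (rotP * rotP).adj],
    ∀ n ∈ one :: powersP, ∀ k ∈ one :: powersP,
      (rotP * rotQ * m * (rotP * rotQ)).Indep (n * (rotP * rotQ) * k) := by
  decide +kernel

theorem indep_bot_one : ∀ m ∈ [one, rotR * rotR, (rotR * rotR).adj, rotR * rotR * rotR],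
    ∀ n ∈ one :: powersR, ∀ k ∈ one :: powersR,
      (rotQ * rotR * m * (rotQ * rotR)).Indep (n * (rotQ * rotR) * k) := by
  decide +kernel

theorem indep_mid : ∀ t ∈ [rotP * rotQ, rotQ * rotR], ∀ m ∈ one :: [rotP * rotQ * rotR],
    ∀ n ∈ one :: [rotP * rotQ * rotR], ∀ k ∈ one :: [rotP * rotQ * rotR],
      (t * m * t).Indep (n * t * k) := by
  decide +kernel

end GoldenMatrix

section Powers

variable {G : Type*} [Group G] {g x : G}

theorem eq_of_mem_zpowers_of_pow_five (hg : g ^ 5 = 1) (hx : x ∈ Subgroup.zpowers g) :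
    x = g ∨ x = g⁻¹ ∨ x = 1 ∨ x = g * g ∨ x = (g * g)⁻¹ := by
  obtain ⟨k, rfl⟩ := hx
  have hg' : g ^ (5 : ℤ) = 1 := mod_cast hg
  have h5 (n : ℤ) : g ^ (5 * n) = 1 := by rw [zpow_mul, hg', one_zpow]
  have hk : k = 5 * (k / 5) ∨ k = 1 + 5 * (k / 5) ∨ k = 2 + 5 * (k / 5) ∨
      k = -2 + 5 * (k / 5 + 1) ∨ k = -1 + 5 * (k / 5 + 1) := by lia
  rcases hk with h | h | h | h | h <;> rw [h] <;> simp only [zpow_add _ _ (5 * _), h5, mul_one] <;>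
    simp [zpow_neg, zpow_ofNat, pow_two]

theorem eq_of_mem_zpowers_of_pow_six (hg : g ^ 6 = 1) (hx : x ∈ Subgroup.zpowers g) :
    x = g ∨ x = g⁻¹ ∨ x = 1 ∨ x = g * g ∨ x = (g * g)⁻¹ ∨ x = g * g * g := by
  obtain ⟨k, rfl⟩ := hx
  have hg' : g ^ (6 : ℤ) = 1 := mod_cast hg
  have h6 (n : ℤ) : g ^ (6 * n) = 1 := by rw [zpow_mul, hg', one_zpow]
  have hk : k = 6 * (k / 6) ∨ k = 1 + 6 * (k / 6) ∨ k = 2 + 6 * (k / 6) ∨ k = 3 + 6 * (k / 6) ∨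
      k = -2 + 6 * (k / 6 + 1) ∨ k = -1 + 6 * (k / 6 + 1) := by lia
  rcases hk with h | h | h | h | h | h <;> rw [h] <;>
    simp only [zpow_add _ _ (6 * _), h6, mul_one] <;>
    simp [zpow_neg, zpow_ofNat, pow_succ]

theorem eq_of_mem_zpowers_of_sq (hg : g ^ 2 = 1) (hx : x ∈ Subgroup.zpowers g) :
    x = 1 ∨ x = g := by
  obtain ⟨k, rfl⟩ := hx
  have hg' : g ^ (2 : ℤ) = 1 := mod_cast hg
  have h2 (n : ℤ) : g ^ (2 * n) = 1 := by rw [zpow_mul, hg', one_zpow]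
  have hk : k = 2 * (k / 2) ∨ k = 1 + 2 * (k / 2) := by lia
  rcases hk with h | h <;> rw [h] <;> simp [zpow_add, h2]

end Powers

open GoldenMatrix in
/-- The projective group of `ℤ[ζ, σ]` modulo `a + b ζ` contains a dodecahedral triple. -/
theorem exists_dodecahedralTriple {a b : ℕ} (h : 6 ≤ a + b) :
    ∃ D : DodecahedralTriple PGL(2, GoldenQuotient a b), D.P ^ 5 = 1 ∧ D.P ≠ 1 ∧ D.R ^ 6 = 1 ∧
      (D.Q * D.R ^ 4) ^ a * (D.R * D.Q * D.R ^ 3) ^ b = 1 := by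
  obtain ⟨P, hP⟩ := exists_represents (a := a) (b := b) rotP ⟨3, -1⟩ (by decide)
  obtain ⟨Q, hQ⟩ := exists_represents (a := a) (b := b) rotQ ⟨⟨0, -1⟩, 0⟩ (by decide)
  obtain ⟨R, hR⟩ := exists_represents (a := a) (b := b) rotR ⟨⟨1, -1⟩, 0⟩ (by decide)
  have hPQ := hP.mul hQ
  have hQR := hQ.mul hR
  have hu := hPQ.mul hR
  have rel {m : GoldenMatrix} {x : PGL(2, GoldenQuotient a b)} (hm : m.Represents x)
      (hs : m = scalar m.a) : x = 1 := Represents.eq_one (hs ▸ hm)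
  have P_pow : P ^ 5 = 1 := by
    simp only [pow_succ, pow_zero, one_mul]
    exact rel ((((hP.mul hP).mul hP).mul hP).mul hP) (by decide +kernel)
  have R_pow : R ^ 6 = 1 := by
    simp only [pow_succ, pow_zero, one_mul]
    exact rel (((((hR.mul hR).mul hR).mul hR).mul hR).mul hR) (by decide +kernel)
  have PQR_pow : (P * Q * R) ^ 2 = 1 := by
    rw [pow_two]
    exact rel (hu.mul hu) (by decide +kernel)
  have c0' : ∀ x ∈ Subgroup.zpowers P, x = P ∨ x = P⁻¹ ∨
      ∃ m ∈ [one, rotP * rotP, (rotP * rotP).adj], m.Represents x := by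
    intro x hx
    rcases eq_of_mem_zpowers_of_pow_five P_pow hx with rfl | rfl | rfl | rfl | rfl
    · exact .inl rfl
    · exact .inr (.inl rfl)
    · exact .inr (.inr ⟨one, by simp, Represents.one⟩)
    · exact .inr (.inr ⟨_, by simp, hP.mul hP⟩)
    · exact .inr (.inr ⟨_, by simp, (hP.mul hP).inv⟩)
  have c0 : Covers powersP (Subgroup.zpowers P) := by
    intro x hx
    rcases eq_of_mem_zpowers_of_pow_five P_pow hx with rfl | rfl | rfl | rfl | rfl
    · exact .inr ⟨_, by simp [powersP], hP⟩
    · exact .inr ⟨rotP.adj, by simp [powersP], hP.inv⟩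
    · exact .inl rfl
    · exact .inr ⟨rotP * rotP, by simp [powersP], hP.mul hP⟩
    · exact .inr ⟨(rotP * rotP).adj, by simp [powersP], (hP.mul hP).inv⟩
  have c1 : Covers [rotP * rotQ * rotR] (Subgroup.zpowers (P * Q * R)) := by
    intro x hx
    rcases eq_of_mem_zpowers_of_sq PQR_pow hx with rfl | rfl
    · exact .inl rfl
    · exact .inr ⟨_, by simp, hu⟩
  have c2' : ∀ x ∈ Subgroup.zpowers R, x = R ∨ x = R⁻¹ ∨
      ∃ m ∈ [one, rotR * rotR, (rotR * rotR).adj, rotR * rotR * rotR], m.Represents x := by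
    intro x hx
    rcases eq_of_mem_zpowers_of_pow_six R_pow hx with rfl | rfl | rfl | rfl | rfl | rfl
    · exact .inl rfl
    · exact .inr (.inl rfl)
    · exact .inr (.inr ⟨one, by simp, Represents.one⟩)
    · exact .inr (.inr ⟨_, by simp, hR.mul hR⟩)
    · exact .inr (.inr ⟨_, by simp, (hR.mul hR).inv⟩)
    · exact .inr (.inr ⟨_, by simp, (hR.mul hR).mul hR⟩)
  have c2 : Covers powersR (Subgroup.zpowers R) := by
    intro x hx
    rcases eq_of_mem_zpowers_of_pow_six R_pow hx with rfl | rfl | rfl | rfl | rfl | rfl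
    · exact .inr ⟨_, by simp [powersR], hR⟩
    · exact .inr ⟨rotR.adj, by simp [powersR], hR.inv⟩
    · exact .inl rfl
    · exact .inr ⟨rotR * rotR, by simp [powersR], hR.mul hR⟩
    · exact .inr ⟨(rotR * rotR).adj, by simp [powersR], (hR.mul hR).inv⟩
    · exact .inr ⟨rotR * rotR * rotR, by simp [powersR], (hR.mul hR).mul hR⟩
  have mid {K : Subgroup PGL(2, GoldenQuotient a b)} {l : List GoldenMatrix} (hK : Covers l K)
      (hi : ∀ n ∈ one :: l, (rotP * rotQ * rotR).Indep n) :
      ∀ x ∈ K, x ∈ Subgroup.zpowers (P * Q * R) → x = 1 := by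
    intro x hx hx1
    rcases eq_of_mem_zpowers_of_sq PQR_pow hx1 with rfl | rfl
    · rfl
    · exact absurd hx (hK.notMem h hu hi)
  let D : DodecahedralTriple PGL(2, GoldenQuotient a b) :=
    { P := P
      Q := Q
      R := R
      K := ![Subgroup.zpowers P, Subgroup.zpowers (P * Q * R), Subgroup.zpowers R]
      τ := ![P * Q, Q * R]
      Q_pow := by
        simp only [pow_succ, pow_zero, one_mul]
        exact rel ((hQ.mul hQ).mul hQ) (by decide +kernel)
      PQ_pow := by
        rw [pow_two]
        exact rel (hPQ.mul hPQ) (by decide +kernel)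
      QR_pow := by
        rw [pow_two]
        exact rel (hQR.mul hQR) (by decide +kernel)
      PQR_pow := PQR_pow
      P_mem := Subgroup.mem_zpowers P
      PQR_mem := Subgroup.mem_zpowers (P * Q * R)
      R_mem := Subgroup.mem_zpowers R
      eq_or_eq_of_mem := fun x hx => eq_of_mem_zpowers_of_sq PQR_pow hx
      τ_zero := rfl
      τ_one := rfl
      notMem_castSucc := Fin.forall_fin_two.2
        ⟨c0.notMem h hPQ (by decide +kernel), c1.notMem h hQR (by decide +kernel)⟩
      notMem_succ := Fin.forall_fin_two.2
        ⟨c1.notMem h hPQ (by decide +kernel), c2.notMem h hQR (by decide +kernel)⟩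
      QR_notMem := c0.notMem h hQR (by decide +kernel)
      top_eq_one := Fin.forall_fin_two.2
        ⟨c0.eq_one h hPQ (by decide +kernel), c1.eq_one h hQR (by decide +kernel)⟩
      mid_eq_one := Fin.forall_fin_two.2
        ⟨mid c0 (by decide +kernel), fun x hx hx' => mid c2 (by decide +kernel) x hx' hx⟩
      bot_eq_one := Fin.forall_fin_two.2
        ⟨c1.eq_one h hPQ (by decide +kernel), c2.eq_one h hQR (by decide +kernel)⟩
      top_zero := by
        intro x hx y hy z hz hxyz
        rcases c0' x hx with hx | hx | ⟨m, hm, hr⟩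
        · exact .inl hx
        · exact .inr hx
        · exact absurd hxyz (c0.mul_mul_ne h hPQ hr (indep_top_zero m hm) hy hz)
      top_one := by
        intro x hx y hy z hz
        obtain ⟨m, hm, hr⟩ := c1.exists_represents hx
        exact c1.mul_mul_ne h hQR hr (indep_mid _ (by simp) m hm) hy hz
      bot_zero := by
        intro x hx y hy z hz
        obtain ⟨m, hm, hr⟩ := c1.exists_represents hx
        exact c1.mul_mul_ne h hPQ hr (indep_mid _ (by simp) m hm) hy hz
      bot_one := by
        intro x hx y hy z hz hxyz
        rcases c2' x hx with hx | hx | ⟨m, hm, hr⟩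
        · exact .inl hx
        · exact .inr hx
        · exact absurd hxyz (c2.mul_mul_ne h hQR hr (indep_bot_one m hm) hy hz) }
  refine ⟨D, P_pow, hP.ne_of_indep h Represents.one (by decide +kernel), R_pow, ?_⟩
  change (Q * R ^ 4) ^ a * (R * Q * R ^ 3) ^ b = 1
  have h1 : Represents ⟨1, 1, 0, 1⟩ (Q * R ^ 4) := by
    simp only [pow_succ, pow_zero, one_mul]
    have e : (⟨1, 1, 0, 1⟩ : GoldenMatrix) = rotQ * (rotR * rotR * rotR * rotR) := by
      decide +kernel
    exact e ▸ hQ.mul (((hR.mul hR).mul hR).mul hR)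
  have h2 : Represents ⟨1, ⟨⟨0, 1⟩, 0⟩, 0, 1⟩ (R * Q * R ^ 3) := by
    simp only [pow_succ, pow_zero, one_mul]
    have e : (⟨1, ⟨⟨0, 1⟩, 0⟩, 0, 1⟩ : GoldenMatrix) = rotR * rotQ * (rotR * rotR * rotR) := by
      decide +kernel
    exact e ▸ (hR.mul hQ).mul ((hR.mul hR).mul hR)
  have h3 := (h1.translation_pow a).translation_mul (h2.translation_pow b)
  refine h3.eq_one_of_translation ?_
  rw [QuadraticAlgebra.algebraMap_dvd_iff]
  constructor
  · apply dvd_of_eq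
    ext <;> simp
  · simp

/-- dodecahedral case of Theorem 7.1: for integers a ≥ b ≥ 0 with
a+b ≥ 6, the group G_{5,3,6}(a,b) is infinite. -/
theorem tessGroup_536_infinite (a b : ℕ) (hab : b ≤ a) (h : 6 ≤ a + b) :
    Infinite (tessGroup 5 3 6 a b) := by
  obtain ⟨D, hP, hP1, hR, hz⟩ := exists_dodecahedralTriple h
  exact D.infinite_tessGroup hP hP1 hR hz
end

section
/- For all integers a ≥ b ≥ 0 with a + b ≥ 9 or a ≥ 6, the presented group G_{3,4,4}(a,b) = ⟨P, Q, R | P³, Q⁴, R⁴, (PQ)², (QR)², (PQR)², (QR³)^a (RQR²)^b⟩ is infinite. (This is the octahedral case of Theorem 7.1: the universal regular tessellation of type {3,4,4} and cusp modulus z = a+bi is infinite volume when ‖z‖ = a+b ≥ 9 or a ≥ 6.) -/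
namespace Tess344

section Flags

variable {X A : Type} [AddCommGroup A]

/-- A field of vertex links: the vertex `v` has an edge in each position `p` of its link, and
`nb v p` records the other end of that edge, the position of the edge in the link there, and the
twist between the two links.  The directions in every link are given by `u`. -/
structure Net (X A : Type) [AddCommGroup A] (u : ZMod 4 → A) where
  nb : X → A → X × A × ZMod 4
  u_add_two : ∀ k, u (k + 2) = -u k
  nb_symm : ∀ v p, nb (nb v p).1 (nb v p).2.1 = (v, p, (nb v p).2.2)

namespace Net

variable {u : ZMod 4 → A} (N : Net X A u)

theorem u_opp (N : Net X A u) {k l : ZMod 4} (h : k = l + 2) : u k = -u l := by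
  rw [h, N.u_add_two]

/-- Rotation of a flag about its edge. -/
def turn (_ : Net X A u) : Equiv.Perm (X × A × ZMod 4) where
  toFun f := (f.1, f.2.1, f.2.2 + 1)
  invFun f := (f.1, f.2.1, f.2.2 - 1)
  left_inv f := by simp
  right_inv f := by simp

/-- Rotation of a flag about its cell, seen in the link of its vertex. -/
def slide (_ : Net X A u) : Equiv.Perm (X × A × ZMod 4) where
  toFun f := (f.1, f.2.1 + u f.2.2, f.2.2 + 1)
  invFun f := (f.1, f.2.1 - u (f.2.2 - 1), f.2.2 - 1)
  left_inv f := by simp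
  right_inv f := by simp

/-- Reversal of the edge of a flag. -/
def swap : Equiv.Perm (X × A × ZMod 4) where
  toFun f := ((N.nb f.1 f.2.1).1, (N.nb f.1 f.2.1).2.1, (N.nb f.1 f.2.1).2.2 - 1 - f.2.2)
  invFun f := ((N.nb f.1 f.2.1).1, (N.nb f.1 f.2.1).2.1, (N.nb f.1 f.2.1).2.2 - 1 - f.2.2)
  left_inv f := by simp [N.nb_symm]
  right_inv f := by simp [N.nb_symm]

/-- The rotation about a triangle. -/
def spin : Equiv.Perm (X × A × ZMod 4) := N.slide * N.swap

theorem turn_apply (f) : N.turn f = (f.1, f.2.1, f.2.2 + 1) := rfl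

theorem slide_apply (f) : N.slide f = (f.1, f.2.1 + u f.2.2, f.2.2 + 1) := rfl

theorem swap_apply (f) : N.swap f =
    ((N.nb f.1 f.2.1).1, (N.nb f.1 f.2.1).2.1, (N.nb f.1 f.2.1).2.2 - 1 - f.2.2) := rfl

/-- The triangle at the flag `f` closes up. -/
def Closes (f : X × A × ZMod 4) : Prop := N.spin (N.spin (N.spin f)) = f

/-- The image of the generators of the presentation. -/
def gen : Fin 3 → Equiv.Perm (X × A × ZMod 4) := ![N.swap * N.slide⁻¹, N.slide, N.turn]

theorem four (d : ZMod 4) : d + 1 + 1 + 1 + 1 = d := by revert d; decide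

theorem turn_pow_four : N.turn ^ 4 = 1 := by
  ext1 f
  simp [pow_succ, turn_apply, four]

theorem slide_pow_four : N.slide ^ 4 = 1 := by
  ext1 ⟨v, p, d⟩
  have h1 : u (d + 1 + 1) = -u d := N.u_opp (by clear * -; revert d; decide)
  have h2 : u (d + 1 + 1 + 1) = -u (d + 1) := N.u_opp (by clear * -; revert d; decide)
  simp [pow_succ, slide_apply, four, h1, h2]
  abel

theorem swap_sq : N.swap ^ 2 = 1 := by
  ext1 f
  simp [pow_succ, swap_apply, N.nb_symm]

theorem slide_turn_sq : (N.slide * N.turn) ^ 2 = 1 := by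
  ext1 ⟨v, p, d⟩
  have h2 : u (d + 1 + 1 + 1) = -u (d + 1) := N.u_opp (by clear * -; revert d; decide)
  simp [pow_succ, slide_apply, turn_apply, four, h2]

theorem swap_turn_sq : (N.swap * N.turn) ^ 2 = 1 := by
  ext1 ⟨v, p, d⟩
  simp only [pow_succ, pow_zero, one_mul, Equiv.Perm.mul_apply, turn_apply, swap_apply, N.nb_symm,
    Equiv.Perm.one_apply, Prod.mk.injEq, true_and]
  ring

theorem slide_turn_pow_three (a : ℕ) (f : X × A × ZMod 4) :
    ((N.slide * N.turn ^ 3) ^ a) f = (f.1, f.2.1 + a • u (f.2.2 - 1), f.2.2) := by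
  have h1 : ∀ d : ZMod 4, d + 1 + 1 + 1 = d - 1 := by decide
  induction a with
  | zero => simp
  | succ n ih =>
    rw [pow_succ', Equiv.Perm.mul_apply, ih]
    simp only [pow_succ, pow_zero, one_mul, Equiv.Perm.mul_apply, slide_apply, turn_apply, h1,
      sub_add_cancel, add_smul, one_smul, add_assoc f.2.1]

theorem turn_slide_turn_sq (b : ℕ) (f : X × A × ZMod 4) :
    ((N.turn * N.slide * N.turn ^ 2) ^ b) f = (f.1, f.2.1 + b • u (f.2.2 + 2), f.2.2) := by
  have h1 : ∀ d : ZMod 4, d + 1 + 1 = d + 2 := by decide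
  have h2 : ∀ d : ZMod 4, d + 2 + 2 = d := by decide
  induction b with
  | zero => simp
  | succ n ih =>
    rw [pow_succ', Equiv.Perm.mul_apply, ih]
    simp only [pow_succ, pow_zero, one_mul, Equiv.Perm.mul_apply, slide_apply, turn_apply, h1, h2,
      add_smul, one_smul, add_assoc f.2.1]

theorem exists_hom (a b : ℕ) (hc : ∀ f, N.Closes f)
    (hab : ∀ d, a • u (d - 1) + b • u (d + 2) = 0) :
    ∃ φ : PresentedGroup (tessRels 3 4 4 a b) →* Equiv.Perm (X × A × ZMod 4),
      N.swap ∈ φ.range ∧ N.slide ∈ φ.range ∧ N.turn ∈ φ.range := by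
  have hs : (N.swap * N.slide⁻¹) ^ 3 = 1 := by
    have h3 : N.spin ^ 3 = 1 := by
      ext1 f
      exact hc f
    have hi : N.swap⁻¹ = N.swap := by
      rw [inv_eq_iff_mul_eq_one, ← pow_two, N.swap_sq]
    have : (N.swap * N.slide⁻¹) = N.spin⁻¹ := by
      rw [spin, mul_inv_rev, hi]
    rw [this, inv_pow, h3, inv_one]
  have hrel : ∀ r ∈ tessRels 3 4 4 a b, FreeGroup.lift N.gen r = 1 := by
    intro r hr
    simp only [tessRels, Set.mem_insert_iff, Set.mem_singleton_iff] at hr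
    rcases hr with rfl | rfl | rfl | rfl | rfl | rfl | rfl
    · simpa [gen] using hs
    · simpa [gen] using N.slide_pow_four
    · simpa [gen] using N.turn_pow_four
    · simpa [gen] using N.swap_sq
    · simpa [gen] using N.slide_turn_sq
    · simpa [gen] using N.swap_turn_sq
    · ext1 f
      simp only [map_mul, map_pow, FreeGroup.lift_apply_of, Equiv.Perm.mul_apply,
        Equiv.Perm.one_apply]
      have := N.slide_turn_pow_three a ((N.turn * N.slide * N.turn ^ 2) ^ b <| f)
      simp only [gen, Matrix.cons_val] at *
      norm_num
      rw [this, turn_slide_turn_sq]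
      ext1
      · rfl
      · ext1
        · simp [add_assoc, add_comm (b • _), hab]
        · rfl
  let φ : PresentedGroup (tessRels 3 4 4 a b) →* Equiv.Perm (X × A × ZMod 4) := PresentedGroup.toGroup hrel
  have hφ : ∀ i, φ (PresentedGroup.of i) = N.gen i := fun i => PresentedGroup.toGroup.of hrel
  refine ⟨φ, ⟨PresentedGroup.of 0 * PresentedGroup.of 1, ?_⟩, ⟨PresentedGroup.of 1, hφ 1⟩,
    ⟨PresentedGroup.of 2, hφ 2⟩⟩
  rw [map_mul, hφ, hφ]
  simp [gen]

end Net

end Flags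

end Tess344

namespace Tess344

namespace Net

variable {X A : Type} [AddCommGroup A] {u : ZMod 4 → A} (N : Net X A u)

/-- The triangle between the positions `p` and `p + u k` of the link of `v` closes up. -/
def Good (v : X) (p : A) (k : ZMod 4) : Prop := N.Closes (v, p, k - 1)

theorem half_turn_mul_spin :
    N.slide * N.turn * N.spin = N.spin⁻¹ * (N.slide * N.turn) := by
  have h1 : N.slide * N.turn * N.slide = N.turn⁻¹ := by
    rw [eq_inv_iff_mul_eq_one]
    simpa [pow_two, mul_assoc] using N.slide_turn_sq
  have h2 : N.turn⁻¹ * N.swap = N.swap * N.turn := by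
    have h3 : N.swap * N.turn * (N.swap * N.turn) = 1 := by simpa [pow_two] using N.swap_turn_sq
    have h4 : N.swap * N.swap = 1 := by simpa [pow_two] using N.swap_sq
    rw [inv_mul_eq_iff_eq_mul]
    calc N.swap = N.swap * (N.swap * N.turn * (N.swap * N.turn)) := by rw [h3, mul_one]
      _ = N.swap * N.swap * (N.turn * (N.swap * N.turn)) := by simp only [mul_assoc]
      _ = _ := by rw [h4, one_mul]
  have h4 : N.swap⁻¹ = N.swap := by
    rw [inv_eq_iff_mul_eq_one, ← pow_two, N.swap_sq]
  rw [spin, ← mul_assoc, h1, h2, mul_inv_rev, h4]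
  group

theorem closes_half_turn {f : X × A × ZMod 4} (h : N.Closes f) :
    N.Closes (N.slide (N.turn f)) := by
  have key : ∀ g, N.slide (N.turn (N.spin g)) = N.spin⁻¹ (N.slide (N.turn g)) := fun g => by
    simpa using congrArg (fun σ => σ g) N.half_turn_mul_spin
  have h1 := congrArg (fun g => N.slide (N.turn g)) h
  simp only [key, Equiv.Perm.inv_eq_iff_eq] at h1
  exact h1.symm

theorem closes_of_spin {f : X × A × ZMod 4} (h : N.Closes (N.spin f)) : N.Closes f :=
  N.spin.injective h

variable {N}

theorem Good.symm {v : X} {p : A} {k : ZMod 4} (h : N.Good v p k) :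
    N.Good v (p + u k) (k + 2) := by
  have := N.closes_half_turn h
  simp only [turn_apply, slide_apply, sub_add_cancel] at this
  have e : k + 2 - 1 = k + 1 := by ring
  rwa [Good, e]

theorem Good.of_symm {v : X} {p : A} {k : ZMod 4} (h : N.Good v (p + u k) (k + 2)) :
    N.Good v p k := by
  have := h.symm
  have e : ∀ k : ZMod 4, k + 2 + 2 = k := by decide
  simpa [N.u_add_two, e] using this

theorem spin_apply (v : X) (p : A) (k : ZMod 4) : N.spin (v, p, k - 1) =
    ((N.nb v p).1, (N.nb v p).2.1 + u ((N.nb v p).2.2 - k), (N.nb v p).2.2 - k + 1) := by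
  simp [spin, swap_apply, slide_apply]

theorem good_of_nb {v : X} {p : A} {k : ZMod 4}
    (h : N.Good (N.nb v p).1 (N.nb v p).2.1 ((N.nb v p).2.2 - k)) : N.Good v p k := by
  apply N.closes_of_spin
  rw [spin_apply]
  have := h.symm
  have e : ∀ k : ZMod 4, k + 2 - 1 = k + 1 := by decide
  rwa [Good, e] at this

theorem good_of_nb_eq {v : X} {p : A} {k : ZMod 4} {v₁ v₂ : X} {p₁ p₂ : A} {e₁ e₂ : ZMod 4}
    (h₁ : N.nb v p = (v₁, p₁, e₁)) (h₂ : N.nb v (p + u k) = (v₂, p₂, e₂))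
    (h : N.nb v₁ (p₁ + u (e₁ - k)) = (v₂, p₂ - u (e₂ - k), 2 + e₁ + e₂ - 2 * k)) :
    N.Good v p k := by
  have s1 : N.spin (v, p, k - 1) = (v₁, p₁ + u (e₁ - k), e₁ - k + 1) := by
    rw [spin_apply, h₁]
  have s2 : N.spin (v₁, p₁ + u (e₁ - k), e₁ - k + 1) = (v₂, p₂, e₂ - k + 1) := by
    have e : e₁ - k + 1 = e₁ - k + 2 - 1 := by ring
    have e' : 2 + e₁ + e₂ - 2 * k - (e₁ - k + 2) = e₂ - k := by ring
    rw [e, spin_apply, h]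
    simp [e']
  have s3 : N.spin (v₂, p₂, e₂ - k + 1) = (v, p, k - 1) := by
    have e : e₂ - k + 1 = e₂ - k + 2 - 1 := by ring
    have h3 : N.nb v₂ p₂ = (v, p + u k, e₂) := by
      have := N.nb_symm v (p + u k)
      rwa [h₂] at this
    have e' : e₂ - (e₂ - k + 2) = k - 2 := by ring
    have e'' : u (k - 2) = - u k := N.u_opp (by clear * -; revert k; decide)
    rw [e, spin_apply, h3]
    simp only [e', e'', Prod.mk.injEq, add_neg_cancel_right, true_and]
    ring
  rw [Good, Closes, s1, s2, s3]

/-- A net whose triangles close up, and which contains an infinite chain of neighbours each entered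
and left at positions two steps apart, makes the group infinite. -/
theorem infinite_group (N : Net X A u) (a b : ℕ) (hc : ∀ v p k, N.Good v p k)
    (hab : ∀ d, a • u (d - 1) + b • u (d + 2) = 0) (v : ℕ → X) (p : ℕ → A)
    (hv : Function.Injective v) (h₁ : ∀ n, (N.nb (v n) (p n)).1 = v (n + 1))
    (h₂ : ∀ n, p (n + 1) = (N.nb (v n) (p n)).2.1 + u 3 + u 3) :
    Infinite (PresentedGroup (tessRels 3 4 4 a b)) := by
  obtain ⟨φ, ht, hs, hr⟩ := N.exists_hom a b
    (fun f => by simpa [Good] using hc f.1 f.2.1 (f.2.2 + 1)) hab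
  by_contra hfin
  rw [not_infinite_iff_finite] at hfin
  have hreach : ∀ n, ∃ g ∈ φ.range, ∃ d, g (v 0, p 0, 0) = (v n, p n, d) := by
    intro n
    induction n with
    | zero => exact ⟨1, one_mem _, 0, rfl⟩
    | succ n ih =>
      obtain ⟨g, hg, d, hd⟩ := ih
      have aux : ∀ (σ : Equiv.Perm (X × A × ZMod 4)) (w : X) (q : A), σ ∈ φ.range →
          (∃ d, σ (v 0, p 0, 0) = (w, q, d)) →
          ∃ τ ∈ φ.range, ∃ d, τ (v 0, p 0, 0) = (w, q + u 3, d) := by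
        rintro σ w q hσ ⟨d, hd⟩
        refine ⟨N.slide * N.turn ^ (3 - d).val * σ,
          mul_mem (mul_mem hs (pow_mem hr _)) hσ, 4, ?_⟩
        have hturn : ∀ (m : ℕ) f, (N.turn ^ m) f = (f.1, f.2.1, f.2.2 + m) := by
          intro m f
          induction m with
          | zero => simp
          | succ m ih => rw [pow_succ', Equiv.Perm.mul_apply, ih]; simp [turn_apply, add_assoc]
        rw [Equiv.Perm.mul_apply, Equiv.Perm.mul_apply, hd, hturn, slide_apply]
        simp
        decide
      obtain ⟨g₁, hg₁, h⟩ := aux (N.swap * g) _ _ (mul_mem ht hg)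
        ⟨_, by rw [Equiv.Perm.mul_apply, hd, swap_apply]⟩
      obtain ⟨g₂, hg₂, e, he⟩ := aux g₁ _ _ hg₁ h
      exact ⟨g₂, hg₂, e, by rw [he, ← h₂, h₁]⟩
  choose g hg d hd using hreach
  have : Function.Injective (fun n => (⟨g n, hg n⟩ : φ.range)) := by
    intro m n hmn
    have h1 : g m = g n := congrArg Subtype.val hmn
    have h2 := hd m
    rw [h1, hd n] at h2
    exact hv (congrArg Prod.fst h2).symm
  have hf : Finite φ.range := (Set.finite_range φ).to_subtype
  exact not_injective_infinite_finite _ this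

end Net

end Tess344

namespace Tess344

/-- The four unit vectors of the square lattice. -/
def U : ZMod 4 → ℤ × ℤ := ![(1, 0), (0, 1), (-1, 0), (0, -1)]

/-- The shapes of the occupied regions in the vertex links: nothing, a unit square, a `2 × 2`
square, and a `3 × 2` rectangle. -/
inductive Ty
  | O
  | A
  | B
  | C
  deriving DecidableEq

namespace Ty

instance : Fintype Ty := ⟨{O, A, B, C}, fun T => by cases T <;> decide⟩

/-- The number of boundary points. -/
abbrev n : Ty → ℕ
  | O => 0
  | A => 4
  | B => 8
  | C => 10

/-- The number of interior points. -/
abbrev m : Ty → ℕ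
  | O => 0
  | A => 0
  | B => 1
  | C => 2

/-- The boundary points, in counterclockwise order. -/
def pos : (T : Ty) → Fin T.n → ℤ × ℤ
  | O => ![]
  | A => ![(0, 0), (1, 0), (1, 1), (0, 1)]
  | B => ![(0, 1), (-1, 1), (-1, 0), (-1, -1), (0, -1), (1, -1), (1, 0), (1, 1)]
  | C => ![(0, 1), (-1, 1), (-1, 0), (-1, -1), (0, -1), (1, -1), (2, -1), (2, 0), (2, 1), (1, 1)]

/-- The direction from a boundary point to the next one. -/
def dir : (T : Ty) → Fin T.n → ZMod 4
  | O => ![]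
  | A => ![0, 1, 2, 3]
  | B => ![2, 3, 3, 0, 0, 1, 1, 2]
  | C => ![2, 3, 3, 0, 0, 0, 1, 1, 2, 2]

/-- Whether a boundary point is a corner. -/
def corner : (T : Ty) → Fin T.n → Bool
  | O => ![]
  | A => ![true, true, true, true]
  | B => ![false, true, false, true, false, true, false, true]
  | C => ![false, true, false, true, false, false, true, false, true, false]

/-- The interior points. -/
def inn : (T : Ty) → Fin T.m → ℤ × ℤ
  | O => ![]
  | A => ![]
  | B => ![(0, 0)]
  | C => ![(0, 0), (1, 0)]

/-- The next boundary point. -/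
def rot (T : Ty) : Equiv.Perm (Fin T.n) := finRotate T.n

/-- The direction from the previous boundary point. -/
def pdir (T : Ty) (j : Fin T.n) : ZMod 4 := T.dir (T.rot.symm j)

/-- The point outside a boundary point, perpendicular to the side that follows. -/
def aft (T : Ty) (j : Fin T.n) : ℤ × ℤ := T.pos j - U (T.dir j + 1)

/-- The point outside a boundary point, perpendicular to the side that precedes. -/
def bef (T : Ty) (j : Fin T.n) : ℤ × ℤ := T.pos j - U (T.pdir j + 1)

/-- The point diagonally outside a corner. -/
def diag (T : Ty) (j : Fin T.n) : ℤ × ℤ := T.pos j - U (T.dir j) - U (T.dir j + 1)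

/-- All points of the region. -/
def pts (T : Ty) : List (ℤ × ℤ) := List.ofFn T.pos ++ List.ofFn T.inn

/-- Two lattice points that are distinct and at distance less than six. -/
def Apart (s r : ℤ × ℤ) : Prop := s ≠ r ∧ (s.1 - r.1) ^ 2 + (s.2 - r.2) ^ 2 < 36

instance (s r : ℤ × ℤ) : Decidable (Apart s r) := inferInstanceAs (Decidable (_ ∧ _))

theorem pos_rot : ∀ (T : Ty) (j : Fin T.n), T.pos (T.rot j) = T.pos j + U (T.dir j) := by
  decide +kernel

theorem dir_of_corner : ∀ (T : Ty) (j : Fin T.n), T.corner j = true → T.dir j = T.pdir j + 1 := by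
  decide +kernel

theorem dir_of_not_corner : ∀ (T : Ty) (j : Fin T.n), T.corner j = false → T.dir j = T.pdir j := by
  decide +kernel

theorem inward : ∀ (T : Ty), ∀ q ∈ T.pts, ∀ k, q - U k ∈ T.pts ∨
    ∃ j, q = T.pos j ∧ (k = T.dir j + 1 ∨ k = T.pdir j + 1) := by
  decide +kernel

theorem inn_sub : ∀ (T : Ty) (s : Fin T.m) (k), T.inn s - U k ∈ T.pts := by
  decide +kernel

theorem inward_corner : ∀ (T : Ty), ∀ q ∈ T.pts, ∀ k, q - U k ∈ T.pts ∨ q - U (k + 1) ∈ T.pts ∨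
    ∃ j, q = T.pos j ∧ T.corner j = true ∧ T.dir j = k := by
  decide +kernel

theorem consecutive : ∀ (T : Ty) (i j : Fin T.n) (k),
    (j = T.rot i ∧ k = T.dir i) ∨ (i = T.rot j ∧ k = T.dir j + 2) ∨
      Apart (T.pos i + U k) (T.pos j) := by
  decide +kernel

theorem apart_pos : ∀ (T : Ty) (i j : Fin T.n), i ≠ j → Apart (T.pos i) (T.pos j) := by
  decide +kernel

theorem apart_inn : ∀ (T : Ty) (i j : Fin T.m), i ≠ j → Apart (T.inn i) (T.inn j) := by
  decide +kernel

theorem apart_pos_inn : ∀ (T : Ty) (i : Fin T.n) (j : Fin T.m), Apart (T.pos i) (T.inn j) := by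
  decide +kernel

theorem apart_inn_add : ∀ (T : Ty) (s : Fin T.m), ∀ q ∈ T.pts,
    Apart (T.inn s + U 3 + U 3) q := by
  decide +kernel

theorem apart_aft : ∀ (T : Ty) (i : Fin T.n), ∀ q ∈ T.pts, Apart (T.aft i) q := by
  decide +kernel

theorem apart_bef : ∀ (T : Ty) (i : Fin T.n), ∀ q ∈ T.pts, Apart (T.bef i) q := by
  decide +kernel

theorem apart_aft_add : ∀ (T : Ty) (i : Fin T.n) (k), k ≠ T.dir i + 1 → ∀ q ∈ T.pts,
    Apart (T.aft i + U k) q := by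
  decide +kernel

theorem apart_bef_add : ∀ (T : Ty) (i : Fin T.n) (k), k ≠ T.pdir i + 1 → ∀ q ∈ T.pts,
    Apart (T.bef i + U k) q := by
  decide +kernel

theorem apart_aft_aft : ∀ (T : Ty) (i j : Fin T.n), i ≠ j → Apart (T.aft i) (T.aft j) := by
  decide +kernel

theorem apart_bef_bef : ∀ (T : Ty) (i j : Fin T.n), i ≠ j → Apart (T.bef i) (T.bef j) := by
  decide +kernel

theorem apart_aft_bef : ∀ (T : Ty) (i j : Fin T.n), (i = j ∧ T.corner i = false) ∨
    Apart (T.aft i) (T.bef j) := by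
  decide +kernel

theorem apart_diag : ∀ (T : Ty) (i : Fin T.n), T.corner i = true → ∀ q ∈ T.pts,
    Apart (T.diag i) q := by
  decide +kernel

end Ty
end Tess344

namespace Tess344

/-- A quotient of the square lattice by translations of length at least six. -/
structure Torus (A : Type) [AddCommGroup A] where
  ι : ℤ × ℤ →+ A
  small : ∀ g, ι g = 0 → g = 0 ∨ 36 ≤ g.1 ^ 2 + g.2 ^ 2

/-- A boundary point of one of the regions `ty v`. -/
structure Dart {V : Type} (ty : V → Ty) where
  v : V
  j : Fin (ty v).n

namespace Dart

variable {V : Type} {ty : V → Ty}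

/-- The next boundary point. -/
def rot (x : Dart ty) : Dart ty := ⟨x.v, (ty x.v).rot x.j⟩

/-- The previous boundary point. -/
def prv (x : Dart ty) : Dart ty := ⟨x.v, (ty x.v).rot.symm x.j⟩

/-- The direction to the next boundary point. -/
def dr (x : Dart ty) : ZMod 4 := (ty x.v).dir x.j

/-- Whether a boundary point is a corner. -/
def corner (x : Dart ty) : Bool := (ty x.v).corner x.j

theorem rot_prv (x : Dart ty) : x.prv.rot = x :=
  congrArg (Dart.mk x.v) (Equiv.apply_symm_apply _ _)

theorem prv_rot (x : Dart ty) : x.rot.prv = x :=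
  congrArg (Dart.mk x.v) (Equiv.symm_apply_apply _ _)

theorem dr_of_corner {x : Dart ty} (h : x.corner = true) : x.dr = x.prv.dr + 1 :=
  Ty.dir_of_corner _ _ h

theorem dr_of_not_corner {x : Dart ty} (h : x.corner = false) : x.dr = x.prv.dr :=
  Ty.dir_of_not_corner _ _ h

end Dart

namespace Torus

variable {A : Type} [AddCommGroup A] (τ : Torus A)

theorem ne_of_apart {s r : ℤ × ℤ} (h : Ty.Apart s r) : τ.ι s ≠ τ.ι r := by
  intro he
  rcases τ.small (s - r) (by rw [map_sub, he, sub_self]) with h1 | h1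
  · exact h.1 (sub_eq_zero.1 h1)
  · exact absurd h.2 (not_lt.2 h1)

/-- The four directions. -/
def u (k : ZMod 4) : A := τ.ι (U k)

theorem u_add_two (k : ZMod 4) : τ.u (k + 2) = -τ.u k := by
  have : ∀ k, U (k + 2) = -U k := by decide
  rw [u, this, map_neg, u]

variable {V : Type} {ty : V → Ty}

/-- The position of a boundary point. -/
def pos (x : Dart ty) : A := τ.ι ((ty x.v).pos x.j)

/-- The point outside a boundary point, perpendicular to the side that follows. -/
def aft (x : Dart ty) : A := τ.pos x - τ.u (x.dr + 1)

/-- The point outside a boundary point, perpendicular to the side that precedes. -/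
def bef (x : Dart ty) : A := τ.pos x - τ.u (x.prv.dr + 1)

/-- The point diagonally outside a corner. -/
def diag (x : Dart ty) : A := τ.pos x - τ.u x.dr - τ.u (x.dr + 1)

variable (ty) in
/-- A position is outside the region. -/
def Ext (v : V) (p : A) : Prop := ∀ q ∈ (ty v).pts, τ.ι q ≠ p

variable {τ}

theorem aft_eq (x : Dart ty) : τ.aft x = τ.ι ((ty x.v).aft x.j) := by
  simp [aft, Ty.aft, pos, u, Dart.dr]

theorem bef_eq (x : Dart ty) : τ.bef x = τ.ι ((ty x.v).bef x.j) := by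
  simp [bef, Ty.bef, pos, u, Dart.dr, Ty.pdir, Dart.prv]

theorem diag_eq (x : Dart ty) : τ.diag x = τ.ι ((ty x.v).diag x.j) := by
  simp [diag, Ty.diag, pos, u, Dart.dr]

theorem pos_rot (x : Dart ty) : τ.pos x.rot = τ.pos x + τ.u x.dr := by
  simp [pos, Dart.rot, u, Dart.dr, Ty.pos_rot]

theorem aft_add_u (x : Dart ty) : τ.aft x + τ.u x.dr = τ.bef x.rot := by
  rw [aft, bef, pos_rot, Dart.prv_rot]
  abel

theorem aft_eq_bef {x : Dart ty} (h : x.corner = false) : τ.aft x = τ.bef x := by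
  rw [aft, bef, Dart.dr_of_not_corner h]

theorem diag_add_u (x : Dart ty) : τ.diag x + τ.u x.dr = τ.aft x := by
  rw [diag, aft]
  abel

theorem diag_add_u_add_one {x : Dart ty} (h : x.corner = true) :
    τ.diag x + τ.u (x.dr + 1) = τ.bef x := by
  rw [diag, bef, ← Dart.dr_of_corner h]
  abel

theorem not_ext_pos (x : Dart ty) : ¬ τ.Ext ty x.v (τ.pos x) := fun h =>
  h ((ty x.v).pos x.j) (by simp [Ty.pts]) rfl

theorem not_ext_inn (v : V) (s : Fin (ty v).m) : ¬ τ.Ext ty v (τ.ι ((ty v).inn s)) := fun h =>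
  h ((ty v).inn s) (by simp [Ty.pts]) rfl

theorem exists_of_not_ext {v : V} {p : A} (h : ¬ τ.Ext ty v p) :
    (∃ x : Dart ty, x.v = v ∧ τ.pos x = p) ∨ ∃ s, τ.ι ((ty v).inn s) = p := by
  simp only [Ext, not_forall, not_not, Ty.pts, List.mem_append, List.mem_ofFn] at h
  obtain ⟨q, ⟨j, rfl⟩ | ⟨s, rfl⟩, rfl⟩ := h
  · exact .inl ⟨⟨v, j⟩, rfl, rfl⟩
  · exact .inr ⟨s, rfl⟩

theorem pos_injective {x y : Dart ty} (hv : x.v = y.v) (h : τ.pos x = τ.pos y) : x = y := by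
  obtain ⟨v, i⟩ := x
  obtain ⟨w, j⟩ := y
  obtain rfl : v = w := hv
  by_contra hne
  exact τ.ne_of_apart (Ty.apart_pos _ i j fun h => hne (by rw [h])) h

theorem aft_injective {x y : Dart ty} (hv : x.v = y.v) (h : τ.aft x = τ.aft y) : x = y := by
  obtain ⟨v, i⟩ := x
  obtain ⟨w, j⟩ := y
  obtain rfl : v = w := hv
  by_contra hne
  rw [aft_eq, aft_eq] at h
  exact τ.ne_of_apart (Ty.apart_aft_aft _ i j fun h => hne (by rw [h])) h

theorem bef_injective {x y : Dart ty} (hv : x.v = y.v) (h : τ.bef x = τ.bef y) : x = y := by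
  obtain ⟨v, i⟩ := x
  obtain ⟨w, j⟩ := y
  obtain rfl : v = w := hv
  by_contra hne
  rw [bef_eq, bef_eq] at h
  exact τ.ne_of_apart (Ty.apart_bef_bef _ i j fun h => hne (by rw [h])) h

theorem eq_of_aft_eq_bef {x y : Dart ty} (hv : x.v = y.v) (h : τ.aft x = τ.bef y) :
    x = y ∧ x.corner = false := by
  obtain ⟨v, i⟩ := x
  obtain ⟨w, j⟩ := y
  obtain rfl : v = w := hv
  rw [aft_eq, bef_eq] at h
  rcases Ty.apart_aft_bef _ i j with ⟨rfl, h'⟩ | h'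
  · exact ⟨rfl, h'⟩
  · exact absurd h (τ.ne_of_apart h')

theorem inn_injective {v : V} {s t : Fin (ty v).m}
    (h : τ.ι ((ty v).inn s) = τ.ι ((ty v).inn t)) : s = t := by
  by_contra hne
  exact τ.ne_of_apart (Ty.apart_inn _ s t hne) h

theorem pos_ne_inn (x : Dart ty) (s : Fin (ty x.v).m) : τ.pos x ≠ τ.ι ((ty x.v).inn s) :=
  τ.ne_of_apart (Ty.apart_pos_inn _ _ _)

theorem ext_aft (x : Dart ty) : τ.Ext ty x.v (τ.aft x) := fun q hq => by
  rw [aft_eq]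
  exact (τ.ne_of_apart (Ty.apart_aft _ _ q hq)).symm

theorem ext_bef (x : Dart ty) : τ.Ext ty x.v (τ.bef x) := fun q hq => by
  rw [bef_eq]
  exact (τ.ne_of_apart (Ty.apart_bef _ _ q hq)).symm

theorem ext_aft_add (x : Dart ty) {k : ZMod 4} (hk : k ≠ x.dr + 1) :
    τ.Ext ty x.v (τ.aft x + τ.u k) := fun q hq => by
  rw [aft_eq, u, ← map_add]
  exact (τ.ne_of_apart (Ty.apart_aft_add _ _ k hk q hq)).symm

theorem ext_bef_add (x : Dart ty) {k : ZMod 4} (hk : k ≠ x.prv.dr + 1) :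
    τ.Ext ty x.v (τ.bef x + τ.u k) := fun q hq => by
  rw [bef_eq, u, ← map_add]
  exact (τ.ne_of_apart (Ty.apart_bef_add _ _ k hk q hq)).symm

theorem ext_diag {x : Dart ty} (h : x.corner = true) : τ.Ext ty x.v (τ.diag x) := fun q hq => by
  rw [diag_eq]
  exact (τ.ne_of_apart (Ty.apart_diag _ _ h q hq)).symm

theorem inward {v : V} {p : A} (h : ¬ τ.Ext ty v p) (k : ZMod 4) (h' : τ.Ext ty v (p - τ.u k)) :
    ∃ x : Dart ty, x.v = v ∧ τ.pos x = p ∧ (k = x.dr + 1 ∨ k = x.prv.dr + 1) := by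
  simp only [Ext, not_forall, not_not] at h
  obtain ⟨q, hq, rfl⟩ := h
  rcases Ty.inward _ q hq k with h1 | ⟨j, rfl, h1⟩
  · exact absurd (by simp [u]) (h' _ h1)
  · exact ⟨⟨v, j⟩, rfl, rfl, h1⟩

theorem inward_corner {v : V} {p : A} (h : ¬ τ.Ext ty v p) (k : ZMod 4)
    (h₁ : τ.Ext ty v (p - τ.u k)) (h₂ : τ.Ext ty v (p - τ.u (k + 1))) :
    ∃ x : Dart ty, x.v = v ∧ τ.pos x = p ∧ x.corner = true ∧ x.dr = k := by
  simp only [Ext, not_forall, not_not] at h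
  obtain ⟨q, hq, rfl⟩ := h
  rcases Ty.inward_corner _ q hq k with h' | h' | ⟨j, rfl, h'⟩
  · exact absurd (by simp [u]) (h₁ _ h')
  · exact absurd (by simp [u]) (h₂ _ h')
  · exact ⟨⟨v, j⟩, rfl, rfl, h'⟩

theorem not_ext_inn_add (v : V) (s : Fin (ty v).m) (k : ZMod 4) :
    ¬ τ.Ext ty v (τ.ι ((ty v).inn s) + τ.u k) := fun h =>
  h _ (Ty.inn_sub _ s (k + 2)) (by rw [map_sub, ← u, u_add_two, sub_neg_eq_add])

theorem consecutive {x y : Dart ty} (hv : x.v = y.v) {k : ZMod 4}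
    (h : τ.pos x + τ.u k = τ.pos y) :
    (y = x.rot ∧ k = x.dr) ∨ (x = y.rot ∧ k = y.dr + 2) := by
  obtain ⟨v, i⟩ := x
  obtain ⟨w, j⟩ := y
  obtain rfl : v = w := hv
  rw [pos, pos, u, ← map_add] at h
  rcases Ty.consecutive _ i j k with ⟨rfl, h'⟩ | ⟨rfl, h'⟩ | h'
  · exact .inl ⟨rfl, h'⟩
  · exact .inr ⟨rfl, h'⟩
  · exact absurd h (τ.ne_of_apart h')

end Torus
end Tess344

namespace Tess344

/-- A closed surface tiled by triangles and squares, presented by its vertices and the gluing `h` of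
its darts, together with a choice `sg` of a side for every edge that is not a corner. -/
structure Surf where
  V : Type
  ty : V → Ty
  h : Dart ty → Dart ty
  sg : Dart ty → Bool
  h_h : ∀ x, h (h x) = x
  corner_h : ∀ x, (h x).corner = x.corner
  tri : ∀ x, h (h (h x.rot).rot).rot = x
  sg_h : ∀ x : Dart ty, x.corner = false → sg (h x) = !sg x

/-- An interior point of one of the regions `ty v`. -/
structure Inner {V : Type} (ty : V → Ty) where
  v : V
  s : Fin (ty v).m

variable {A : Type} [AddCommGroup A]

/-- The corners of the unit square. -/
def unitCorner : ZMod 4 → ℤ × ℤ := ![(0, 0), (1, 0), (1, 1), (0, 1)]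

/-- The vertices in the layer that follows a surface: one for every unit square, one for every
point away from the surface, and one for every dart up to gluing. -/
inductive NextV (τ : Torus A) (S : Surf) : Type
  | sq (v : S.V) (q : A) (h : ∀ k, τ.Ext S.ty v (q + τ.ι (unitCorner k)))
  | pt (v : S.V) (p : A) (h : τ.Ext S.ty v p ∧ ∀ k, τ.Ext S.ty v (p + τ.u k))
  | sd (x : Dart S.ty) (h : x.corner = true ∨ S.sg x = true)

/-- Coordinates for the darts in the layer that follows a surface. -/
inductive Raw (V A : Type) : Type
  | a (v : V) (p : A) (k : ZMod 4)
  | m (v : V) (p : A) (k : ZMod 4)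
  | c (v : V) (p : A) (k : ZMod 4)

/-- The interior point, the kind and the direction that a boundary point of the `2 × 2` square
represents. -/
def labB : Fin 8 → Fin 1 × Bool × ZMod 4 :=
  ![(0, false, 3), (0, true, 2), (0, false, 2), (0, true, 1), (0, false, 1), (0, true, 0),
    (0, false, 0), (0, true, 3)]

/-- The interior point, the kind and the direction that a boundary point of the `3 × 2` rectangle
represents. -/
def labC : Fin 10 → Fin 2 × Bool × ZMod 4 :=
  ![(0, false, 3), (0, true, 2), (0, false, 2), (0, true, 1), (0, false, 1), (1, false, 1),
    (1, true, 0), (1, false, 0), (1, true, 3), (1, false, 3)]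

/-- The direction from an interior point of the rectangle to the other one. -/
def blocked (s : Fin 2) : ZMod 4 := ![0, 2] s

theorem labC_spec : ∀ j, (labC j).2.2 ≠ blocked (labC j).1 ∧
    ((labC j).2.1 = true → (labC j).2.2 + 1 ≠ blocked (labC j).1) := by decide

theorem exists_labC : ∀ s b κ, κ ≠ blocked s → (b = true → κ + 1 ≠ blocked s) →
    ∃ j, labC j = (s, b, κ) := by decide

theorem exists_labB : ∀ s b κ, ∃ j, labB j = (s, b, κ) := by decide

theorem labB_injective : ∀ i j, labB i = labB j → i = j := by decide

theorem labC_injective : ∀ i j, labC i = labC j → i = j := by decide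

theorem labB_mid : ∀ j, (labB j).2.1 = false →
    Ty.B.pos j = Ty.B.inn (labB j).1 + U (-(labB j).2.2) ∧
      Ty.B.dir j = -(labB j).2.2 + 1 ∧ Ty.B.pdir j = -(labB j).2.2 + 1 := by decide

theorem labC_mid : ∀ j, (labC j).2.1 = false →
    Ty.C.pos j = Ty.C.inn (labC j).1 + U (-(labC j).2.2) ∧
      Ty.C.dir j = -(labC j).2.2 + 1 ∧ Ty.C.pdir j = -(labC j).2.2 + 1 := by decide

theorem labB_corner : ∀ j, Ty.B.corner j = (labB j).2.1 := by decide

theorem labC_corner : ∀ j, Ty.C.corner j = (labC j).2.1 := by decide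

namespace NextV

variable {τ : Torus A} {S : Surf}

/-- The region occupied in the link of a new vertex. -/
def ty : NextV τ S → Ty
  | sq .. => .A
  | pt .. => .B
  | sd .. => .C

/-- The old vertex, the position in its link, and the twist of the edge at an interior point. -/
def par : (w : NextV τ S) → Fin (ty w).m → S.V × A × ZMod 4
  | sq .. => ![]
  | pt v p _ => ![(v, p, 0)]
  | sd x _ => ![(x.v, τ.aft x, x.dr + 1),
      ((S.h x).v, τ.bef (S.h x), (S.h x).prv.dr + 3)]

end NextV

open NextV

namespace Raw

/-- The coordinates of a dart at the end of an edge. -/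
def lab {V A : Type} (y : V × A × ZMod 4) (b : Bool) (κ : ZMod 4) : Raw V A :=
  if b then .c y.1 y.2.1 (κ + y.2.2) else .m y.1 y.2.1 (κ + y.2.2)

/-- The coordinates that actually occur. -/
def Valid (τ : Torus A) (S : Surf) : Raw S.V A → Prop
  | a v p k => τ.Ext S.ty v p ∧ τ.Ext S.ty v (p + τ.u k) ∧ τ.Ext S.ty v (p + τ.u (k + 1)) ∧
      τ.Ext S.ty v (p + τ.u k + τ.u (k + 1))
  | m v p k => τ.Ext S.ty v p ∧ τ.Ext S.ty v (p + τ.u k)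
  | c v p k => τ.Ext S.ty v p ∧ τ.Ext S.ty v (p + τ.u k) ∧ τ.Ext S.ty v (p + τ.u (k + 1))

end Raw

variable {τ : Torus A} {S : Surf}

/-- The parent edge of an interior point. -/
def Inner.par (i : Inner (NextV.ty (τ := τ) (S := S))) : S.V × A × ZMod 4 := NextV.par i.v i.s

/-- The coordinates of the darts of a new vertex. -/
def codeAt : (w : NextV τ S) → Fin (NextV.ty w).n → Raw S.V A
  | .sq v q _ => fun j : ZMod 4 => .a v (q + τ.ι (unitCorner (-j))) (-j)
  | pt v p h => fun j => Raw.lab (NextV.par (.pt v p h) (labB j).1) (labB j).2.1 (labB j).2.2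
  | sd x h => fun j => Raw.lab (NextV.par (τ := τ) (.sd x h) (labC j).1) (labC j).2.1 (labC j).2.2

/-- The coordinates of a dart. -/
def code (d : Dart (NextV.ty (τ := τ) (S := S))) : Raw S.V A := codeAt d.v d.j

/-- The effect of rotation on coordinates. -/
inductive RotStep (τ : Torus A) (S : Surf) : Raw S.V A → Raw S.V A → Prop
  | a (v p k) : RotStep τ S (.a v p k) (.a v (p + τ.u (k + 1)) (k - 1))
  | c (v p k) : RotStep τ S (.c v p k) (.m v p k)
  | m (v p k) : RotStep τ S (.m v p k) (.c v p (k - 1))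
  | aft (x : Dart S.ty) : RotStep τ S (.m x.v (τ.aft x) (x.dr + 2))
      (.m (S.h x).v (τ.bef (S.h x)) (S.h x).prv.dr)
  | bef (x : Dart S.ty) : RotStep τ S (.m x.v (τ.bef x) (x.prv.dr + 2))
      (.m (S.h x).v (τ.aft (S.h x)) (S.h x).dr)

theorem aft_add_inward {V : Type} {ty : V → Ty} (x : Dart ty) :
    τ.aft x + τ.u (x.dr + 1) = τ.pos x := by
  rw [Torus.aft]; abel

theorem bef_add_inward {V : Type} {ty : V → Ty} (x : Dart ty) :
    τ.bef x + τ.u (x.prv.dr + 1) = τ.pos x := by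
  rw [Torus.bef]; abel

theorem rotStep_code (d : Dart (NextV.ty (τ := τ) (S := S))) :
    RotStep τ S (code d) (code d.rot) := by
  obtain ⟨w, j⟩ := d
  have hm : ∀ v p (k l : ZMod 4), k - 1 = l → RotStep τ S (.m v p k) (.c v p l) := by
    rintro v p k _ rfl
    exact .m v p k
  cases w with
  | sq v q h =>
    have hU : ∀ j : ZMod 4, unitCorner (-(j + 1)) = unitCorner (-j) + U (-j + 1) := by decide
    have hr : ∀ j : Fin 4, Ty.A.rot j = j + 1 := by decide
    have key : ∀ j l : ZMod 4, l = j + 1 → RotStep τ S (.a v (q + τ.ι (unitCorner (-j))) (-j))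
        (.a v (q + τ.ι (unitCorner (-l))) (-l)) := by
      rintro j _ rfl
      rw [hU, map_add, ← add_assoc, neg_add', ← Torus.u]
      exact .a _ _ _
    exact key j _ (hr j)
  | pt v p h =>
    have hj : ∀ j : Fin 8, (labB j).2.1 = true ∧ (labB (Ty.B.rot j)).2 = (false, (labB j).2.2) ∨
      (labB j).2.1 = false ∧ (labB (Ty.B.rot j)).2 = (true, (labB j).2.2 - 1) := by decide
    have hs : ∀ s : Fin 1, NextV.par (.pt v p h : NextV τ S) s = (v, p, 0) := by
      intro s
      fin_cases s
      rfl
    change RotStep τ S (Raw.lab (NextV.par (.pt v p h) (labB j).1) (labB j).2.1 (labB j).2.2)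
      (Raw.lab (NextV.par (.pt v p h) (labB (Ty.B.rot j)).1) (labB (Ty.B.rot j)).2.1
        (labB (Ty.B.rot j)).2.2)
    rw [hs, hs]
    rcases hj j with ⟨h1, h2⟩ | ⟨h1, h2⟩ <;> rw [h1, h2]
    · exact .c _ _ _
    · exact hm _ _ _ _ (by ring)
  | sd x h =>
    have hj : ∀ j : Fin 10, (labC j).2.1 = true ∧
        labC (Ty.C.rot j) = ((labC j).1, false, (labC j).2.2) ∨
      (labC j).2.1 = false ∧ labC (Ty.C.rot j) = ((labC j).1, true, (labC j).2.2 - 1) ∨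
      labC j = (0, false, 1) ∧ labC (Ty.C.rot j) = (1, false, 1) ∨
      labC j = (1, false, 3) ∧ labC (Ty.C.rot j) = (0, false, 3) := by decide
    change RotStep τ S (Raw.lab (NextV.par (.sd x h) (labC j).1) (labC j).2.1 (labC j).2.2)
      (Raw.lab (NextV.par (.sd x h) (labC (Ty.C.rot j)).1) (labC (Ty.C.rot j)).2.1
        (labC (Ty.C.rot j)).2.2)
    rcases hj j with ⟨h1, h2⟩ | ⟨h1, h2⟩ | ⟨h1, h2⟩ | ⟨h1, h2⟩ <;> rw [h1, h2]
    · exact .c _ _ _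
    · exact hm _ _ _ _ (by ring)
    · have := RotStep.aft (τ := τ) x
      have e1 : x.dr + 2 = 1 + (x.dr + 1) := by ring
      have e2 : (S.h x).prv.dr = 1 + ((S.h x).prv.dr + 3) := by
        generalize (S.h x).prv.dr = y
        revert y; decide
      rw [e1, e2] at this
      exact this
    · have := RotStep.bef (τ := τ) (S.h x)
      rw [S.h_h] at this
      have e1 : x.dr = 3 + (x.dr + 1) := by
        generalize x.dr = y
        revert y; decide
      have e2 : (S.h x).prv.dr + 2 = 3 + ((S.h x).prv.dr + 3) := by
        generalize (S.h x).prv.dr = y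
        revert y; decide
      rw [e1, e2] at this
      exact this

end Tess344

namespace Tess344

variable {A : Type} [AddCommGroup A] {τ : Torus A} {S : Surf}

open NextV

theorem fin_two (s : Fin 2) : s = 0 ∨ s = 1 := by revert s; decide

theorem par_pt (v : S.V) (p : A) (h) (s : Fin (NextV.ty (.pt v p h : NextV τ S)).m) :
    NextV.par (.pt v p h : NextV τ S) s = (v, p, 0) := by
  obtain rfl := Subsingleton.elim (α := Fin 1) 0 s
  rfl

/-- The direction from an interior point of a rectangle to the other one points inwards. -/
theorem sd_blocked (x : Dart S.ty) (h) (s : Fin 2) :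
    ∃ y : Dart S.ty, (NextV.par (.sd x h : NextV τ S) s).1 = y.v ∧
      (NextV.par (.sd x h : NextV τ S) s).2.1 +
        τ.u (blocked s + (NextV.par (.sd x h : NextV τ S) s).2.2) = τ.pos y ∧
      τ.Ext S.ty y.v (NextV.par (.sd x h : NextV τ S) s).2.1 ∧
      ∀ κ, κ ≠ blocked s → τ.Ext S.ty y.v ((NextV.par (.sd x h : NextV τ S) s).2.1 +
        τ.u (κ + (NextV.par (.sd x h : NextV τ S) s).2.2)) := by
  rcases fin_two s with rfl | rfl
  · refine ⟨x, rfl, ?_, τ.ext_aft x, fun κ hκ => τ.ext_aft_add x fun h => hκ ?_⟩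
    · change τ.aft x + τ.u (0 + (x.dr + 1)) = _
      rw [zero_add, aft_add_inward]
    · exact add_eq_right.1 h
  · have e : ∀ d : ZMod 4, 2 + (d + 3) = d + 1 := by decide
    refine ⟨S.h x, rfl, ?_, τ.ext_bef _, fun κ hκ => τ.ext_bef_add _ fun h => hκ ?_⟩
    · change τ.bef (S.h x) + τ.u (2 + ((S.h x).prv.dr + 3)) = _
      rw [e, bef_add_inward]
    · rw [← e] at h
      exact add_right_cancel h

theorem valid_code (d : Dart (NextV.ty (τ := τ) (S := S))) : (code d).Valid τ S := by
  obtain ⟨w, j⟩ := d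
  cases w with
  | sq v q h =>
    have key : ∀ k : ZMod 4, (Raw.a v (q + τ.ι (unitCorner k)) k).Valid τ S := by
      intro k
      have h1 : unitCorner k + U k = unitCorner (k + 1) := by revert k; decide
      have h2 : unitCorner k + U (k + 1) = unitCorner (k + 3) := by revert k; decide
      have h3 : unitCorner k + U k + U (k + 1) = unitCorner (k + 2) := by revert k; decide
      refine ⟨h k, ?_, ?_, ?_⟩ <;> simp only [Torus.u, add_assoc, ← map_add]
      · rw [h1]; exact h _
      · rw [h2]; exact h _
      · rw [← add_assoc, h3]; exact h _
    exact key _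
  | pt v p h =>
    have e := par_pt (τ := τ) v p h (labB j).1
    change (Raw.lab (NextV.par (.pt v p h) (labB j).1) (labB j).2.1 (labB j).2.2).Valid τ S
    rw [e]
    cases (labB j).2.1
    · exact ⟨h.1, h.2 _⟩
    · exact ⟨h.1, h.2 _, h.2 _⟩
  | sd x h =>
    change (Raw.lab (NextV.par (.sd x h) (labC j).1) (labC j).2.1 (labC j).2.2).Valid τ S
    obtain ⟨h1, h2⟩ := labC_spec j
    obtain ⟨y, hy, -, h3, h4⟩ := sd_blocked (τ := τ) x h (labC j).1
    generalize hb : (labC j).2.1 = b at *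
    cases b
    · refine ⟨?_, ?_⟩ <;> rw [hy]
      · exact h3
      · exact h4 _ h1
    · refine ⟨?_, ?_, ?_⟩ <;> rw [hy]
      · exact h3
      · exact h4 _ h1
      · rw [add_right_comm]
        exact h4 _ (h2 rfl)

theorem par_injective {i i' : Inner (NextV.ty (τ := τ) (S := S))} (hv : i.par.1 = i'.par.1)
    (hp : i.par.2.1 = i'.par.2.1) : i = i' := by
  have hne : ∀ v p h (x : Dart S.ty) h' (s : Fin 2),
      (NextV.par (.sd x h' : NextV τ S) s).1 = v → (NextV.par (.sd x h' : NextV τ S) s).2.1 = p →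
      (NextV.pt v p h : NextV τ S) = .pt v p h → False := by
    rintro v p h x h' s rfl rfl -
    obtain ⟨y, hy, h1, -, -⟩ := sd_blocked (τ := τ) x h' s
    refine τ.not_ext_pos y ?_
    rw [← h1, ← hy]
    exact h.2 _
  have hsd : ∀ (x y : Dart S.ty), (x.corner = true ∨ S.sg x = true) →
      (y.corner = true ∨ S.sg y = true) → x.v = (S.h y).v → τ.aft x ≠ τ.bef (S.h y) := by
    intro x y hx hy hv hp
    obtain ⟨rfl, h1⟩ := τ.eq_of_aft_eq_bef hv hp
    have h2 := S.corner_h y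
    have h3 := S.sg_h y
    simp_all
  obtain ⟨w, s⟩ := i
  obtain ⟨w', s'⟩ := i'
  change (NextV.par w s).1 = (NextV.par w' s').1 at hv
  change (NextV.par w s).2.1 = (NextV.par w' s').2.1 at hp
  cases w with
  | sq v q h => exact Fin.elim0 s
  | pt v p h =>
    cases w' with
    | sq v q h => exact Fin.elim0 s'
    | pt v' p' h' =>
      rw [par_pt, par_pt] at hv hp
      obtain rfl : v = v' := hv
      obtain rfl : p = p' := hp
      exact congrArg (Inner.mk _) (Subsingleton.elim (α := Fin 1) s s')
    | sd x h' =>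
      rw [par_pt] at hv hp
      exact (hne v p h x h' s' hv.symm hp.symm rfl).elim
  | sd x h =>
    cases w' with
    | sq v q h => exact Fin.elim0 s'
    | pt v' p' h' =>
      rw [par_pt] at hv hp
      exact (hne v' p' h' x h s hv hp rfl).elim
    | sd y h' =>
      rcases fin_two s with rfl | rfl <;> rcases fin_two s' with rfl | rfl
      · obtain rfl : x = y := τ.aft_injective hv hp
        rfl
      · exact (hsd x y h h' hv hp).elim
      · exact (hsd y x h' h hv.symm hp.symm).elim
      · have := congrArg S.h (τ.bef_injective hv hp)
        rw [S.h_h, S.h_h] at this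
        subst this
        rfl

theorem exists_par_aft_or_bef (τ : Torus A) (x : Dart S.ty) (h : x.corner = false) :
    (∃ i : Inner (NextV.ty (τ := τ) (S := S)), i.par = (x.v, τ.aft x, x.dr + 1)) ∨
    ∃ i : Inner (NextV.ty (τ := τ) (S := S)), i.par = (x.v, τ.bef x, x.prv.dr + 3) := by
  cases hs : S.sg x with
  | true => exact .inl ⟨⟨.sd x (.inr hs), (0 : Fin 2)⟩, rfl⟩
  | false =>
    refine .inr ⟨⟨.sd (S.h x) (.inr (by rw [S.sg_h x h, hs]; rfl)), (1 : Fin 2)⟩, ?_⟩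
    change ((S.h (S.h x)).v, τ.bef (S.h (S.h x)), (S.h (S.h x)).prv.dr + 3) = _
    rw [S.h_h]

theorem exists_par_aft {x : Dart S.ty} (h : x.corner = true) :
    ∃ i : Inner (NextV.ty (τ := τ) (S := S)), i.par = (x.v, τ.aft x, x.dr + 1) :=
  ⟨⟨.sd x (.inl h), (0 : Fin 2)⟩, rfl⟩

theorem exists_par_bef {x : Dart S.ty} (h : x.corner = true) :
    ∃ i : Inner (NextV.ty (τ := τ) (S := S)), i.par = (x.v, τ.bef x, x.prv.dr + 3) := by
  refine ⟨⟨.sd (S.h x) (.inl (by rw [S.corner_h, h])), (1 : Fin 2)⟩, ?_⟩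
  change ((S.h (S.h x)).v, τ.bef (S.h (S.h x)), (S.h (S.h x)).prv.dr + 3) = _
  rw [S.h_h]

theorem exists_par {v : S.V} {p : A} (h : τ.Ext S.ty v p) :
    ∃ i : Inner (NextV.ty (τ := τ) (S := S)), i.par.1 = v ∧ i.par.2.1 = p := by
  by_cases hf : ∀ k, τ.Ext S.ty v (p + τ.u k)
  · exact ⟨⟨.pt v p ⟨h, hf⟩, (0 : Fin 1)⟩, rfl, rfl⟩
  · push Not at hf
    obtain ⟨k, hk⟩ := hf
    obtain ⟨x, rfl, hx, hk⟩ := τ.inward hk k (by rwa [add_sub_cancel_right])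
    have hp : p = τ.aft x ∨ p = τ.bef x := by
      rcases hk with rfl | rfl
      · exact .inl (by rw [Torus.aft, hx]; abel)
      · exact .inr (by rw [Torus.bef, hx]; abel)
    cases hc : x.corner with
    | true =>
      rcases hp with rfl | rfl
      · obtain ⟨i, hi⟩ := exists_par_aft (τ := τ) hc
        exact ⟨i, by rw [hi], by rw [hi]⟩
      · obtain ⟨i, hi⟩ := exists_par_bef (τ := τ) hc
        exact ⟨i, by rw [hi], by rw [hi]⟩
    | false =>
      rw [← τ.aft_eq_bef hc, or_self] at hp
      subst hp
      rcases exists_par_aft_or_bef τ x hc with ⟨i, hi⟩ | ⟨i, hi⟩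
      · exact ⟨i, by rw [hi], by rw [hi]⟩
      · exact ⟨i, by rw [hi], by rw [hi, τ.aft_eq_bef hc]⟩

theorem ext_par (i : Inner (NextV.ty (τ := τ) (S := S))) : τ.Ext S.ty i.par.1 i.par.2.1 := by
  obtain ⟨w, s⟩ := i
  change τ.Ext S.ty (NextV.par w s).1 (NextV.par w s).2.1
  cases w with
  | sq v q h => exact Fin.elim0 s
  | pt v p h => rw [par_pt]; exact h.1
  | sd x h =>
    obtain ⟨y, hy, -, h3, -⟩ := sd_blocked (τ := τ) x h s
    rw [hy]
    exact h3

theorem exists_code_lab {v : S.V} {p : A} {k : ZMod 4} (b : Bool) (hp : τ.Ext S.ty v p)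
    (hk : τ.Ext S.ty v (p + τ.u k)) (hb : b = true → τ.Ext S.ty v (p + τ.u (k + 1))) :
    ∃ d : Dart (NextV.ty (τ := τ) (S := S)), code d = Raw.lab (v, p, k) b 0 := by
  obtain ⟨⟨w, s⟩, rfl, rfl⟩ := exists_par hp
  cases w with
  | sq v q h => exact Fin.elim0 s
  | pt v p h =>
    obtain ⟨j, hj⟩ := exists_labB s b k
    refine ⟨⟨.pt v p h, j⟩, ?_⟩
    have e := par_pt (τ := τ) v p h s
    change Raw.lab (NextV.par (.pt v p h) (labB j).1) (labB j).2.1 (labB j).2.2 =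
      Raw.lab ((NextV.par (.pt v p h) s).1, (NextV.par (.pt v p h) s).2.1, k) b 0
    rw [hj, e]
    simp [Raw.lab]
  | sd x h' =>
    change τ.Ext S.ty (NextV.par (.sd x h') s).1 ((NextV.par (.sd x h') s).2.1 + τ.u k) at hk
    change _ → τ.Ext S.ty (NextV.par (.sd x h') s).1
      ((NextV.par (.sd x h') s).2.1 + τ.u (k + 1)) at hb
    change ∃ d, code d =
      Raw.lab ((NextV.par (.sd x h') s).1, (NextV.par (.sd x h') s).2.1, k) b 0
    obtain ⟨y, hy, h1, -, -⟩ := sd_blocked (τ := τ) x h' s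
    rw [hy] at hk hb
    obtain ⟨j, hj⟩ := exists_labC s b (k - (NextV.par (.sd x h') s).2.2)
      (fun he => τ.not_ext_pos y (by rwa [← h1, ← he, sub_add_cancel]))
      (fun hb' he => τ.not_ext_pos y (by
        rw [← h1, ← he, add_right_comm, sub_add_cancel]; exact hb hb'))
    refine ⟨⟨.sd x h', j⟩, ?_⟩
    change Raw.lab (NextV.par (.sd x h') (labC j).1) (labC j).2.1 (labC j).2.2 = _
    rw [hj]
    simp [Raw.lab]

theorem exists_code {r : Raw S.V A} (h : r.Valid τ S) :
    ∃ d : Dart (NextV.ty (τ := τ) (S := S)), code d = r := by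
  cases r with
  | m v p k =>
    obtain ⟨d, hd⟩ := exists_code_lab (τ := τ) (S := S) false h.1 h.2 nofun
    exact ⟨d, by simpa [Raw.lab] using hd⟩
  | c v p k =>
    obtain ⟨d, hd⟩ := exists_code_lab (τ := τ) (S := S) true h.1 h.2.1 fun _ => h.2.2
    exact ⟨d, by simpa [Raw.lab] using hd⟩
  | a v p k =>
    obtain ⟨h0, h1, h2, h3⟩ := h
    have hq : ∀ l, τ.Ext S.ty v (p - τ.ι (unitCorner k) + τ.ι (unitCorner l)) := by
      have e : ∀ k l, unitCorner l - unitCorner k = 0 ∨ unitCorner l - unitCorner k = U k ∨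
        unitCorner l - unitCorner k = U (k + 1) ∨
        unitCorner l - unitCorner k = U k + U (k + 1) := by decide
      intro l
      rw [sub_add_eq_add_sub, add_sub_assoc, ← map_sub]
      rcases e k l with e | e | e | e <;> rw [e]
      · rwa [map_zero, add_zero]
      · exact h1
      · exact h2
      · rwa [map_add, ← add_assoc]
    have e : ∀ j k : ZMod 4, j = -k → Raw.a v (p - τ.ι (unitCorner k) +
        τ.ι (unitCorner (-j))) (-j) = .a v p k := by
      rintro _ k rfl
      simp
    exact ⟨⟨.sq v _ hq, (-k : ZMod 4)⟩, e _ _ rfl⟩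

theorem eq_of_lab {V B : Type} {y y' : V × B × ZMod 4} {b b' : Bool} {κ κ' : ZMod 4}
    (h : Raw.lab y b κ = Raw.lab y' b' κ') :
    y.1 = y'.1 ∧ y.2.1 = y'.2.1 ∧ b = b' ∧ κ + y.2.2 = κ' + y'.2.2 := by
  cases b <;> cases b' <;> simp_all [Raw.lab]

theorem code_injective : Function.Injective (code (τ := τ) (S := S)) := by
  have hlab : ∀ v q h j y b κ, codeAt (.sq v q h : NextV τ S) j ≠ Raw.lab y b κ := by
    intro v q h j y b κ
    cases b <;> exact nofun
  rintro ⟨w, j⟩ ⟨w', j'⟩ he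
  change codeAt w j = codeAt w' j' at he
  cases w with
  | sq v q h =>
    cases w' with
    | sq v' q' h' =>
      have key : ∀ j j' : ZMod 4, Raw.a v (q + τ.ι (unitCorner (-j))) (-j) =
          .a v' (q' + τ.ι (unitCorner (-j'))) (-j') → v = v' ∧ q = q' ∧ j = j' := by
        intro j j' h
        simp only [Raw.a.injEq, neg_inj] at h
        obtain ⟨rfl, h, rfl⟩ := h
        exact ⟨rfl, add_right_cancel h, rfl⟩
      obtain ⟨rfl, rfl, rfl⟩ := key _ _ he
      rfl
    | pt v' p' h' => exact (hlab _ _ _ _ _ _ _ he).elim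
    | sd x' h' => exact (hlab _ _ _ _ _ _ _ he).elim
  | pt v p h =>
    cases w' with
    | sq v' q' h' => exact (hlab _ _ _ _ _ _ _ he.symm).elim
    | pt v' p' h' =>
      obtain ⟨h1, h2, h3, h4⟩ := eq_of_lab he
      have e := par_pt (τ := τ) v p h (labB j).1
      have e' := par_pt (τ := τ) v' p' h' (labB j').1
      rw [e, e'] at h1 h2 h4
      obtain rfl : v = v' := h1
      obtain rfl : p = p' := h2
      exact congrArg (Dart.mk _) (labB_injective j j'
        (Prod.ext (Subsingleton.elim _ _) (Prod.ext h3 (add_right_cancel h4))))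
    | sd x' h' =>
      obtain ⟨h1, h2, -⟩ := eq_of_lab he
      exact nomatch par_injective (i := ⟨.pt v p h, (labB j).1⟩) (i' := ⟨.sd x' h', (labC j').1⟩)
        h1 h2
  | sd x h =>
    cases w' with
    | sq v' q' h' => exact (hlab _ _ _ _ _ _ _ he.symm).elim
    | pt v' p' h' =>
      obtain ⟨h1, h2, -⟩ := eq_of_lab he
      exact nomatch par_injective (i := ⟨.sd x h, (labC j).1⟩) (i' := ⟨.pt v' p' h', (labB j').1⟩)
        h1 h2
    | sd x' h' =>
      obtain ⟨h1, h2, h3, h4⟩ := eq_of_lab he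
      have h5 := par_injective (i := ⟨.sd x h, (labC j).1⟩) (i' := ⟨.sd x' h', (labC j').1⟩) h1 h2
      injection h5 with h6 h7
      injection h6 with h6
      subst h6
      have h5 : (labC j).1 = (labC j').1 := h7
      rw [h5] at h4
      exact congrArg (Dart.mk _) (labC_injective j j'
        (Prod.ext h5 (Prod.ext h3 (add_right_cancel h4))))

theorem code_mid {d : Dart (NextV.ty (τ := τ) (S := S))} {v : S.V} {p : A} {k : ZMod 4}
    (h : code d = .m v p k) :
    ∃ i : Inner (NextV.ty (τ := τ) (S := S)), i.v = d.v ∧ i.par = (v, p, i.par.2.2) ∧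
      τ.pos d = τ.ι ((NextV.ty i.v).inn i.s) + τ.u (i.par.2.2 - k) ∧
      d.dr = i.par.2.2 - k + 1 ∧ d.prv.dr = i.par.2.2 - k + 1 ∧ d.corner = false := by
  obtain ⟨w, j⟩ := d
  cases w with
  | sq v q h => exact nomatch h
  | pt v' p' h' =>
    have h0 : Raw.lab (NextV.par (.pt v' p' h') (labB j).1) (labB j).2.1 (labB j).2.2 =
      Raw.lab (v, p, k) false 0 :=
        Eq.trans h (by simp [Raw.lab])
    obtain ⟨h1, h2, h3, h4⟩ := eq_of_lab h0
    obtain ⟨h5, h6, h7⟩ := labB_mid j h3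
    refine ⟨⟨.pt v' p' h', (labB j).1⟩, rfl, Prod.ext h1 (Prod.ext h2 rfl), ?_⟩
    change _ + _ = 0 + k at h4
    rw [zero_add] at h4
    have h8 : -(labB j).2.2 = (NextV.par (.pt v' p' h' : NextV τ S) (labB j).1).2.2 - k := by
      rw [← h4]; ring
    rw [h8] at h5 h6 h7
    refine ⟨?_, h6, h7, (labB_corner j).trans h3⟩
    exact (congrArg τ.ι h5).trans (map_add _ _ _)
  | sd x h' =>
    have h0 : Raw.lab (NextV.par (.sd x h') (labC j).1) (labC j).2.1 (labC j).2.2 =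
      Raw.lab (v, p, k) false 0 :=
        Eq.trans h (by simp [Raw.lab])
    obtain ⟨h1, h2, h3, h4⟩ := eq_of_lab h0
    obtain ⟨h5, h6, h7⟩ := labC_mid j h3
    refine ⟨⟨.sd x h', (labC j).1⟩, rfl, Prod.ext h1 (Prod.ext h2 rfl), ?_⟩
    change _ + _ = 0 + k at h4
    rw [zero_add] at h4
    have h8 : -(labC j).2.2 = (NextV.par (.sd x h' : NextV τ S) (labC j).1).2.2 - k := by
      rw [← h4]; ring
    rw [h8] at h5 h6 h7
    refine ⟨?_, h6, h7, (labC_corner j).trans h3⟩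
    exact (congrArg τ.ι h5).trans (map_add _ _ _)

/-- The coordinates of the middle of a side. -/
def Raw.isMid {V : Type} : Raw V A → Bool
  | .m .. => true
  | _ => false

theorem corner_eq (d : Dart (NextV.ty (τ := τ) (S := S))) : d.corner = !(code d).isMid := by
  obtain ⟨w, j⟩ := d
  cases w with
  | sq v q h =>
    have : ∀ j, Ty.A.corner j = true := by decide
    exact this j
  | pt v p h =>
    change _ = !(Raw.lab (NextV.par (.pt v p h) (labB j).1) (labB j).2.1 (labB j).2.2).isMid
    refine (labB_corner j).trans ?_
    cases (labB j).2.1 <;> rfl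
  | sd x h =>
    change _ = !(Raw.lab (NextV.par (.sd x h) (labC j).1) (labC j).2.1 (labC j).2.2).isMid
    refine (labC_corner j).trans ?_
    cases (labC j).2.1 <;> rfl

end Tess344

namespace Tess344

variable {A : Type} [AddCommGroup A] {τ : Torus A} {S : Surf}

/-- The effect of the gluing on coordinates. -/
inductive Glue (τ : Torus A) (S : Surf) : Raw S.V A → Raw S.V A → Prop
  | m (v p k) : Glue τ S (.m v p k) (.m v (p + τ.u k) (k + 2))
  | ac (v p k) : τ.Ext S.ty v (p + τ.u k + τ.u (k + 1)) → Glue τ S (.a v p k) (.c v p k)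
  | ca (v p k) : τ.Ext S.ty v (p + τ.u k + τ.u (k + 1)) → Glue τ S (.c v p k) (.a v p k)
  | cc (x : Dart S.ty) : x.corner = true →
      Glue τ S (.c x.v (τ.diag x) x.dr) (.c (S.h x).v (τ.diag (S.h x)) (S.h x).dr)

theorem diag_add_add {V : Type} {ty : V → Ty} (x : Dart ty) :
    τ.diag x + τ.u x.dr + τ.u (x.dr + 1) = τ.pos x := by
  rw [Torus.diag_add_u, aft_add_inward]

namespace Glue

theorem symm {r s : Raw S.V A} (h : Glue τ S r s) : Glue τ S s r := by
  cases h with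
  | m v p k =>
    have := Glue.m (τ := τ) (S := S) v (p + τ.u k) (k + 2)
    have e : ∀ k : ZMod 4, k + 2 + 2 = k := by decide
    rwa [τ.u_add_two, add_neg_cancel_right, e] at this
  | ac v p k h => exact .ca v p k h
  | ca v p k h => exact .ac v p k h
  | cc x h =>
    have := Glue.cc (τ := τ) (S.h x) (by rwa [S.corner_h])
    rwa [S.h_h] at this

theorem eq {r s t : Raw S.V A} (h : Glue τ S r s) (h' : Glue τ S r t) : s = t := by
  cases h with
  | m v p k => cases h'; rfl
  | ac v p k h => cases h'; rfl
  | ca v p k h =>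
    generalize hr : Raw.c v p k = r at h'
    cases h' with
    | m | ac => exact nomatch hr
    | ca => injection hr with h1 h2 h3; subst h1 h2 h3; rfl
    | cc x =>
      injection hr with h1 h2 h3
      subst h1 h2 h3
      rw [diag_add_add] at h
      exact (τ.not_ext_pos x h).elim
  | cc x hx =>
    generalize hr : Raw.c x.v (τ.diag x) x.dr = r at h'
    cases h' with
    | m | ac => exact nomatch hr
    | ca v p k h =>
      injection hr with h1 h2 h3
      subst h1 h2 h3
      rw [diag_add_add] at h
      exact (τ.not_ext_pos x h).elim
    | cc y =>
      injection hr with h1 h2 h3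
      obtain rfl : x = y := τ.pos_injective h1 (by
        rw [← diag_add_add, ← diag_add_add, h2, h3])
      rfl

end Glue

theorem exists_corner {v : S.V} {p : A} {k : ZMod 4} (h : (Raw.c v p k).Valid τ S)
    (hp : ¬ τ.Ext S.ty v (p + τ.u k + τ.u (k + 1))) :
    ∃ x : Dart S.ty, x.corner = true ∧ x.v = v ∧ τ.diag x = p ∧ x.dr = k := by
  obtain ⟨x, rfl, h1, h2, rfl⟩ := τ.inward_corner hp k
    (by rw [add_right_comm, add_sub_cancel_right]; exact h.2.2)
    (by rw [add_sub_cancel_right]; exact h.2.1)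
  refine ⟨x, h2, rfl, ?_, rfl⟩
  rw [← diag_add_add] at h1
  exact add_right_cancel (add_right_cancel h1)

theorem valid_diag {x : Dart S.ty} (h : x.corner = true) :
    (Raw.c x.v (τ.diag x) x.dr).Valid τ S := by
  refine ⟨τ.ext_diag h, ?_, ?_⟩
  · rw [τ.diag_add_u]
    exact τ.ext_aft x
  · rw [τ.diag_add_u_add_one h]
    exact τ.ext_bef x

theorem exists_glue {r : Raw S.V A} (h : r.Valid τ S) : ∃ s, s.Valid τ S ∧ Glue τ S r s := by
  cases r with
  | a v p k => exact ⟨.c v p k, ⟨h.1, h.2.1, h.2.2.1⟩, .ac v p k h.2.2.2⟩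
  | m v p k =>
    refine ⟨.m v (p + τ.u k) (k + 2), ⟨h.2, ?_⟩, .m v p k⟩
    rw [τ.u_add_two, add_neg_cancel_right]
    exact h.1
  | c v p k =>
    by_cases hp : τ.Ext S.ty v (p + τ.u k + τ.u (k + 1))
    · exact ⟨.a v p k, ⟨h.1, h.2.1, h.2.2, hp⟩, .ca v p k hp⟩
    · obtain ⟨x, hx, rfl, rfl, rfl⟩ := exists_corner h hp
      exact ⟨_, valid_diag (by rwa [S.corner_h]), .cc x hx⟩

theorem exists_glue_code (d : Dart (NextV.ty (τ := τ) (S := S))) :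
    ∃ d' : Dart (NextV.ty (τ := τ) (S := S)), Glue τ S (code d) (code d') := by
  obtain ⟨s, hs, h⟩ := exists_glue (valid_code d)
  obtain ⟨d', rfl⟩ := exists_code hs
  exact ⟨d', h⟩

/-- The gluing of the next layer. -/
noncomputable def nextH (d : Dart (NextV.ty (τ := τ) (S := S))) :
    Dart (NextV.ty (τ := τ) (S := S)) := (exists_glue_code d).choose

theorem glue_nextH (d : Dart (NextV.ty (τ := τ) (S := S))) :
    Glue τ S (code d) (code (nextH d)) := (exists_glue_code d).choose_spec

theorem code_nextH {d : Dart (NextV.ty (τ := τ) (S := S))} {r : Raw S.V A}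
    (h : Glue τ S (code d) r) : code (nextH d) = r := (glue_nextH d).eq h

theorem nextH_nextH (d : Dart (NextV.ty (τ := τ) (S := S))) : nextH (nextH d) = d :=
  code_injective (code_nextH (glue_nextH d).symm)

theorem code_rot_a {d : Dart (NextV.ty (τ := τ) (S := S))} {v p k} (h : code d = .a v p k) :
    code d.rot = .a v (p + τ.u (k + 1)) (k - 1) := by
  have := rotStep_code d
  rw [h] at this
  generalize code d.rot = t at this ⊢
  cases this
  rfl

theorem code_rot_c {d : Dart (NextV.ty (τ := τ) (S := S))} {v p k} (h : code d = .c v p k) :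
    code d.rot = .m v p k := by
  have := rotStep_code d
  rw [h] at this
  generalize code d.rot = t at this ⊢
  cases this
  rfl

theorem code_rot_m {d : Dart (NextV.ty (τ := τ) (S := S))} {v p k} (h : code d = .m v p k)
    (hp : τ.Ext S.ty v (p + τ.u (k - 1))) : code d.rot = .c v p (k - 1) := by
  have := rotStep_code d
  rw [h] at this
  generalize hr : Raw.m v p k = r at this
  generalize code d.rot = t at this ⊢
  have e : ∀ k : ZMod 4, k + 2 - 1 = k + 1 := by decide
  cases this with
  | a | c => exact nomatch hr
  | m => injection hr with h1 h2 h3; subst h1 h2 h3; rfl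
  | aft x =>
    injection hr with h1 h2 h3
    subst h1 h2 h3
    rw [e, aft_add_inward] at hp
    exact (τ.not_ext_pos x hp).elim
  | bef x =>
    injection hr with h1 h2 h3
    subst h1 h2 h3
    rw [e, bef_add_inward] at hp
    exact (τ.not_ext_pos x hp).elim

theorem code_rot_bef_h {x : Dart S.ty} (h : x.corner = false) :
    (Raw.m (S.h x).v (τ.bef (S.h x)) (S.h x).prv.dr : Raw S.V A) =
      .m (S.h x).v (τ.aft (S.h x)) (S.h x).dr := by
  have h' : (S.h x).corner = false := by rw [S.corner_h, h]
  rw [τ.aft_eq_bef h', Dart.dr_of_not_corner h']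

theorem code_rot_aft {d : Dart (NextV.ty (τ := τ) (S := S))} {x : Dart S.ty}
    (h : code d = .m x.v (τ.aft x) (x.dr + 2)) :
    code d.rot = .m (S.h x).v (τ.bef (S.h x)) (S.h x).prv.dr := by
  have := rotStep_code d
  have hv := valid_code d.rot
  rw [h] at this
  generalize hr : Raw.m x.v (τ.aft x) (x.dr + 2) = r at this
  generalize code d.rot = t at this hv ⊢
  have e : ∀ k : ZMod 4, k + 2 - 1 = k + 1 := by decide
  cases this with
  | a | c => exact nomatch hr
  | m =>
    injection hr with h1 h2 h3
    subst h1 h2 h3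
    have hv := hv.2.1
    rw [e, aft_add_inward] at hv
    exact (τ.not_ext_pos x hv).elim
  | aft y =>
    injection hr with h1 h2 h3
    rw [τ.aft_injective h1 h2]
  | bef y =>
    injection hr with h1 h2 h3
    obtain ⟨rfl, hc⟩ := τ.eq_of_aft_eq_bef h1 h2
    exact (code_rot_bef_h hc).symm

theorem code_rot_bef {d : Dart (NextV.ty (τ := τ) (S := S))} {x : Dart S.ty}
    (h : code d = .m x.v (τ.bef x) (x.prv.dr + 2)) :
    code d.rot = .m (S.h x).v (τ.aft (S.h x)) (S.h x).dr := by
  have := rotStep_code d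
  have hv := valid_code d.rot
  rw [h] at this
  generalize hr : Raw.m x.v (τ.bef x) (x.prv.dr + 2) = r at this
  generalize code d.rot = t at this hv ⊢
  have e : ∀ k : ZMod 4, k + 2 - 1 = k + 1 := by decide
  cases this with
  | a | c => exact nomatch hr
  | m =>
    injection hr with h1 h2 h3
    subst h1 h2 h3
    have hv := hv.2.1
    rw [e, bef_add_inward] at hv
    exact (τ.not_ext_pos x hv).elim
  | aft y =>
    injection hr with h1 h2 h3
    obtain ⟨rfl, hc⟩ := τ.eq_of_aft_eq_bef h1.symm h2.symm
    exact code_rot_bef_h hc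
  | bef y =>
    injection hr with h1 h2 h3
    rw [τ.bef_injective h1 h2]

/-- The dart that follows in the boundary of a face. -/
noncomputable def nextF (d : Dart (NextV.ty (τ := τ) (S := S))) :
    Dart (NextV.ty (τ := τ) (S := S)) := nextH d.rot

theorem nextF_injective : Function.Injective (nextF (τ := τ) (S := S)) := by
  intro d d' h
  have := congrArg nextH h
  rw [nextF, nextF, nextH_nextH, nextH_nextH] at this
  rw [← d.prv_rot, this, d'.prv_rot]

theorem code_nextF {d : Dart (NextV.ty (τ := τ) (S := S))} {r s : Raw S.V A}
    (h : code d.rot = r) (h' : Glue τ S r s) : code (nextF d) = s :=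
  code_nextH (h.symm ▸ h')

theorem code_nextF_c {d : Dart (NextV.ty (τ := τ) (S := S))} {v p k} (h : code d = .c v p k) :
    code (nextF d) = .m v (p + τ.u k) (k + 2) := code_nextF (code_rot_c h) (.m _ _ _)

theorem code_nextF_bef {d : Dart (NextV.ty (τ := τ) (S := S))} {x : Dart S.ty}
    (h : code d = .m x.v (τ.bef x) (x.prv.dr + 2)) : code (nextF d) =
      .m (S.h x).rot.v (τ.bef (S.h x).rot) ((S.h x).rot.prv.dr + 2) := by
  refine code_nextF (code_rot_bef h) ?_
  rw [Dart.prv_rot, ← τ.aft_add_u]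
  exact .m _ _ _

theorem tri_of_nextF {d : Dart (NextV.ty (τ := τ) (S := S))}
    (h : nextF (nextF (nextF (nextF d))) = nextF d) : nextF (nextF (nextF d)) = d :=
  nextF_injective h

theorem tri_of_a {d : Dart (NextV.ty (τ := τ) (S := S))} {v p k} (h : code d = .a v p k) :
    nextF (nextF (nextF d)) = d := by
  obtain ⟨h0, h1, h2, h3⟩ : (Raw.a v p k).Valid τ S := h ▸ valid_code d
  have e1 : k - 1 + 1 = k := by ring
  have e2 : k - 1 = k + 1 + 2 := by clear * -; revert k; decide
  have e3 : k - 1 + 2 = k + 1 := by clear * -; revert k; decide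
  have h4 : code (nextF d) = .c v (p + τ.u (k + 1)) (k - 1) := by
    refine code_nextF (code_rot_a h) (.ac _ _ _ ?_)
    rwa [e1, e2, τ.u_add_two, add_neg_cancel_right]
  have h5 := code_nextF_c h4
  rw [e3, e2, τ.u_add_two, add_neg_cancel_right] at h5
  have h6 := code_rot_m h5 (by rwa [add_sub_cancel_right])
  rw [add_sub_cancel_right] at h6
  exact code_injective ((code_nextF h6 (.ca _ _ _ h3)).trans h.symm)

theorem tri_of_diag {d : Dart (NextV.ty (τ := τ) (S := S))} {x : Dart S.ty}
    (hx : x.corner = true) (h : code d = .c x.v (τ.diag x) x.dr) :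
    nextF (nextF (nextF d)) = d := by
  have hy : (S.h x).corner = true := by rwa [S.corner_h]
  have h1 := code_nextF_c h
  rw [τ.diag_add_u] at h1
  have e : (S.h x).prv.dr + 2 = (S.h x).dr + 1 := by rw [Dart.dr_of_corner hy]; ring
  have h2 : code (nextF (nextF d)) = .m (S.h x).v (τ.diag (S.h x)) ((S.h x).dr + 1) := by
    refine code_nextF (code_rot_aft h1) ?_
    have e' : τ.diag (S.h x) = τ.bef (S.h x) + τ.u (S.h x).prv.dr := by
      rw [← τ.diag_add_u_add_one hy, ← e, τ.u_add_two, neg_add_cancel_right]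
    rw [e', ← e]
    exact .m _ _ _
  have h3 := code_rot_m h2 (by
    rw [add_sub_cancel_right, τ.diag_add_u]
    exact τ.ext_aft _)
  rw [add_sub_cancel_right] at h3
  exact code_injective ((code_nextF h3 (Glue.cc x hx).symm).trans h.symm)

theorem tri_of_c {d : Dart (NextV.ty (τ := τ) (S := S))} {v p k} (h : code d = .c v p k) :
    nextF (nextF (nextF d)) = d := by
  have hd : (Raw.c v p k).Valid τ S := h ▸ valid_code d
  by_cases hp : τ.Ext S.ty v (p + τ.u k + τ.u (k + 1))
  · have e1 : k + 2 - 1 = k + 1 := by ring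
    have e2 : k + 1 + 1 = k + 2 := by ring
    have h1 := code_rot_m (code_nextF_c h) (by rwa [e1])
    rw [e1] at h1
    have h2 := code_nextF h1 (.ca _ _ _ (by
      rw [e2, τ.u_add_two, add_right_comm, add_neg_cancel_right]
      exact hd.2.2))
    exact tri_of_nextF (tri_of_nextF (tri_of_a h2))
  · obtain ⟨x, hx, rfl, rfl, rfl⟩ := exists_corner hd hp
    exact tri_of_diag hx h

theorem tri_of_bef {d : Dart (NextV.ty (τ := τ) (S := S))} {x : Dart S.ty}
    (h : code d = .m x.v (τ.bef x) (x.prv.dr + 2)) : nextF (nextF (nextF d)) = d := by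
  have h1 := code_nextF_bef (code_nextF_bef (code_nextF_bef h))
  have h2 : (S.h (S.h (S.h x).rot).rot).rot = x := by
    have := S.tri x.prv
    rw [x.rot_prv] at this
    rw [this, x.rot_prv]
  rw [h2] at h1
  exact code_injective (h1.trans h.symm)

theorem tri_of_m {d : Dart (NextV.ty (τ := τ) (S := S))} {v p k} (h : code d = .m v p k) :
    nextF (nextF (nextF d)) = d := by
  have hd : (Raw.m v p k).Valid τ S := h ▸ valid_code d
  by_cases hp : τ.Ext S.ty v (p + τ.u (k - 1))
  · obtain ⟨s, -, hs⟩ := exists_glue (code_rot_m h hp ▸ valid_code d.rot)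
    have h1 := code_nextF (code_rot_m h hp) hs
    cases s with
    | a => exact tri_of_nextF (tri_of_a h1)
    | c => exact tri_of_nextF (tri_of_c h1)
    | m => exact nomatch hs.symm
  · obtain ⟨x, rfl, hx, hk⟩ := τ.inward hp (k - 1) (by rw [add_sub_cancel_right]; exact hd.1)
    have hp : p = τ.pos x - τ.u (k - 1) := by rw [hx, add_sub_cancel_right]
    have hb : k - 1 = x.prv.dr + 1 → nextF (nextF (nextF d)) = d := by
      intro hk
      refine tri_of_bef (x := x) ?_
      rw [h, Torus.bef, ← hk, ← hp, eq_add_of_sub_eq hk, add_assoc]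
      rfl
    rcases hk with hk | hk
    · cases hc : x.corner with
      | false => exact hb (by rw [hk, Dart.dr_of_not_corner hc])
      | true =>
        obtain ⟨d', hd'⟩ := exists_code (valid_diag (τ := τ) hc)
        have h1 : d = nextF d' := by
          refine code_injective ?_
          rw [h, code_nextF_c hd', τ.diag_add_u, Torus.aft, ← hk, ← hp, eq_add_of_sub_eq hk,
            add_assoc]
          rfl
        rw [h1]
        exact congrArg nextF (tri_of_diag hc hd')
    · exact hb hk

/-- A choice of a side for every edge between two outside points. -/
def Raw.side {V B : Type} : Raw V B → Bool
  | .m _ _ k => decide (k = 0 ∨ k = 1)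
  | _ => false

variable (τ S) in
/-- The next layer. -/
noncomputable def Surf.next : Surf where
  V := NextV τ S
  ty := NextV.ty
  h := nextH
  sg d := (code d).side
  h_h := nextH_nextH
  corner_h d := by
    rw [corner_eq, corner_eq]
    have := glue_nextH d
    generalize code d = r, code (nextH d) = s at this
    cases this <;> rfl
  tri d := by
    change nextF (nextF (nextF d)) = d
    cases h : code d with
    | a => exact tri_of_a h
    | m => exact tri_of_m h
    | c => exact tri_of_c h
  sg_h d hd := by
    rw [corner_eq] at hd
    have := glue_nextH d
    generalize code d = r, code (nextH d) = s at this hd ⊢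
    cases this with
    | m v p k =>
      clear hd
      revert k
      simp only [Raw.side]
      decide
    | _ => exact nomatch hd

end Tess344

namespace Tess344

variable {A : Type} [AddCommGroup A] {τ : Torus A}

/-- The surface of a single vertex with nothing occupied around it. -/
def Surf.root : Surf where
  V := Unit
  ty _ := .O
  h x := x
  sg _ := false
  h_h _ := rfl
  corner_h _ := rfl
  tri x := x.j.elim0
  sg_h x := x.j.elim0

variable (τ) in
/-- The successive layers. -/
noncomputable def surf : ℕ → Surf
  | 0 => .root
  | n + 1 => (surf n).next τ

variable (τ) in
/-- The vertices of all layers. -/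
abbrev Vert : Type := Σ n, (surf τ n).V

/-- The edge from an interior point to the previous layer. -/
noncomputable def down : (n : ℕ) → (v : (surf τ n).V) → Fin ((surf τ n).ty v).m →
    Vert τ × A × ZMod 4
  | 0, _, s => s.elim0
  | n + 1, v, s => (⟨n, (NextV.par (τ := τ) (S := surf τ n) v s).1⟩,
      (NextV.par (τ := τ) (S := surf τ n) v s).2)

/-- The edge from an outside point to the next layer. -/
noncomputable def up (n : ℕ) (i : Inner (NextV.ty (τ := τ) (S := surf τ n))) :
    Vert τ × A × ZMod 4 :=
  (⟨n + 1, i.v⟩, τ.ι ((NextV.ty i.v).inn i.s), i.par.2.2)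

/-- The edge from a boundary point, within a layer. -/
noncomputable def same (n : ℕ) (x : Dart (surf τ n).ty) : Vert τ × A × ZMod 4 :=
  (⟨n, ((surf τ n).h x).v⟩, τ.pos ((surf τ n).h x), 2 + ((surf τ n).h x).prv.dr + x.dr)

open Classical in
/-- The edges of all layers. -/
noncomputable def edge (v : Vert τ) (p : A) : Vert τ × A × ZMod 4 :=
  if h : τ.Ext (surf τ v.1).ty v.2 p then up v.1 (exists_par h).choose
  else if h' : ∃ x : Dart (surf τ v.1).ty, x.v = v.2 ∧ τ.pos x = p then same v.1 h'.choose
  else down v.1 v.2 ((τ.exists_of_not_ext h).resolve_left h').choose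

theorem edge_up (n : ℕ) (i : Inner (NextV.ty (τ := τ) (S := surf τ n))) :
    edge ⟨n, i.par.1⟩ i.par.2.1 = up n i := by
  have h := ext_par i
  rw [edge, dif_pos h]
  exact congrArg (up n)
    (par_injective (exists_par h).choose_spec.1 (exists_par h).choose_spec.2)

theorem edge_same (n : ℕ) (x : Dart (surf τ n).ty) : edge ⟨n, x.v⟩ (τ.pos x) = same n x := by
  have h : ∃ y : Dart (surf τ n).ty, y.v = x.v ∧ τ.pos y = τ.pos x := ⟨x, rfl, rfl⟩
  rw [edge, dif_neg (τ.not_ext_pos x), dif_pos h]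
  exact congrArg (same n) (τ.pos_injective h.choose_spec.1 h.choose_spec.2)

theorem edge_inn (n : ℕ) (v : (surf τ n).V) (s : Fin ((surf τ n).ty v).m) :
    edge ⟨n, v⟩ (τ.ι (((surf τ n).ty v).inn s)) = down n v s := by
  have h : ¬ ∃ y : Dart (surf τ n).ty, y.v = v ∧ τ.pos y = τ.ι (((surf τ n).ty v).inn s) := by
    rintro ⟨y, rfl, hy⟩
    exact τ.pos_ne_inn y s hy
  rw [edge, dif_neg (τ.not_ext_inn v s), dif_neg h]
  exact congrArg (down n v) (τ.inn_injective
    (Exists.choose_spec ((τ.exists_of_not_ext (τ.not_ext_inn v s)).resolve_left h)))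

theorem edge_down (n : ℕ) (i : Inner (NextV.ty (τ := τ) (S := surf τ n))) :
    edge (⟨n + 1, i.v⟩ : Vert τ) (τ.ι ((NextV.ty i.v).inn i.s)) =
      (⟨n, i.par.1⟩, i.par.2.1, i.par.2.2) :=
  edge_inn (n + 1) i.v i.s

theorem edge_of_par {n : ℕ} {i : Inner (NextV.ty (τ := τ) (S := surf τ n))} {v p e}
    (h : i.par = (v, p, e)) :
    edge ⟨n, v⟩ p = (⟨n + 1, i.v⟩, τ.ι ((NextV.ty i.v).inn i.s), e) := by
  have := edge_up n i
  rwa [up, h] at this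

theorem Surf.dr_add (S : Surf) (x : Dart S.ty) :
    (S.h x).dr + x.prv.dr = (S.h x).prv.dr + x.dr := by
  have := S.corner_h x
  cases h : x.corner with
  | true =>
    rw [Dart.dr_of_corner h, Dart.dr_of_corner (this.trans h)]
    ring
  | false => rw [Dart.dr_of_not_corner h, Dart.dr_of_not_corner (this.trans h)]

theorem edge_edge (v : Vert τ) (p : A) :
    edge (edge v p).1 (edge v p).2.1 = (v, p, (edge v p).2.2) := by
  obtain ⟨n, v⟩ := v
  by_cases h : τ.Ext (surf τ n).ty v p
  · obtain ⟨i, rfl, rfl⟩ := exists_par h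
    rw [edge_up]
    exact edge_down n i
  · rcases τ.exists_of_not_ext h with ⟨x, rfl, rfl⟩ | ⟨s, rfl⟩
    · rw [edge_same]
      refine (edge_same n ((surf τ n).h x)).trans ?_
      rw [same, (surf τ n).h_h, same, add_assoc, add_assoc, ← (surf τ n).dr_add,
        add_comm (Dart.dr _)]
    · cases n with
      | zero => exact s.elim0
      | succ n =>
        rw [edge_inn]
        exact edge_up n ⟨v, s⟩

variable (τ) in
/-- The net of all layers. -/
noncomputable def net : Net (Vert τ) A τ.u where
  nb := edge
  u_add_two := τ.u_add_two
  nb_symm := edge_edge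

section Good

variable {n : ℕ}

theorem good_of_ext_ext {v : (surf τ n).V} {p : A} {k : ZMod 4} (h : τ.Ext (surf τ n).ty v p)
    (hk : τ.Ext (surf τ n).ty v (p + τ.u k)) : (net τ).Good ⟨n, v⟩ p k := by
  obtain ⟨d, hd⟩ := exists_code (τ := τ) (S := surf τ n) (r := .m v p k) ⟨h, hk⟩
  have hd' : code (nextH d) = _ := code_nextH (hd ▸ Glue.m v p k)
  obtain ⟨i, h1, h2, h3, h4, -, -⟩ := code_mid hd
  obtain ⟨i', h1', h2', h3', -, h5', -⟩ := code_mid hd'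
  refine Net.good_of_nb_eq (edge_of_par h2) (edge_of_par h2') ?_
  rw [← h3, h1]
  refine (edge_same (n + 1) d).trans ?_
  have e : i'.par.2.2 - (k + 2) = i'.par.2.2 - k + 2 := by
    generalize i'.par.2.2 = e
    clear * -
    revert e k
    decide
  have e' : 2 + (nextH d).prv.dr + d.dr = 2 + i.par.2.2 + i'.par.2.2 - 2 * k := by
    rw [h4, h5', e]
    have : (4 : ZMod 4) = 0 := rfl
    linear_combination this
  refine Prod.ext (congrArg (Sigma.mk (n + 1)) h1'.symm) (Prod.ext ?_ e')
  rw [sub_eq_add_neg, ← τ.u_add_two, ← e]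
  exact h3'

theorem good_aft {x : Dart (surf τ n).ty} (h : x.corner = true ∨ (surf τ n).sg x = true) :
    (net τ).Good ⟨n, x.v⟩ (τ.pos x) (x.dr + 3) := by
  have e3 : ∀ d : ZMod 4, d + 3 = d + 1 + 2 := by decide
  have h1 := edge_of_par (τ := τ) (n := n) (i := ⟨.sd x h, (0 : Fin 2)⟩) rfl
  have h2 := edge_of_par (τ := τ) (n := n) (i := ⟨.sd x h, (1 : Fin 2)⟩) rfl
  rw [Torus.aft, sub_eq_add_neg, ← τ.u_add_two, ← e3] at h1
  refine Net.good_of_nb_eq (edge_same n x) h1 ?_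
  have e : 2 + ((surf τ n).h x).prv.dr + x.dr - (x.dr + 3) =
      ((surf τ n).h x).prv.dr + 1 + 2 := by
    generalize ((surf τ n).h x).prv.dr = d, x.dr = d'
    revert d d'
    decide
  rw [e, τ.u_add_two, ← sub_eq_add_neg]
  refine h2.trans ?_
  have e1 : x.dr + 1 - (x.dr + 3) = 2 := by ring_nf; rfl
  have e2 : 2 + (2 + ((surf τ n).h x).prv.dr + x.dr) + (x.dr + 1) - 2 * (x.dr + 3) =
      ((surf τ n).h x).prv.dr + 3 := by
    have : (4 : ZMod 4) = 0 := rfl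
    linear_combination -this
  rw [e1, e2, Torus.u, ← map_sub]
  rfl

theorem good_bef {x : Dart (surf τ n).ty}
    (h : ((surf τ n).h x).corner = true ∨ (surf τ n).sg ((surf τ n).h x) = true) :
    (net τ).Good ⟨n, x.v⟩ (τ.pos x) (x.prv.dr + 3) := by
  have e3 : ∀ d : ZMod 4, d + 3 = d + 1 + 2 := by decide
  have hd := (surf τ n).dr_add x
  have h4 : (4 : ZMod 4) = 0 := rfl
  have h1 := edge_of_par (τ := τ) (n := n) (i := ⟨.sd ((surf τ n).h x) h, (0 : Fin 2)⟩) rfl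
  have h2 := edge_of_par (τ := τ) (n := n) (i := ⟨.sd ((surf τ n).h x) h, (1 : Fin 2)⟩)
    (v := x.v) (p := τ.bef x) (e := x.prv.dr + 3) (by
      change (((surf τ n).h ((surf τ n).h x)).v, τ.bef ((surf τ n).h ((surf τ n).h x)),
        ((surf τ n).h ((surf τ n).h x)).prv.dr + 3) = _
      rw [(surf τ n).h_h])
  rw [Torus.bef, sub_eq_add_neg, ← τ.u_add_two, ← e3] at h2
  refine Net.good_of_nb_eq (edge_same n x) h2 ?_
  have e : 2 + ((surf τ n).h x).prv.dr + x.dr - (x.prv.dr + 3) =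
      ((surf τ n).h x).dr + 1 + 2 := by
    linear_combination -hd - h4
  rw [e, τ.u_add_two, ← sub_eq_add_neg]
  refine h1.trans ?_
  have e1 : x.prv.dr + 3 - (x.prv.dr + 3) = 0 := sub_self _
  have e2 : 2 + (2 + ((surf τ n).h x).prv.dr + x.dr) + (x.prv.dr + 3) - 2 * (x.prv.dr + 3) =
      ((surf τ n).h x).dr + 1 := by
    linear_combination -hd
  rw [e1, e2, Torus.u, ← map_sub]
  rfl

theorem good_of_pos_ext {x : Dart (surf τ n).ty} {k : ZMod 4}
    (hk : τ.Ext (surf τ n).ty x.v (τ.pos x + τ.u k)) : (net τ).Good ⟨n, x.v⟩ (τ.pos x) k := by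
  obtain ⟨y, hv, hy, hyk⟩ := τ.inward (τ.not_ext_pos x) (k + 2)
    (by rwa [τ.u_add_two, sub_neg_eq_add])
  obtain rfl := τ.pos_injective hv hy
  have e : ∀ k d : ZMod 4, k + 2 = d + 1 → k = d + 3 := by decide
  have hc := (surf τ n).corner_h y
  cases h : y.corner with
  | true =>
    rcases hyk with hyk | hyk <;> rw [e _ _ hyk]
    · exact good_aft (.inl h)
    · exact good_bef (.inl (hc.trans h))
  | false =>
    have hd := Dart.dr_of_not_corner h
    rw [hd, or_self] at hyk
    cases hs : (surf τ n).sg y with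
    | true =>
      rw [e _ _ hyk, ← hd]
      exact good_aft (.inr hs)
    | false =>
      rw [e _ _ hyk]
      exact good_bef (.inr (by rw [(surf τ n).sg_h y h, hs]; rfl))

theorem good_of_ext {v : (surf τ n).V} {p : A} (k : ZMod 4) (h : τ.Ext (surf τ n).ty v p) :
    (net τ).Good ⟨n, v⟩ p k := by
  by_cases hk : τ.Ext (surf τ n).ty v (p + τ.u k)
  · exact good_of_ext_ext h hk
  have hp : p + τ.u k + τ.u (k + 2) = p := by rw [τ.u_add_two, add_neg_cancel_right]
  rcases τ.exists_of_not_ext hk with ⟨x, rfl, hx⟩ | ⟨s, hs⟩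
  · refine Net.Good.of_symm ?_
    rw [← hx]
    refine good_of_pos_ext ?_
    rwa [hx, hp]
  · refine absurd ?_ (τ.not_ext_inn_add v s (k + 2))
    rwa [hs, hp]

theorem good_rot (x : Dart (surf τ n).ty) : (net τ).Good ⟨n, x.v⟩ (τ.pos x) x.dr := by
  obtain ⟨z, hz⟩ : ∃ z, z = (surf τ n).h x.rot := ⟨_, rfl⟩
  have h1 : (surf τ n).h ((surf τ n).h x).prv = z.rot := by
    have := congrArg (surf τ n).h ((surf τ n).tri x)
    rw [(surf τ n).h_h, ← hz] at this
    rw [← this, Dart.prv_rot, (surf τ n).h_h]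
  have h4 : (4 : ZMod 4) = 0 := rfl
  have hd := (surf τ n).dr_add x.rot
  rw [← hz, Dart.prv_rot] at hd
  have h2 : edge ⟨n, x.v⟩ (τ.pos x + τ.u x.dr) = same n x.rot := by
    rw [← τ.pos_rot]
    exact edge_same n x.rot
  refine Net.good_of_nb_eq (edge_same n x) h2 ?_
  have e : 2 + ((surf τ n).h x).prv.dr + x.dr - x.dr = ((surf τ n).h x).prv.dr + 2 := by ring
  have e' : 2 + z.prv.dr + x.rot.dr - x.dr = z.dr + 2 := by linear_combination -hd
  have h3 : τ.pos ((surf τ n).h x) + τ.u (((surf τ n).h x).prv.dr + 2) =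
      τ.pos ((surf τ n).h x).prv := by
    rw [τ.u_add_two, ← sub_eq_add_neg, sub_eq_iff_eq_add, ← τ.pos_rot, Dart.rot_prv]
  rw [e, h3, ← hz, e']
  refine (edge_same n ((surf τ n).h x).prv).trans ?_
  rw [same, h1, Dart.prv_rot, τ.pos_rot, τ.u_add_two, sub_neg_eq_add]
  refine Prod.ext rfl (Prod.ext rfl ?_)
  change 2 + z.dr + _ = _
  linear_combination hd - h4

end Good

theorem good (v : Vert τ) (p : A) (k : ZMod 4) : (net τ).Good v p k := by
  have hinn : ∀ n (v : (surf τ n).V) s k,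
      (net τ).Good ⟨n, v⟩ (τ.ι (((surf τ n).ty v).inn s)) k := by
    intro n v s k
    cases n with
    | zero => exact s.elim0
    | succ n =>
      refine Net.good_of_nb ?_
      have h : (net τ).nb ⟨n + 1, v⟩ (τ.ι (((surf τ (n + 1)).ty v).inn s)) = _ :=
        edge_inn (n + 1) v s
      rw [h]
      exact good_of_ext _ (ext_par (τ := τ) (S := surf τ n) ⟨v, s⟩)
  obtain ⟨n, v⟩ := v
  by_cases h : τ.Ext (surf τ n).ty v p
  · exact good_of_ext k h
  rcases τ.exists_of_not_ext h with ⟨x, rfl, rfl⟩ | ⟨s, rfl⟩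
  · by_cases hk : τ.Ext (surf τ n).ty x.v (τ.pos x + τ.u k)
    · exact good_of_pos_ext hk
    rcases τ.exists_of_not_ext hk with ⟨y, hv, hy⟩ | ⟨s, hs⟩
    · rcases τ.consecutive hv.symm hy.symm with ⟨-, rfl⟩ | ⟨rfl, rfl⟩
      · exact good_rot x
      · refine Net.Good.of_symm ?_
        rw [← hy]
        have e : ∀ d : ZMod 4, d + 2 + 2 = d := by decide
        rw [e]
        exact good_rot y
    · refine Net.Good.of_symm ?_
      rw [← hs]
      exact hinn n x.v s _
  · exact hinn n v s k

theorem ext_inn_add (n : ℕ) (v : (surf τ n).V) (s : Fin ((surf τ n).ty v).m) :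
    τ.Ext (surf τ n).ty v (τ.ι (((surf τ n).ty v).inn s) + τ.u 3 + τ.u 3) := fun q hq => by
  rw [Torus.u, ← map_add, ← map_add]
  exact (τ.ne_of_apart (Ty.apart_inn_add _ s q hq)).symm

variable (τ) in
/-- A straight path through all layers. -/
theorem exists_chain : ∃ (v : ℕ → Vert τ) (p : ℕ → A), (∀ n, (v n).1 = n) ∧
    (∀ n, ((net τ).nb (v n) (p n)).1 = v (n + 1)) ∧
    ∀ n, p (n + 1) = ((net τ).nb (v n) (p n)).2.1 + τ.u 3 + τ.u 3 := by
  let f : Vert τ × A → Vert τ × A := fun x =>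
    ((edge x.1 x.2).1, (edge x.1 x.2).2.1 + τ.u 3 + τ.u 3)
  let c : ℕ → Vert τ × A := fun n => f^[n] (⟨0, ()⟩, 0)
  have hc : ∀ n, c (n + 1) = f (c n) := fun n => Function.iterate_succ_apply' f n _
  have key : ∀ n, (c n).1.1 = n ∧ τ.Ext (surf τ (c n).1.1).ty (c n).1.2 (c n).2 := by
    intro n
    induction n with
    | zero => exact ⟨rfl, fun q hq => nomatch hq⟩
    | succ n ih =>
      rw [hc]
      generalize c n = x at ih
      obtain ⟨⟨m, v⟩, p⟩ := x
      obtain ⟨rfl, ih : τ.Ext (surf τ m).ty v p⟩ := ih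
      obtain ⟨i, rfl, rfl⟩ := exists_par ih
      have he := edge_up m i
      simp only [f]
      rw [he]
      exact ⟨rfl, ext_inn_add (m + 1) i.v i.s⟩
  exact ⟨fun n => (c n).1, fun n => (c n).2, fun n => (key n).1,
    fun n => congrArg Prod.fst (hc n).symm, fun n => congrArg Prod.snd (hc n)⟩

variable (τ) in
theorem Torus.infinite (a b : ℕ) (h : ∀ d, a • τ.u (d - 1) + b • τ.u (d + 2) = 0) :
    Infinite (PresentedGroup (tessRels 3 4 4 a b)) := by
  obtain ⟨v, p, h1, h2, h3⟩ := exists_chain τ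
  refine (net τ).infinite_group a b good h v p (fun m n hmn => ?_) h2 h3
  rw [← h1 m, hmn, h1]

end Tess344

namespace Tess344

/-- The lattice of Gaussian multiples of `a - bi`. -/
def lattice (a b : ℕ) : AddSubgroup (ℤ × ℤ) where
  carrier := {p | ∃ m n : ℤ, p = (m * a + n * b, n * a - m * b)}
  zero_mem' := ⟨0, 0, by ext <;> simp⟩
  add_mem' := by
    rintro _ _ ⟨m, n, rfl⟩ ⟨m', n', rfl⟩
    exact ⟨m + m', n + n', by ext <;> simp only [Prod.mk_add_mk] <;> ring⟩
  neg_mem' := by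
    rintro _ ⟨m, n, rfl⟩
    exact ⟨-m, -n, by ext <;> simp only [Prod.neg_mk] <;> ring⟩

theorem lattice_small {a b : ℕ} (h : 36 ≤ a ^ 2 + b ^ 2) {g : ℤ × ℤ} (hg : g ∈ lattice a b) :
    g = 0 ∨ 36 ≤ g.1 ^ 2 + g.2 ^ 2 := by
  obtain ⟨m, n, rfl⟩ := hg
  by_cases hmn : m = 0 ∧ n = 0
  · exact .inl (by simp [hmn])
  · refine .inr ?_
    have h1 : 1 ≤ m ^ 2 + n ^ 2 := by
      by_contra! h1
      exact hmn ⟨by nlinarith, by nlinarith⟩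
    have h2 : (36 : ℤ) ≤ a ^ 2 + b ^ 2 := by exact_mod_cast h
    nlinarith [mul_le_mul h1 h2 (by norm_num) (by positivity)]

theorem nsmul_U_mem_lattice (a b : ℕ) (d : ZMod 4) :
    a • U (d - 1) + b • U (d + 2) ∈ lattice a b := by
  have key : ∀ d, (U (d - 1), U (d + 2)) = ((0, -1), (-1, 0)) ∨
      (U (d - 1), U (d + 2)) = ((1, 0), (0, -1)) ∨ (U (d - 1), U (d + 2)) = ((0, 1), (1, 0)) ∨
      (U (d - 1), U (d + 2)) = ((-1, 0), (0, 1)) := by decide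
  rcases key d with h | h | h | h <;> obtain ⟨h1, h2⟩ := Prod.mk.inj h <;> rw [h1, h2]
  · exact ⟨0, -1, by simp⟩
  · exact ⟨1, 0, by simp⟩
  · exact ⟨0, 1, by simp⟩
  · exact ⟨-1, 0, by simp⟩

/-- The torus that is the link of a cusp. -/
def cuspTorus {a b : ℕ} (h : 36 ≤ a ^ 2 + b ^ 2) : Torus ((ℤ × ℤ) ⧸ lattice a b) where
  ι := QuotientAddGroup.mk' _
  small _ hg := lattice_small h ((QuotientAddGroup.eq_zero_iff _).1 hg)

end Tess344

/-- octahedral case of Theorem 7.1: for integers a ≥ b ≥ 0 with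
a+b ≥ 9 or a ≥ 6, the group G_{3,4,4}(a,b) is infinite. -/
theorem tessGroup_344_infinite (a b : ℕ) (hab : b ≤ a) (h : 9 ≤ a + b ∨ 6 ≤ a) :
    Infinite (tessGroup 3 4 4 a b) := by
  have hn : 36 ≤ a ^ 2 + b ^ 2 := by
    by_cases h6 : 6 ≤ a
    · nlinarith
    · obtain rfl : a = 5 := by omega
      have : 4 ≤ b := by omega
      nlinarith
  refine (Tess344.cuspTorus hn).infinite a b fun d => ?_
  exact (QuotientAddGroup.eq_zero_iff _).2 (Tess344.nsmul_U_mem_lattice a b d)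
end

section
/- For (a,b) equal to (2,2), (3,0), (3,1), (3,2), (4,0), (4,1), (5,0), the presented group G_{5,3,6}(a,b) = ⟨P, Q, R | P⁵, Q³, R⁶, (PQ)², (QR)², (PQR)², (QR⁴)^a (RQR³)^b⟩ is infinite. (These are the dodecahedral cases of Table 6, proved in the paper via Gap by exhibiting a finite-index subgroup with infinite abelianization or satisfying Newman's infinity criterion; they show the corresponding universal regular tessellations of type {5,3,6} are infinite volume.) -/
/-- Elements of a monoid satisfying the relations of `tessGroup` generate a quotient of it. -/
theorem exists_tessGroup_hom {M : Type*} [Monoid M] {p q r : ℕ} (a b : ℕ)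
    (hp : p ≠ 0) (hq : q ≠ 0) (hr : r ≠ 0) {P Q R : M}
    (hP : P ^ p = 1) (hQ : Q ^ q = 1) (hR : R ^ r = 1) (hPQ : (P * Q) ^ 2 = 1)
    (hQR : (Q * R) ^ 2 = 1) (hPQR : (P * Q * R) ^ 2 = 1)
    (hab : (Q * R ^ (r / 2 + 1)) ^ a * (R * Q * R ^ (r / 2)) ^ b = 1) :
    ∃ (φ : tessGroup p q r a b →* Mˣ) (x y : tessGroup p q r a b),
      (φ x : M) = P ∧ (φ y : M) = R := by
  let f : Fin 3 → Mˣ :=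
    ![Units.ofPowEqOne P p hP hp, Units.ofPowEqOne Q q hQ hq, Units.ofPowEqOne R r hR hr]
  have hf : ∀ w ∈ tessRels p q r a b, FreeGroup.lift f w = 1 := by
    intro w hw
    simp only [tessRels, Set.mem_insert_iff, Set.mem_singleton_iff] at hw
    rcases hw with rfl | rfl | rfl | rfl | rfl | rfl | rfl <;>
      simp [f, Units.ext_iff, *]
  exact ⟨PresentedGroup.toGroup hf, PresentedGroup.of 0, PresentedGroup.of 2,
    congrArg Units.val (PresentedGroup.toGroup.of hf),
    congrArg Units.val (PresentedGroup.toGroup.of hf)⟩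

/-- The self-map of `α × ℤ` covering `σ : α → α` and translating the fibre over `i` by `c i`. -/
def shear {α : Type*} (σ : α → α) (c : α → ℤ) : Function.End (α × ℤ) :=
  fun x => (σ x.1, x.2 + c x.1)

/-- The self-maps of `α × ℤ` that commute with the translations of the second factor. -/
def translationEquivariant (α : Type*) : Submonoid (Function.End (α × ℤ)) where
  carrier := {f | ∀ i n, f (i, n) = ((f (i, 0)).1, n + (f (i, 0)).2)}
  one_mem' i n := by simp [Function.End.one_def]
  mul_mem' {f g} hf hg i n := by
    change f (g (i, n)) = ((f (g (i, 0))).1, n + (f (g (i, 0))).2)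
    rw [hg i n, hf, hf (g (i, 0)).1 (g (i, 0)).2, add_assoc]

theorem shear_mem {α : Type*} (σ : α → α) (c : α → ℤ) :
    shear σ c ∈ translationEquivariant α := fun i n => by simp [shear]

theorem eq_one_of_mem {α : Type*} {f : Function.End (α × ℤ)} (hf : f ∈ translationEquivariant α)
    (h : ∀ i, f (i, 0) = (i, 0)) : f = 1 := by
  funext ⟨i, n⟩
  simp [hf i n, h, Function.End.one_def]

theorem pow_apply_of_mem {α : Type*} {f : Function.End (α × ℤ)}
    (hf : f ∈ translationEquivariant α) {i : α} {c : ℤ} (h : f (i, 0) = (i, c)) (n : ℕ) :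
    (f ^ n) (i, 0) = (i, n * c) := by
  induction n with
  | zero => simp [Function.End.one_def]
  | succ n ih =>
    rw [pow_succ']
    change f ((f ^ n) (i, 0)) = _
    rw [ih, hf, h]
    push_cast
    ring_nf

/-- If the generators act on `α × ℤ` by shears satisfying the relations, and some element
`(P ^ s * R ^ t) ^ k` translates a fibre nontrivially, then the group is infinite. -/
theorem infinite_tessGroup_of_shear {α : Type*} {p q r a b : ℕ}
    (P Q R : α → α) (c d : α → ℤ) (s t k : ℕ) (i : α)
    (hp : p ≠ 0) (hq : q ≠ 0) (hr : r ≠ 0)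
    (hP : ∀ i, (shear P c ^ p) (i, 0) = (i, 0))
    (hQ : ∀ i, (shear Q 0 ^ q) (i, 0) = (i, 0))
    (hR : ∀ i, (shear R d ^ r) (i, 0) = (i, 0))
    (hPQ : ∀ i, ((shear P c * shear Q 0) ^ 2) (i, 0) = (i, 0))
    (hQR : ∀ i, ((shear Q 0 * shear R d) ^ 2) (i, 0) = (i, 0))
    (hPQR : ∀ i, ((shear P c * shear Q 0 * shear R d) ^ 2) (i, 0) = (i, 0))
    (hab : ∀ i, ((shear Q 0 * shear R d ^ (r / 2 + 1)) ^ a *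
      (shear R d * shear Q 0 * shear R d ^ (r / 2)) ^ b) (i, 0) = (i, 0))
    (hfix : (((shear P c ^ s * shear R d ^ t) ^ k) (i, 0)).1 = i)
    (hmove : (((shear P c ^ s * shear R d ^ t) ^ k) (i, 0)).2 ≠ 0) :
    Infinite (tessGroup p q r a b) := by
  have mP := shear_mem P c
  have mQ := shear_mem Q 0
  have mR := shear_mem R d
  obtain ⟨φ, x, y, hx, hy⟩ := exists_tessGroup_hom a b hp hq hr
    (eq_one_of_mem (pow_mem mP _) hP) (eq_one_of_mem (pow_mem mQ _) hQ)
    (eq_one_of_mem (pow_mem mR _) hR) (eq_one_of_mem (pow_mem (mul_mem mP mQ) _) hPQ)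
    (eq_one_of_mem (pow_mem (mul_mem mQ mR) _) hQR)
    (eq_one_of_mem (pow_mem (mul_mem (mul_mem mP mQ) mR) _) hPQR)
    (eq_one_of_mem (mul_mem (pow_mem (mul_mem mQ (pow_mem mR _)) _)
      (pow_mem (mul_mem (mul_mem mR mQ) (pow_mem mR _)) _)) hab)
  by_contra hfin
  rw [not_infinite_iff_finite] at hfin
  have hg : (φ ((x ^ s * y ^ t) ^ k) : Function.End (α × ℤ)) =
      (shear P c ^ s * shear R d ^ t) ^ k := by
    simp [hx, hy]
  have hpow := congrArg (fun g => (φ g : Function.End (α × ℤ)))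
    (pow_card_eq_one' (x := (x ^ s * y ^ t) ^ k))
  simp only [map_pow φ _ (Nat.card _), Units.val_pow_eq_pow_val, hg, map_one, Units.val_one]
    at hpow
  have := congrFun hpow (i, 0)
  rw [pow_apply_of_mem (pow_mem (mul_mem (pow_mem mP _) (pow_mem mR _)) _)
    (Prod.ext hfix rfl)] at this
  simpa [Function.End.one_def, Nat.card_pos.ne', hmove] using congrArg Prod.snd this

theorem infinite_tessGroup_five_three_six_two_two : Infinite (tessGroup 5 3 6 2 2) :=
  infinite_tessGroup_of_shear (α := Fin 22)
    ![1, 9, 11, 10, 0, 2, 13, 8, 6, 18, 17, 12, 16, 21, 15, 3, 5, 14, 4, 19, 20, 7]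
    ![0, 4, 7, 1, 3, 11, 2, 6, 5, 15, 18, 8, 16, 21, 9, 14, 19, 10, 17, 12, 13, 20]
    ![6, 8, 0, 4, 5, 3, 2, 7, 11, 12, 9, 1, 10, 13, 18, 17, 14, 15, 19, 21, 16, 20]
    0
    ![0, 0, 0, 0, 0, 0, 0, 0, 0, 0, 0, 0, 0, 0, 0, 0, 0, 0, 0, -1, 1, 0]
    2 2 2 2
    (by decide) (by decide) (by decide)
    (by decide +kernel) (by decide +kernel) (by decide +kernel)
    (by decide +kernel) (by decide +kernel) (by decide +kernel)
    (by decide +kernel) (by decide +kernel) (by decide +kernel)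

theorem infinite_tessGroup_five_three_six_three_zero : Infinite (tessGroup 5 3 6 3 0) :=
  infinite_tessGroup_of_shear (α := Fin 18)
    ![1, 5, 0, 6, 3, 12, 10, 14, 9, 7, 13, 11, 2, 4, 17, 15, 16, 8]
    ![2, 0, 1, 8, 6, 12, 9, 3, 7, 4, 13, 5, 11, 15, 17, 10, 14, 16]
    ![7, 9, 4, 1, 2, 10, 0, 3, 8, 6, 5, 12, 15, 11, 14, 17, 13, 16]
    ![0, 0, 0, 0, 0, 0, 0, -1, 0, 0, 0, 0, 0, 0, 0, 0, 0, 1]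
    0
    1 1 5 0
    (by decide) (by decide) (by decide)
    (by decide +kernel) (by decide +kernel) (by decide +kernel)
    (by decide +kernel) (by decide +kernel) (by decide +kernel)
    (by decide +kernel) (by decide +kernel) (by decide +kernel)

/-- The self-map of `Fin n` whose values are the base-`n` digits of `m`. -/
def digitMap (n : ℕ) [NeZero n] (m : ℕ) : Fin n → Fin n :=
  fun i => Fin.ofNat n (m / n ^ (i : ℕ))

/-- The action of `P` on `26` points, satisfying the relations of `tessGroup 5 3 6 3 1`. -/
def pointPermP : Fin 26 → Fin 26 :=
  digitMap 26 3047210192680610988370414275613847825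

/-- The action of `Q` on `26` points, satisfying the relations of `tessGroup 5 3 6 3 1`. -/
def pointPermQ : Fin 26 → Fin 26 :=
  digitMap 26 5863945874741754596870682566436989250

/-- The action of `R` on `26` points, satisfying the relations of `tessGroup 5 3 6 3 1`. -/
def pointPermR : Fin 26 → Fin 26 :=
  digitMap 26 6099682336454337593048760657655172750

/-- Translation lengths of `R` over the pairs of points, making the action of
`tessGroup 5 3 6 3 1` on pairs into an action by shears. The lengths over the pairs `(i, j)` are the
base-`7` digits of the `i`-th entry, shifted by `3` to lie between `-3` and `3`. -/
def pairVoltage (i j : Fin 26) : ℤ :=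
  ((![
    4756273520294598449472, 4747483113122362214472, 5980190167834313764644,
    2457312757853409943854, 2393803176834948429918, 4501998716911397235774,
    4885326309100096775496, 4693751569075266784668, 7368650513075097203052,
    5812453358811193151718, 4307704484840404612962, 7149107752066313100450,
    4693740633891173325084, 2401638694074716743692, 3325223000148441252570,
    4693739934836882183826, 4693764595025908982868, 4634534302413352921170,
    5680132198027968332220, 4698049017766797175428, 4693717370548738496898,
    4693754591722577402934, 4693751335278037548318, 4693741331296206336264,
    4693736912187876828222, 4693741796369480500866] : Fin 26 → ℕ) i / 7 ^ (j : ℕ) % 7 : ℕ) - 3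

theorem infinite_tessGroup_five_three_six_three_one : Infinite (tessGroup 5 3 6 3 1) :=
  infinite_tessGroup_of_shear (α := Fin 26 × Fin 26)
    (Prod.map pointPermP pointPermP) (Prod.map pointPermQ pointPermQ) (Prod.map pointPermR pointPermR)
    0 (fun x => pairVoltage x.1 x.2)
    1 1 8 (1, 2)
    (by decide) (by decide) (by decide)
    (by decide +kernel) (by decide +kernel) (by decide +kernel)
    (by decide +kernel) (by decide +kernel) (by decide +kernel)
    (by decide +kernel) (by decide +kernel) (by decide +kernel)

theorem infinite_tessGroup_five_three_six_three_two : Infinite (tessGroup 5 3 6 3 2) :=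
  infinite_tessGroup_of_shear (α := Fin 20)
    ![1, 4, 6, 0, 9, 16, 11, 15, 2, 3, 13, 12, 8, 7, 5, 19, 18, 14, 17, 10]
    ![0, 3, 1, 2, 8, 11, 9, 4, 7, 13, 5, 10, 14, 6, 15, 12, 19, 16, 18, 17]
    ![0, 1, 10, 2, 6, 3, 12, 11, 17, 7, 8, 19, 18, 9, 13, 16, 4, 5, 15, 14]
    0
    ![0, 0, -1, 0, 0, 1, -1, 0, -1, 0, 0, -1, -1, 0, 1, 0, 1, 1, 1, 0]
    1 2 1 2
    (by decide) (by decide) (by decide)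
    (by decide +kernel) (by decide +kernel) (by decide +kernel)
    (by decide +kernel) (by decide +kernel) (by decide +kernel)
    (by decide +kernel) (by decide +kernel) (by decide +kernel)

theorem infinite_tessGroup_five_three_six_four_zero : Infinite (tessGroup 5 3 6 4 0) :=
  infinite_tessGroup_of_shear (α := Fin 36)
    ![1, 5, 0, 6, 3, 13, 22, 17, 9, 20, 11, 15, 12, 2, 4, 25, 7, 29, 32, 18, 28, 34, 14, 21, 23,
     30, 8, 16, 26, 27, 10, 19, 35, 24, 33, 31]
    ![2, 0, 1, 8, 10, 13, 16, 3, 7, 4, 9, 14, 5, 12, 22, 6, 15, 26, 28, 17, 30, 25, 11, 20, 18,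
     27, 19, 21, 24, 31, 23, 34, 33, 35, 29, 32]
    ![7, 9, 15, 1, 2, 11, 0, 6, 24, 26, 27, 30, 13, 14, 12, 28, 8, 25, 3, 10, 29, 4, 5, 22, 16,
     32, 35, 19, 33, 34, 31, 23, 17, 21, 20, 18]
    ![0, 0, 0, 0, 0, 0, 0, -1, 0, -1, 0, 0, 0, 0, 0, -1, 0, -1, -1, 0, 0, -1, 0, 0, 0, 0, 1, 1, 0,
     1, 1, 1, 0, 1, 0, 0]
    0
    2 1 1 9
    (by decide) (by decide) (by decide)
    (by decide +kernel) (by decide +kernel) (by decide +kernel)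
    (by decide +kernel) (by decide +kernel) (by decide +kernel)
    (by decide +kernel) (by decide +kernel) (by decide +kernel)

theorem infinite_tessGroup_five_three_six_four_one : Infinite (tessGroup 5 3 6 4 1) :=
  infinite_tessGroup_of_shear (α := Fin 42)
    ![4, 6, 0, 7, 20, 9, 25, 26, 13, 10, 22, 1, 3, 34, 12, 2, 5, 28, 8, 29, 15, 11, 16, 27, 19,
     21, 14, 33, 23, 38, 24, 32, 39, 17, 36, 31, 18, 37, 30, 41, 40, 35]
    ![2, 0, 1, 5, 11, 8, 15, 18, 3, 12, 4, 10, 20, 16, 6, 14, 23, 7, 17, 31, 9, 27, 21, 13, 35,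
     26, 33, 22, 36, 38, 19, 30, 24, 25, 28, 32, 34, 29, 37, 41, 39, 40]
    ![8, 3, 17, 1, 9, 2, 13, 0, 30, 4, 22, 20, 10, 32, 12, 25, 14, 34, 37, 5, 15, 11, 33, 26, 23,
     27, 6, 21, 18, 7, 36, 19, 24, 16, 31, 35, 29, 41, 28, 39, 38, 40]
    ![0, 0, 0, 0, 0, 0, 0, 0, 0, 0, 0, 0, 0, 0, 0, 0, 0, 0, 0, 0, 0, 0, 0, 0, 0, 0, 0, 0, 0, 0, 0,
     0, -1, 0, 0, 0, 0, 0, 0, 0, 0, 1]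
    0
    3 1 10 2
    (by decide) (by decide) (by decide)
    (by decide +kernel) (by decide +kernel) (by decide +kernel)
    (by decide +kernel) (by decide +kernel) (by decide +kernel)
    (by decide +kernel) (by decide +kernel) (by decide +kernel)

theorem infinite_tessGroup_five_three_six_five_zero : Infinite (tessGroup 5 3 6 5 0) :=
  infinite_tessGroup_of_shear (α := Fin 26)
    ![1, 4, 6, 0, 9, 10, 16, 14, 2, 3, 15, 5, 7, 17, 19, 22, 18, 24, 8, 23, 13, 21, 11, 12, 25,
     20]
    ![0, 3, 1, 2, 8, 11, 9, 4, 7, 12, 5, 10, 6, 14, 18, 22, 23, 16, 13, 20, 24, 15, 21, 17, 19,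
     25]
    ![0, 1, 10, 2, 6, 3, 5, 18, 11, 7, 4, 12, 23, 8, 19, 14, 15, 9, 21, 25, 13, 22, 17, 20, 16,
     24]
    0
    ![0, 0, 0, 0, 0, 0, 0, -1, 0, 0, 0, 0, -1, 1, -1, 0, 0, 1, 0, -1, 1, 0, 0, -1, 1, 1]
    1 1 1 12
    (by decide) (by decide) (by decide)
    (by decide +kernel) (by decide +kernel) (by decide +kernel)
    (by decide +kernel) (by decide +kernel) (by decide +kernel)
    (by decide +kernel) (by decide +kernel) (by decide +kernel)

/-- dodecahedral cases of Table 6: the groups G_{5,3,6}(a,b) for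
(a,b) = (2,2), (3,0), (3,1), (3,2), (4,0), (4,1), (5,0) are infinite. -/
theorem tessGroup_536_special_infinite :
    Infinite (tessGroup 5 3 6 2 2) ∧ Infinite (tessGroup 5 3 6 3 0) ∧
    Infinite (tessGroup 5 3 6 3 1) ∧ Infinite (tessGroup 5 3 6 3 2) ∧
    Infinite (tessGroup 5 3 6 4 0) ∧ Infinite (tessGroup 5 3 6 4 1) ∧
    Infinite (tessGroup 5 3 6 5 0) :=
  ⟨infinite_tessGroup_five_three_six_two_two,
    infinite_tessGroup_five_three_six_three_zero,
    infinite_tessGroup_five_three_six_three_one,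
    infinite_tessGroup_five_three_six_three_two,
    infinite_tessGroup_five_three_six_four_zero,
    infinite_tessGroup_five_three_six_four_one,
    infinite_tessGroup_five_three_six_five_zero⟩
end
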